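/- Let τ = ib with b > 0 (a rectangular torus). Then: (i) for k = 1 and k = 2, equation (★_k) on E_τ has no solutions at all; (ii) for k = 3, equation (★_3) on E_τ has no non-even family of solutions. -/

import Mathlib

open Metric Set Filter Topology

noncomputable section

/-- The lattice `Λ_τ = ℤ + τℤ` as a set of complex numbers. -/
def lat (τ : ℂ) : Set ℂ := {z | ∃ m n : ℤ, z = (m : ℂ) + (n : ℂ) * τ}

/-- The lattice point `m + nτ` attached to a pair of integers. -/
def latPt (τ : ℂ) (p : ℤ × ℤ) : ℂ := (p.1 : ℂ) + (p.2 : ℂ) * τ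

/-- The Weierstrass elliptic function `℘(z|τ)`. -/
def wp (τ z : ℂ) : ℂ :=
  1 / z ^ 2 + ∑' p : {p : ℤ × ℤ // p ≠ 0},
    (1 / (z - latPt τ p.1) ^ 2 - 1 / latPt τ p.1 ^ 2)

/-- `℘′(z|τ)`. -/
def wpd (τ z : ℂ) : ℂ := deriv (wp τ) z

/-- `℘″(z|τ)`. -/
def wpdd (τ z : ℂ) : ℂ := deriv (deriv (wp τ)) z

/-- The Weierstrass zeta function `ζ(z|τ)` (odd primitive of `-℘`). -/
def wzeta (τ z : ℂ) : ℂ :=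
  1 / z + ∑' p : {p : ℤ × ℤ // p ≠ 0},
    (1 / (z - latPt τ p.1) + 1 / latPt τ p.1 + z / latPt τ p.1 ^ 2)

/-- The Weierstrass sigma function `σ(z|τ)`. -/
def wsigma (τ z : ℂ) : ℂ :=
  z * ∏' p : {p : ℤ × ℤ // p ≠ 0},
    ((1 - z / latPt τ p.1) * Complex.exp (z / latPt τ p.1 + z ^ 2 / (2 * latPt τ p.1 ^ 2)))

/-- The periods `ω₀ = 0, ω₁ = 1, ω₂ = τ, ω₃ = 1 + τ`. -/
def per (τ : ℂ) : ℕ → ℂ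
  | 0 => 0
  | 1 => 1
  | 2 => τ
  | 3 => 1 + τ
  | _ => 0

/-- `e_k(τ) = ℘(ω_k/2|τ)`. -/
def eper (τ : ℂ) (k : ℕ) : ℂ := wp τ (per τ k / 2)

/-- The quasi-period `η₁(τ) = 2ζ(1/2|τ)`. -/
def eta1 (τ : ℂ) : ℂ := 2 * wzeta τ (1 / 2)

/-- The quasi-period `η₂(τ) = 2ζ(τ/2|τ)`. -/
def eta2 (τ : ℂ) : ℂ := 2 * wzeta τ (τ / 2)

/-- `η_k(τ)`, with `η₃ = η₁ + η₂`. -/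
def etaq (τ : ℂ) : ℕ → ℂ
  | 1 => eta1 τ
  | 2 => eta2 τ
  | 3 => eta1 τ + eta2 τ
  | _ => 0

/-- The Hecke form `Z(r,s,τ) = ζ(r+sτ|τ) - r η₁(τ) - s η₂(τ)`. -/
def heckeZ (r s τ : ℂ) : ℂ := wzeta τ (r + s * τ) - r * eta1 τ - s * eta2 τ

/-- The pre-modular form `Z^{(𝐦_k)}(r,s,τ) = Z(r,s,τ)² - ℘(r+sτ|τ) + e_k(τ)`. -/
def heckeZm (k : ℕ) (r s τ : ℂ) : ℂ := heckeZ r s τ ^ 2 - wp τ (r + s * τ) + eper τ k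

/-- First component of `(r_k, s_k)`. -/
def rkr (k : ℕ) (r : ℂ) : ℂ := if k = 2 then r else r + 1 / 2

/-- Second component of `(r_k, s_k)`. -/
def rks (k : ℕ) (s : ℂ) : ℂ := if k = 1 then s else s + 1 / 2

/-- `(r,s)` is a half-integer pair, i.e. belongs to `(1/2)ℤ²`. -/
def IsHalfIntPair (r s : ℂ) : Prop := ∃ m n : ℤ, r = (m : ℂ) / 2 ∧ s = (n : ℂ) / 2

/-- The singular set of the curvature equation: lattice translates of the points `ω_k/2`
with `m_k ≥ 1`. -/
def singSet (τ : ℂ) (m : Fin 4 → ℕ) : Set ℂ :=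
  {z | ∃ k : Fin 4, 1 ≤ m k ∧ ∃ l ∈ lat τ, z = per τ (k : ℕ) / 2 + l}

/-- The Laplacian of a real-valued function on `ℂ ≃ ℝ²`. -/
def lapl (u : ℂ → ℝ) (z : ℂ) : ℝ :=
  fderiv ℝ (fun w => fderiv ℝ u w (1 : ℂ)) z (1 : ℂ) +
  fderiv ℝ (fun w => fderiv ℝ u w Complex.I) z Complex.I

/-- `u` is a solution of the curvature equation `Δu + e^u = 8π Σ m_k δ_{ω_k/2}` on `E_τ`. -/
def IsCurvatureSolution (τ : ℂ) (m : Fin 4 → ℕ) (u : ℂ → ℝ) : Prop :=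
  (∀ z, u (z + 1) = u z) ∧ (∀ z, u (z + τ) = u z) ∧
  (∀ z ∉ singSet τ m, (∀ n : ℕ, ContDiffAt ℝ n u z) ∧ lapl u z + Real.exp (u z) = 0) ∧
  (∀ k : Fin 4, 1 ≤ m k → ∀ l ∈ lat τ,
    ∃ C ε : ℝ, 0 < ε ∧ ∀ z : ℂ, z ≠ per τ (k : ℕ) / 2 + l →
      dist z (per τ (k : ℕ) / 2 + l) < ε →
      |u z - 4 * (m k : ℝ) * Real.log (dist z (per τ (k : ℕ) / 2 + l))| ≤ C)

/-- Multiplicities for equation `(★_k)`: `m₀ = m_k = 1`, the others `0`. -/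
def starM (k : ℕ) : Fin 4 → ℕ := fun j => if (j : ℕ) = 0 ∨ (j : ℕ) = k then 1 else 0

/-- `f` is a developing map of `u`: `f` is meromorphic on `ℂ` and
`u = log (8|f′|²/(1+|f|²)²)` wherever `f` is analytic with nonvanishing derivative. -/
def IsDevelopingMapOf (u : ℂ → ℝ) (f : ℂ → ℂ) : Prop :=
  (∀ z : ℂ, MeromorphicAt f z) ∧
  ∀ z : ℂ, AnalyticAt ℂ f z → deriv f z ≠ 0 →
    u z = Real.log (8 * ‖deriv f z‖ ^ 2 / (1 + ‖f z‖ ^ 2) ^ 2)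

/-- `f` satisfies the type II constraint for the torus `E_τ`. -/
def IsTypeII (τ : ℂ) (f : ℂ → ℂ) : Prop :=
  ∃ θ₁ θ₂ : ℝ,
    (∀ z, f (z + 1) = Complex.exp (2 * Complex.I * (θ₁ : ℂ)) * f z) ∧
    (∀ z, f (z + τ) = Complex.exp (2 * Complex.I * (θ₂ : ℂ)) * f z)

/-- The one-parameter family of solutions generated by the developing map `f`
(with members `u_β` having developing map `e^β f`) contains an even solution. -/
def FamilyHasEven (τ : ℂ) (m : Fin 4 → ℕ) (f : ℂ → ℂ) : Prop :=
  ∃ (β : ℝ) (v : ℂ → ℝ), IsCurvatureSolution τ m v ∧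
    IsDevelopingMapOf v (fun z => (Real.exp β : ℂ) * f z) ∧ ∀ z, v (-z) = v z

/-- `u`, with type II developing map `f`, generates a non-even family of solutions. -/
def GeneratesNonEvenFamily (τ : ℂ) (m : Fin 4 → ℕ) (u : ℂ → ℝ) (f : ℂ → ℂ) : Prop :=
  IsCurvatureSolution τ m u ∧ IsDevelopingMapOf u f ∧ IsTypeII τ f ∧ ¬ FamilyHasEven τ m f

/-- The curvature equation has a non-even family of solutions. -/
def HasNonEvenFamily (τ : ℂ) (m : Fin 4 → ℕ) : Prop :=
  ∃ u f, GeneratesNonEvenFamily τ m u f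

/-- The curvature equation has an even family of solutions. -/
def HasEvenFamily (τ : ℂ) (m : Fin 4 → ℕ) : Prop :=
  ∃ (u : ℂ → ℝ) (f : ℂ → ℂ), IsCurvatureSolution τ m u ∧ IsDevelopingMapOf u f ∧
    IsTypeII τ f ∧ FamilyHasEven τ m f

/-- `y` is a (meromorphic, global) solution of `y″ = q·y` away from the singular set `S`. -/
def SolvesODEOn (q : ℂ → ℂ) (S : Set ℂ) (y : ℂ → ℂ) : Prop :=
  (∀ z : ℂ, MeromorphicAt y z) ∧
  ∀ z ∉ S, AnalyticAt ℂ y z ∧ deriv (deriv y) z = q z * y z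

/-- Linear independence of two functions, tested away from the singular set `S`. -/
def LinIndepOn (S : Set ℂ) (y₁ y₂ : ℂ → ℂ) : Prop :=
  ∀ a b : ℂ, (∀ z ∉ S, a * y₁ z + b * y₂ z = 0) → a = 0 ∧ b = 0

/-- The equation `y″ = q·y` (with singular set `S`) on `E_τ` has unitary monodromy: there is a
fundamental system of solutions whose monodromy matrices w.r.t. `z ↦ z+1` and `z ↦ z+τ`
lie in `SU(2)`. -/
def HasUnitaryMonodromy (q : ℂ → ℂ) (S : Set ℂ) (τ : ℂ) : Prop :=
  ∃ y₁ y₂ : ℂ → ℂ, SolvesODEOn q S y₁ ∧ SolvesODEOn q S y₂ ∧ LinIndepOn S y₁ y₂ ∧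
    ∃ M₁ M₂ : Matrix (Fin 2) (Fin 2) ℂ,
      M₁ ∈ Matrix.unitaryGroup (Fin 2) ℂ ∧ M₁.det = 1 ∧
      M₂ ∈ Matrix.unitaryGroup (Fin 2) ℂ ∧ M₂.det = 1 ∧
      (∀ z, y₁ (z + 1) = M₁ 0 0 * y₁ z + M₁ 0 1 * y₂ z) ∧
      (∀ z, y₂ (z + 1) = M₁ 1 0 * y₁ z + M₁ 1 1 * y₂ z) ∧
      (∀ z, y₁ (z + τ) = M₂ 0 0 * y₁ z + M₂ 0 1 * y₂ z) ∧
      (∀ z, y₂ (z + τ) = M₂ 1 0 * y₁ z + M₂ 1 1 * y₂ z)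

/-- The potential of the Fuchsian equation `L(𝐦_k, T, E, τ)`. -/
def LPot (k : ℕ) (T E τ : ℂ) (z : ℂ) : ℂ :=
  2 * wp τ z + 2 * wp τ (z - per τ k / 2) +
    T * (wzeta τ (z - per τ k / 2) - wzeta τ z) - E

/-- The singular set of `L(𝐦_k, T, E, τ)`: lattice translates of `0` and `ω_k/2`. -/
def LSing (τ : ℂ) (k : ℕ) : Set ℂ := {z | ∃ l ∈ lat τ, z = l ∨ z = per τ k / 2 + l}

/-- The equation `y″ = q·y` is apparent (free of logarithmic singularity) at `p`: there are two
linearly independent single-valued solutions on a punctured neighborhood of `p`, both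
meromorphic at `p`. -/
def ApparentAt (q : ℂ → ℂ) (p : ℂ) : Prop :=
  ∃ (y₁ y₂ : ℂ → ℂ) (ε : ℝ), 0 < ε ∧
    (∀ z ∈ Metric.ball p ε, z ≠ p →
      AnalyticAt ℂ y₁ z ∧ AnalyticAt ℂ y₂ z ∧
      deriv (deriv y₁) z = q z * y₁ z ∧ deriv (deriv y₂) z = q z * y₂ z) ∧
    MeromorphicAt y₁ p ∧ MeromorphicAt y₂ p ∧
    ∀ a b : ℂ, (∀ z ∈ Metric.ball p ε, z ≠ p → a * y₁ z + b * y₂ z = 0) → a = 0 ∧ b = 0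

/-- The translated (even) potential `q_k(z;T,E)` of `L(𝐦_k, T, E, τ)`. -/
def qPot (k : ℕ) (T E τ : ℂ) (z : ℂ) : ℂ :=
  2 * (wp τ (z + per τ k / 4) + wp τ (z - per τ k / 4)) +
    T * (wzeta τ (z + per τ k / 4) - wzeta τ (z - per τ k / 4)) - E

/-- The singular set of the translated potential: lattice translates of `±ω_k/4`. -/
def qSing (τ : ℂ) (k : ℕ) : Set ℂ :=
  {z | ∃ l ∈ lat τ, z = per τ k / 4 + l ∨ z = -(per τ k / 4) + l}

/-- The even elliptic solution `Φ_e(z;T,E)` of the second symmetric product equation. -/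
def PhiE (τ : ℂ) (k : ℕ) (T E : ℂ) (z : ℂ) : ℂ :=
  (wpd τ (per τ k / 4)) ^ 4 / (wp τ z - wp τ (per τ k / 4)) ^ 2 +
  (wpd τ (per τ k / 4)) ^ 2 * (wpd τ (per τ k / 4) * T + wpdd τ (per τ k / 4)) /
      (wp τ z - wp τ (per τ k / 4)) +
  (1 / 4) * (4 * (wpd τ (per τ k / 4)) ^ 2 * E + 3 * (wpd τ (per τ k / 4)) ^ 2 * T ^ 2
    - 8 * wzeta τ (per τ k / 4) * (wpd τ (per τ k / 4)) ^ 2 * T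
    + 32 * wp τ (per τ k / 4) * (wpd τ (per τ k / 4)) ^ 2
    - 3 * (wpdd τ (per τ k / 4)) ^ 2)

/-- For `k ∈ {1,2,3}`, the other two indices, so that `{k, i, i′} = {1,2,3}`. -/
def otherTwo : ℕ → ℕ × ℕ
  | 1 => (2, 3)
  | 2 => (1, 3)
  | 3 => (1, 2)
  | _ => (0, 0)

/-- The Wirtinger derivative `∂_z g = (1/2)(∂_x g - i ∂_y g)`. -/
def wirt (g : ℂ → ℂ) (z : ℂ) : ℂ :=
  (1 / 2) * (fderiv ℝ g z (1 : ℂ) - Complex.I * fderiv ℝ g z Complex.I)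

/-- The potential `q(z) = -(1/2)(u_zz - (1/2) u_z²)` associated with a solution `u`. -/
def uPot (u : ℂ → ℝ) (z : ℂ) : ℂ :=
  -(1 / 2) * (wirt (wirt (fun w => ((u w : ℝ) : ℂ))) z -
    (1 / 2) * (wirt (fun w => ((u w : ℝ) : ℂ)) z) ^ 2)

/-- All lattice translates of the four half-periods. -/
def fullSing (τ : ℂ) : Set ℂ := {z | ∃ k : Fin 4, ∃ l ∈ lat τ, z = per τ (k : ℕ) / 2 + l}

/-- The potential of the general Fuchsian equation (with residues `T₁, T₂, T₃`). -/
def q8 (τ : ℂ) (m : Fin 4 → ℕ) (T₁ T₂ T₃ E : ℂ) (z : ℂ) : ℂ :=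
  (∑ k : Fin 4, (m k : ℂ) * ((m k : ℂ) + 1) * wp τ (z - per τ (k : ℕ) / 2)) +
  T₁ * (wzeta τ (z - per τ 1 / 2) - wzeta τ z) +
  T₂ * (wzeta τ (z - per τ 2 / 2) - wzeta τ z) +
  T₃ * (wzeta τ (z - per τ 3 / 2) - wzeta τ z) - E

/-- The elliptic-of-the-second-kind ansatz built from sigma functions. -/
def sigY (τ : ℂ) (k : ℕ) (a₁ a₂ c : ℂ) (z : ℂ) : ℂ :=
  Complex.exp (c * z) * wsigma τ (z - a₁) * wsigma τ (z - a₂) /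
    (wsigma τ (z - per τ k / 4) * wsigma τ (z + per τ k / 4))

end


section
set_option linter.all false
open scoped ComplexConjugate Real
open Complex (I)

noncomputable def WL (a b : ℂ) : ℂ →L[ℝ] ℂ :=
  a • (ContinuousLinearMap.id ℝ ℂ) + b • (Complex.conjCLE : ℂ →L[ℝ] ℂ)
def HasW (g : ℂ → ℂ) (a b z : ℂ) : Prop := HasFDerivAt g (WL a b) z

lemma WL_apply (a b v : ℂ) : WL a b v = a * v + b * conj v := by
  simp [WL]
lemma HasW.add {g k : ℂ → ℂ} {a b c d z : ℂ} (h1 : HasW g a b z) (h2 : HasW k c d z) :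
    HasW (fun w => g w + k w) (a + c) (b + d) z := by
  have := HasFDerivAt.add h1 h2
  refine this.congr_fderiv ?_
  ext v <;> simp [WL_apply] <;> ring
lemma HasW.mul {g k : ℂ → ℂ} {a b c d z : ℂ} (h1 : HasW g a b z) (h2 : HasW k c d z) :
    HasW (fun w => g w * k w) (a * k z + g z * c) (b * k z + g z * d) z := by
  have := HasFDerivAt.mul h1 h2
  refine this.congr_fderiv ?_
  apply ContinuousLinearMap.ext
  intro v
  simp [WL_apply]; ring
lemma HasW.conj {g : ℂ → ℂ} {a b z : ℂ} (h1 : HasW g a b z) :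
    HasW (fun w => conj (g w)) (conj b) (conj a) z := by
  have := (Complex.conjCLE : ℂ →L[ℝ] ℂ).hasFDerivAt.comp z h1
  refine this.congr_fderiv ?_
  apply ContinuousLinearMap.ext
  intro v
  simp [WL_apply]; ring
lemma HasDerivAt.hasW {g : ℂ → ℂ} {a z : ℂ} (h : HasDerivAt g a z) : HasW g a 0 z := by
  refine (h.hasFDerivAt.restrictScalars ℝ).congr_fderiv ?_
  apply ContinuousLinearMap.ext
  intro v
  simp [WL_apply, mul_comm]
lemma HasW.const (c z : ℂ) : HasW (fun _ => c) 0 0 z := (hasDerivAt_const z c).hasW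
lemma HasW.comp {g φ : ℂ → ℂ} {a b p z : ℂ} (h1 : HasW g a b (φ z)) (h2 : HasDerivAt φ p z) :
    HasW (fun w => g (φ w)) (a * p) (b * conj p) z := by
  have := HasFDerivAt.comp z h1 h2.hasW
  refine this.congr_fderiv ?_
  apply ContinuousLinearMap.ext
  intro v
  simp [WL_apply]; ring
lemma HasW.to {g : ℂ → ℂ} {a b a' b' z : ℂ} (h : HasW g a b z) (ha : a = a') (hb : b = b') :
    HasW g a' b' z := by subst ha hb; exact h
lemma HasW.hasDerivAt {g : ℂ → ℂ} {a z : ℂ} (h : HasW g a 0 z) : HasDerivAt g a z := by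
  have hd : DifferentiableAt ℂ g z := by
    rw [differentiableAt_complex_iff_differentiableAt_real]
    refine ⟨h.differentiableAt, ?_⟩
    rw [HasFDerivAt.fderiv h]
    simp [WL_apply, mul_comm]
  have h2 := hd.hasDerivAt
  have := (HasFDerivAt.unique h2.hasW h)
  have h3 := congrArg (fun L => L 1) this
  simp [WL_apply] at h3
  rwa [← h3]
lemma HasW.uniq {g : ℂ → ℂ} {a b a' b' z : ℂ} (h : HasW g a b z) (h' : HasW g a' b' z) :
    a = a' ∧ b = b' := by
  have := (HasFDerivAt.unique h h')
  have h1 := congrArg (fun L => L 1) this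
  have h2 := congrArg (fun L => L I) this
  simp only [WL_apply, map_one, Complex.conj_I, mul_one] at h1 h2
  have e : a - b = a' - b' := by
    have : I * (a - b) = I * (a' - b') := by linear_combination h2
    exact mul_left_cancel₀ Complex.I_ne_zero this
  constructor
  · linear_combination (h1 + e) / 2
  · linear_combination (h1 - e) / 2
lemma HasW.congr {g k : ℂ → ℂ} {a b z : ℂ} (h : HasW g a b z) (e : k =ᶠ[𝓝 z] g) :
    HasW k a b z := HasFDerivAt.congr_of_eventuallyEq h e
lemma HasW.eq_const {U : Set ℂ} (hU : IsOpen U) (hc : IsPreconnected U) {g : ℂ → ℂ}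
    (h : ∀ z ∈ U, HasW g 0 0 z) {x y : ℂ} (hx : x ∈ U) (hy : y ∈ U) : g x = g y := by
  refine hU.is_const_of_fderiv_eq_zero (𝕜 := ℝ) hc
    (fun z hz => (HasFDerivAt.differentiableAt (h z hz)).differentiableWithinAt) ?_ hx hy
  intro z hz
  rw [HasFDerivAt.fderiv (h z hz)]
  apply ContinuousLinearMap.ext; intro v; simp [WL_apply]
structure Pot (U : Set ℂ) (Q h h1 h12 : ℂ → ℂ) (c : ℝ) : Prop where
  opn : IsOpen U
  d0 : ∀ z ∈ U, HasW h (h1 z) (conj (h1 z)) z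
  d1 : ∀ z ∈ U, HasW h1 (Q z * h z) (h12 z) z
  d2 : ∀ z ∈ U, HasW h12 (Q z * conj (h1 z)) (conj (Q z) * h1 z) z
  re0 : ∀ z ∈ U, conj (h z) = h z
  re12 : ∀ z ∈ U, conj (h12 z) = h12 z
  pos : ∀ z ∈ U, 0 < (h z).re
  cpos : 0 < c
  cc : ∀ z ∈ U, h z * h12 z - h1 z * conj (h1 z) = c
lemma Pot.hre {U Q h h1 h12 c} (P : Pot U Q h h1 h12 c) {z} (hz : z ∈ U) :
    (((h z).re : ℝ) : ℂ) = h z := Complex.conj_eq_iff_re.1 (P.re0 z hz)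
lemma pos_of_id {h K a b : ℂ} {c : ℝ} (hh : conj h = h) (hp : 0 < h.re) (hc : 0 < c)
    (hK : h * K = a * conj a + c * (b * conj b)) (hK' : conj K = K) (hab : a ≠ 0 ∨ b ≠ 0) :
    0 < K.re := by
  rw [← Complex.conj_eq_iff_re.1 hh, ← Complex.conj_eq_iff_re.1 hK', Complex.mul_conj,
    Complex.mul_conj] at hK
  have : h.re * K.re = Complex.normSq a + c * Complex.normSq b := by exact_mod_cast hK
  have h3 : 0 < h.re * K.re := by
    rw [this]
    rcases hab with h | h
    · have := Complex.normSq_pos.2 h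
      have := Complex.normSq_nonneg b
      positivity
    · have := Complex.normSq_pos.2 h
      have := Complex.normSq_nonneg a
      positivity
  exact (pos_iff_pos_of_mul_pos h3).1 hp
lemma Pot.mono {U V Q h h1 h12 c} (P : Pot U Q h h1 h12 c) (hV : IsOpen V) (hVU : V ⊆ U) :
    Pot V Q h h1 h12 c :=
  ⟨hV, fun z hz => P.d0 z (hVU hz), fun z hz => P.d1 z (hVU hz), fun z hz => P.d2 z (hVU hz),
   fun z hz => P.re0 z (hVU hz), fun z hz => P.re12 z (hVU hz), fun z hz => P.pos z (hVU hz),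
   P.cpos, fun z hz => P.cc z (hVU hz)⟩
lemma Pot.congrQ {U Q Q' h h1 h12 c} (P : Pot U Q h h1 h12 c) (hQ : ∀ z ∈ U, Q' z = Q z) :
    Pot U Q' h h1 h12 c :=
  ⟨P.opn, P.d0, fun z hz => by rw [hQ z hz]; exact P.d1 z hz,
   fun z hz => by rw [hQ z hz]; exact P.d2 z hz, P.re0, P.re12, P.pos, P.cpos, P.cc⟩
lemma Pot.trans {U V : Set ℂ} {Q h h1 h12 : ℂ → ℂ} {c : ℝ} (P : Pot U Q h h1 h12 c)
    (hV : IsOpen V) {φ φd α β γ δ Q' : ℂ → ℂ} {D : ℂ} (hD : D ≠ 0)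
    (hφU : ∀ z ∈ V, φ z ∈ U) (hφ : ∀ z ∈ V, HasDerivAt φ (φd z) z)
    (hα : ∀ z ∈ V, HasDerivAt α (γ z - β z * φd z * Q (φ z)) z)
    (hβ : ∀ z ∈ V, HasDerivAt β (δ z - α z * φd z) z)
    (hγ : ∀ z ∈ V, HasDerivAt γ (Q' z * α z - δ z * φd z * Q (φ z)) z)
    (hδ : ∀ z ∈ V, HasDerivAt δ (Q' z * β z - γ z * φd z) z)
    (hdet : ∀ z ∈ V, α z * δ z - β z * γ z = D) :
    Pot V Q'
      (fun z => α z * conj (α z) * h (φ z) + α z * conj (β z) * conj (h1 (φ z)) +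
        β z * conj (α z) * h1 (φ z) + β z * conj (β z) * h12 (φ z))
      (fun z => γ z * conj (α z) * h (φ z) + γ z * conj (β z) * conj (h1 (φ z)) +
        δ z * conj (α z) * h1 (φ z) + δ z * conj (β z) * h12 (φ z))
      (fun z => γ z * conj (γ z) * h (φ z) + γ z * conj (δ z) * conj (h1 (φ z)) +
        δ z * conj (γ z) * h1 (φ z) + δ z * conj (δ z) * h12 (φ z))
      (c * Complex.normSq D) := by
  have e0 := fun z (hz : z ∈ V) => P.re0 _ (hφU z hz)
  have e12 := fun z (hz : z ∈ V) => P.re12 _ (hφU z hz)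
  have D0 := fun z (hz : z ∈ V) => (P.d0 _ (hφU z hz)).comp (hφ z hz)
  have D1 := fun z (hz : z ∈ V) => (P.d1 _ (hφU z hz)).comp (hφ z hz)
  have D2 := fun z (hz : z ∈ V) => (P.d2 _ (hφU z hz)).comp (hφ z hz)
  refine ⟨hV, ?_, ?_, ?_, ?_, ?_, ?_, ?_, ?_⟩
  · intro z hz
    have a := (hα z hz).hasW
    have b := (hβ z hz).hasW
    refine (((((a.mul a.conj).mul (D0 z hz)).add ((a.mul b.conj).mul (D1 z hz).conj)).add
      ((b.mul a.conj).mul (D1 z hz))).add ((b.mul b.conj).mul (D2 z hz))).to ?_ ?_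
    · simp only [map_mul, map_add, map_sub, map_zero, Complex.conj_conj, e0 z hz, e12 z hz]; ring
    · simp only [map_mul, map_add, map_sub, map_zero, Complex.conj_conj, e0 z hz, e12 z hz]; ring
  · intro z hz
    have a := (hα z hz).hasW
    have b := (hβ z hz).hasW
    have g := (hγ z hz).hasW
    have d := (hδ z hz).hasW
    refine (((((g.mul a.conj).mul (D0 z hz)).add ((g.mul b.conj).mul (D1 z hz).conj)).add
      ((d.mul a.conj).mul (D1 z hz))).add ((d.mul b.conj).mul (D2 z hz))).to ?_ ?_
    · simp only [map_mul, map_add, map_sub, map_zero, Complex.conj_conj, e0 z hz, e12 z hz]; ring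
    · simp only [map_mul, map_add, map_sub, map_zero, Complex.conj_conj, e0 z hz, e12 z hz]; ring
  · intro z hz
    have g := (hγ z hz).hasW
    have d := (hδ z hz).hasW
    refine (((((g.mul g.conj).mul (D0 z hz)).add ((g.mul d.conj).mul (D1 z hz).conj)).add
      ((d.mul g.conj).mul (D1 z hz))).add ((d.mul d.conj).mul (D2 z hz))).to ?_ ?_
    · simp only [map_mul, map_add, map_sub, map_zero, Complex.conj_conj, e0 z hz, e12 z hz]; ring
    · simp only [map_mul, map_add, map_sub, map_zero, Complex.conj_conj, e0 z hz, e12 z hz]; ring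
  · intro z hz
    simp only [map_mul, map_add, Complex.conj_conj, e0 z hz, e12 z hz]; ring
  · intro z hz
    simp only [map_mul, map_add, Complex.conj_conj, e0 z hz, e12 z hz]; ring
  · intro z hz
    refine pos_of_id (h := h (φ z)) (c := c) (a := α z * h (φ z) + β z * h1 (φ z)) (b := β z)
      (e0 z hz) (P.pos _ (hφU z hz)) P.cpos ?_ ?_ ?_
    · simp only [map_mul, map_add, Complex.conj_conj, e0 z hz]
      rw [← P.cc _ (hφU z hz)]; ring
    · simp only [map_mul, map_add, Complex.conj_conj, e0 z hz, e12 z hz]; ring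
    · by_contra hcon
      push Not at hcon
      obtain ⟨h1', h2'⟩ := hcon
      rw [h2', zero_mul, add_zero] at h1'
      have hh : h (φ z) ≠ 0 := by
        intro h0; have := P.pos _ (hφU z hz); rw [h0] at this; simp at this
      have ha : α z = 0 := by simpa [hh] using h1'
      have := hdet z hz
      rw [ha, h2'] at this
      apply hD; rw [← this]; ring
  · have := Complex.normSq_pos.2 hD
    have := P.cpos
    positivity
  · intro z hz
    simp only [map_mul, map_add, Complex.conj_conj, e0 z hz, e12 z hz]
    push_cast
    rw [Complex.normSq_eq_conj_mul_self, ← P.cc _ (hφU z hz), ← hdet z hz]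
    simp only [map_mul, map_sub]; ring
noncomputable def Bf (h h1 h12 y y1 : ℂ → ℂ) (z : ℂ) : ℂ :=
  h z * (y1 z * conj (y1 z)) - conj (h1 z) * (y1 z * conj (y z)) - h1 z * (y z * conj (y1 z))
    + h12 z * (y z * conj (y z))
noncomputable def Df (h h1 y y1 : ℂ → ℂ) (z : ℂ) : ℂ :=
  h z * conj (y1 z) - conj (h1 z) * conj (y z)
noncomputable def Df1 (h1 h12 y y1 : ℂ → ℂ) (z : ℂ) : ℂ :=
  h1 z * conj (y1 z) - h12 z * conj (y z)
section
variable {U : Set ℂ} {Q h h1 h12 y y1 : ℂ → ℂ} {c : ℝ} {z : ℂ}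
lemma Pot.df (P : Pot U Q h h1 h12 c) (hz : z ∈ U)
    (hy : HasDerivAt y (y1 z) z) (hy1 : HasDerivAt y1 (Q z * y z) z) :
    HasDerivAt (Df h h1 y y1) (Df1 h1 h12 y y1 z) z := by
  apply HasW.hasDerivAt
  have e := (((P.d0 z hz).mul hy1.hasW.conj).add
    ((HasW.const (-1) z).mul ((P.d1 z hz).conj.mul hy.hasW.conj)))
  refine (e.congr (Eventually.of_forall fun w => ?_)).to ?_ ?_
  · simp only [Df]; ring
  · simp only [Df1, map_mul, map_zero, P.re12 z hz]; ring
  · simp only [map_mul, P.re0 z hz]; ring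
lemma Pot.df1 (P : Pot U Q h h1 h12 c) (hz : z ∈ U)
    (hy : HasDerivAt y (y1 z) z) (hy1 : HasDerivAt y1 (Q z * y z) z) :
    HasDerivAt (Df1 h1 h12 y y1) (Q z * Df h h1 y y1 z) z := by
  apply HasW.hasDerivAt
  have e := (((P.d1 z hz).mul hy1.hasW.conj).add
    ((HasW.const (-1) z).mul ((P.d2 z hz).mul hy.hasW.conj)))
  refine (e.congr (Eventually.of_forall fun w => ?_)).to ?_ ?_
  · simp only [Df1]; ring
  · simp only [Df, map_zero]; ring
  · simp only [map_mul]; ring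
lemma Bf_eq : Bf h h1 h12 y y1 z = Df h h1 y y1 z * y1 z - Df1 h1 h12 y y1 z * y z := by
  simp only [Bf, Df, Df1]; ring
lemma Pot.bf_id (P : Pot U Q h h1 h12 c) (hz : z ∈ U) :
    h z * Bf h h1 h12 y y1 z =
      Df h h1 y y1 z * conj (Df h h1 y y1 z) + c * (y z * conj (y z)) := by
  simp only [Bf, Df, map_mul, map_sub, Complex.conj_conj, P.re0 z hz]
  rw [← P.cc z hz]; ring
lemma Pot.bf_conj (P : Pot U Q h h1 h12 c) (hz : z ∈ U) :
    conj (Bf h h1 h12 y y1 z) = Bf h h1 h12 y y1 z := by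
  simp only [Bf, map_mul, map_sub, map_add, Complex.conj_conj, P.re0 z hz, P.re12 z hz]
  ring
lemma Pot.bf_d (P : Pot U Q h h1 h12 c) (hz : z ∈ U)
    (hy : HasDerivAt y (y1 z) z) (hy1 : HasDerivAt y1 (Q z * y z) z) :
    HasW (Bf h h1 h12 y y1) 0 0 z := by
  have e : HasDerivAt (Bf h h1 h12 y y1) 0 z := by
    have := ((P.df hz hy hy1).mul hy1).sub ((P.df1 hz hy hy1).mul hy)
    have e2 := this.congr_of_eventuallyEq (f₁ := Bf h h1 h12 y y1)
      (Eventually.of_forall fun w => by simp only [Bf_eq]; rfl)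
    exact e2.congr_deriv (by ring)
  exact e.hasW
lemma Pot.bf_pos (P : Pot U Q h h1 h12 c) (hz : z ∈ U) (hy : y z ≠ 0 ∨ y1 z ≠ 0) :
    0 < (Bf h h1 h12 y y1 z).re := by
  refine pos_of_id (P.re0 z hz) (P.pos z hz) P.cpos (P.bf_id hz) (P.bf_conj hz) ?_
  by_contra hcon
  push Not at hcon
  obtain ⟨h1', h2'⟩ := hcon
  have hh : h z ≠ 0 := by
    intro h0; have := P.pos z hz; rw [h0] at this; simp at this
  simp only [Df, h2', map_zero, mul_zero, sub_zero, mul_eq_zero, hh, false_or,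
    map_eq_zero] at h1'
  exact hy.elim (fun h => h h2') (fun h => h h1')
end
def Bd (c : ℕ → ℂ) : Prop := ∀ ρ : ℝ, 0 < ρ → ρ < 1 → ∃ M : ℝ, ∀ n, ‖c n‖ * ρ ^ n ≤ M
lemma Bd.summable {c : ℕ → ℂ} (h : Bd c) {r : ℝ} (hr0 : 0 ≤ r) (hr : r < 1) :
    Summable (fun n => ‖c n‖ * r ^ n) := by
  obtain ⟨ρ, h1, h2⟩ := exists_between hr
  have hρ : 0 < ρ := lt_of_le_of_lt hr0 h1
  obtain ⟨M, hM⟩ := h ρ hρ h2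
  have : Summable (fun n : ℕ => M * (r / ρ) ^ n) :=
    (summable_geometric_of_lt_one (by positivity) ((div_lt_one hρ).2 h1)).mul_left M
  refine Summable.of_nonneg_of_le (fun n => by positivity) (fun n => ?_) this
  have e : ‖c n‖ * r ^ n = (‖c n‖ * ρ ^ n) * (r / ρ) ^ n := by
    rw [div_pow]; field_simp
  rw [e]
  exact mul_le_mul_of_nonneg_right (hM n) (by positivity)
lemma Bd.shift {c : ℕ → ℂ} (h : Bd c) : Bd (fun n => ((n : ℂ) + 1) * c (n + 1)) := by
  intro ρ h0 h1
  obtain ⟨r, h2, h3⟩ := exists_between h1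
  have hr : 0 < r := h0.trans h2
  obtain ⟨M, hM⟩ := h r hr h3
  have hs : Summable (fun n : ℕ => (n : ℝ) ^ 1 * (ρ / r) ^ n) :=
    summable_pow_mul_geometric_of_norm_lt_one 1 (by
      rw [Real.norm_eq_abs, abs_of_pos (by positivity)]; exact (div_lt_one hr).2 h2)
  have hs0 : Summable (fun n : ℕ => (ρ / r) ^ n) :=
    summable_geometric_of_lt_one (by positivity) ((div_lt_one hr).2 h2)
  obtain ⟨N, hN⟩ := (hs.add hs0).tendsto_atTop_zero.bddAbove_range
  have hM0 : 0 ≤ M := le_trans (by positivity) (hM 0)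
  refine ⟨N * M / r, fun n => ?_⟩
  have e : ‖((n : ℂ) + 1) * c (n + 1)‖ * ρ ^ n =
      (((n : ℝ) ^ 1 * (ρ / r) ^ n + (ρ / r) ^ n) * (‖c (n + 1)‖ * r ^ (n + 1))) / r := by
    have : ‖(n : ℂ) + 1‖ = (n : ℝ) + 1 := by
      have : (n : ℂ) + 1 = ((n + 1 : ℕ) : ℂ) := by push_cast; rfl
      rw [this, Complex.norm_natCast]; push_cast; rfl
    rw [norm_mul, this, div_pow, pow_succ r n]; field_simp
  rw [e]
  have hN' := hN ⟨n, rfl⟩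
  simp only at hN'
  gcongr
  · exact le_trans (by positivity) hN'
  · exact hM (n + 1)
noncomputable def psum (c : ℕ → ℂ) (z : ℂ) : ℂ := ∑' n, c n * z ^ n
lemma Bd.hasDerivAt {c : ℕ → ℂ} (h : Bd c) {z : ℂ} (hz : ‖z‖ < 1) :
    HasDerivAt (psum c) (psum (fun n => ((n : ℂ) + 1) * c (n + 1)) z) z := by
  obtain ⟨r, h1, h2⟩ := exists_between hz
  have hr0 : 0 ≤ r := (norm_nonneg z).trans h1.le
  have hs1 := h.shift.summable hr0 h2
  have hu : Summable (fun n : ℕ => (n : ℝ) * ‖c n‖ * r ^ (n - 1)) := by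
    rw [← summable_nat_add_iff 1]
    refine hs1.congr fun n => ?_
    have : ‖(n : ℂ) + 1‖ = (n : ℝ) + 1 := by
      have : (n : ℂ) + 1 = ((n + 1 : ℕ) : ℂ) := by push_cast; rfl
      rw [this, Complex.norm_natCast]; push_cast; rfl
    rw [norm_mul, this]; push_cast; simp
  have key := hasDerivAt_tsum_of_isPreconnected (𝕜 := ℂ) (F := ℂ)
    (g := fun n z => c n * z ^ n) (g' := fun n z => c n * ((n : ℂ) * z ^ (n - 1)))
    (y₀ := 0) (y := z) hu (isOpen_ball (x := (0 : ℂ)) (ε := r))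
    (convex_ball (0 : ℂ) r).isPreconnected
    (fun n y _ => (hasDerivAt_pow n y).const_mul (c n)) ?_ ?_ ?_ ?_
  · refine key.congr_deriv ?_
    have hsum : Summable (fun n : ℕ => c n * ((n : ℂ) * z ^ (n - 1))) := by
      refine Summable.of_norm_bounded hu fun n => ?_
      rw [norm_mul, norm_mul, norm_pow, Complex.norm_natCast]
      have : ‖z‖ ^ (n - 1) ≤ r ^ (n - 1) := by gcongr
      calc ‖c n‖ * ((n : ℝ) * ‖z‖ ^ (n - 1)) ≤ ‖c n‖ * ((n : ℝ) * r ^ (n - 1)) := by gcongr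
        _ = _ := by ring
    rw [hsum.tsum_eq_zero_add]
    simp only [psum, Nat.cast_zero, zero_mul, mul_zero, zero_add, Nat.add_sub_cancel]
    refine tsum_congr fun n => ?_
    push_cast; ring
  · intro n y hy
    rw [mem_ball_zero_iff] at hy
    rw [norm_mul, norm_mul, norm_pow, Complex.norm_natCast]
    calc ‖c n‖ * ((n : ℝ) * ‖y‖ ^ (n - 1)) ≤ ‖c n‖ * ((n : ℝ) * r ^ (n - 1)) := by gcongr
      _ = _ := by ring
  · rw [mem_ball_zero_iff, norm_zero]; exact lt_of_le_of_lt (norm_nonneg z) h1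
  · refine (summable_of_ne_finset_zero (s := {0}) ?_)
    intro n hn
    have : n ≠ 0 := by simpa using hn
    simp [this]
  · rw [mem_ball_zero_iff]; exact h1
lemma psum_zero (c : ℕ → ℂ) : psum c 0 = c 0 := by
  rw [psum, tsum_eq_single 0]
  · simp
  · intro n hn; simp [hn]
noncomputable def cf (q : ℕ → ℂ) (α β : ℂ) : ℕ → ℂ
  | 0 => α
  | 1 => β
  | (n + 2) => (∑ k : Fin (n + 1), q k * cf q α β (n - k)) / (((n : ℂ) + 1) * ((n : ℂ) + 2))
  decreasing_by omega
lemma cf_succ (q : ℕ → ℂ) (α β : ℂ) (n : ℕ) : ((n : ℂ) + 1) * ((n : ℂ) + 2) * cf q α β (n + 2) =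
    ∑ k ∈ Finset.range (n + 1), q k * cf q α β (n - k) := by
  have h1 : (n : ℂ) + 1 ≠ 0 := by exact_mod_cast Nat.succ_ne_zero n
  have h2 : (n : ℂ) + 2 ≠ 0 := by exact_mod_cast Nat.succ_ne_zero (n + 1)
  rw [cf, Finset.sum_range]; field_simp
lemma cf_bd {q : ℕ → ℂ} (hq : Bd q) (α β : ℂ) : Bd (cf q α β) := by
  intro ρ h0 h1
  obtain ⟨M, hM⟩ := hq ρ h0 h1
  obtain ⟨N, hN⟩ := exists_nat_ge M
  set a : ℕ → ℝ := fun n => ‖cf q α β n‖ * ρ ^ n with ha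
  set L : ℝ := ∑ j ∈ Finset.range (N + 2), a j with hL
  have hM0 : 0 ≤ M := le_trans (by positivity) (hM 0)
  have hL0 : 0 ≤ L := Finset.sum_nonneg fun j _ => by positivity
  refine ⟨L, fun n => ?_⟩
  induction n using Nat.strong_induction_on with
  | _ n ih =>
    by_cases hn : n < N + 2
    · exact Finset.single_le_sum (f := a) (fun j _ => by positivity) (Finset.mem_range.2 hn)
    · obtain ⟨m, rfl⟩ : ∃ m, n = m + 2 := ⟨n - 2, by omega⟩
      have hNm : M ≤ m + 2 := by
        have : N ≤ m + 2 := by omega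
        exact hN.trans (by exact_mod_cast this)
      have e := congrArg norm (cf_succ q α β m)
      have n1 : ‖(m : ℂ) + 1‖ = (m : ℝ) + 1 := by
        have : (m : ℂ) + 1 = ((m + 1 : ℕ) : ℂ) := by push_cast; rfl
        rw [this, Complex.norm_natCast]; push_cast; rfl
      have n2 : ‖(m : ℂ) + 2‖ = (m : ℝ) + 2 := by
        have : (m : ℂ) + 2 = ((m + 2 : ℕ) : ℂ) := by push_cast; rfl
        rw [this, Complex.norm_natCast]; push_cast; rfl
      rw [norm_mul, norm_mul, n1, n2] at e
      have b : ‖∑ k ∈ Finset.range (m + 1), q k * cf q α β (m - k)‖ * ρ ^ m ≤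
          (m + 1) * (M * L) := by
        calc _ ≤ (∑ k ∈ Finset.range (m + 1), ‖q k * cf q α β (m - k)‖) * ρ ^ m := by
              gcongr; exact norm_sum_le _ _
          _ = ∑ k ∈ Finset.range (m + 1), (‖q k‖ * ρ ^ k) * a (m - k) := by
              rw [Finset.sum_mul]
              refine Finset.sum_congr rfl fun k hk => ?_
              have : k ≤ m := by have := Finset.mem_range.1 hk; omega
              simp only [ha]
              rw [norm_mul]
              have e2 : ρ ^ m = ρ ^ k * ρ ^ (m - k) := by rw [← pow_add]; congr 1; omega
              rw [e2]; ring
          _ ≤ ∑ k ∈ Finset.range (m + 1), M * L := by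
              refine Finset.sum_le_sum fun k hk => ?_
              have := ih (m - k) (by omega)
              gcongr
              exact hM k
          _ = _ := by simp
      have key : ((m : ℝ) + 1) * ((m + 2) * (‖cf q α β (m + 2)‖ * ρ ^ m)) ≤
          (m + 1) * (M * L) := by
        refine le_trans (le_of_eq ?_) b
        rw [← e]; ring
      have key2 : ((m : ℝ) + 2) * (‖cf q α β (m + 2)‖ * ρ ^ m) ≤ M * L :=
        le_of_mul_le_mul_left key (by positivity)
      have key3 : ‖cf q α β (m + 2)‖ * ρ ^ m ≤ L := by
        have : M * L ≤ (m + 2) * L := by gcongr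
        exact le_of_mul_le_mul_left (key2.trans this) (by positivity)
      refine le_trans ?_ key3
      rw [pow_add]
      have : ρ ^ 2 ≤ 1 := pow_le_one₀ h0.le h1.le
      have h5 : 0 ≤ ‖cf q α β (m + 2)‖ * ρ ^ m := by positivity
      nlinarith
lemma ps_exists {Q : ℂ → ℂ} (hQ : DifferentiableOn ℂ Q (ball 0 1)) (α β : ℂ) :
    ∃ y y1 : ℂ → ℂ, y 0 = α ∧ y1 0 = β ∧ (∀ z ∈ ball (0 : ℂ) 1, HasDerivAt y (y1 z) z) ∧
      ∀ z ∈ ball (0 : ℂ) 1, HasDerivAt y1 (Q z * y z) z := by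
  set q : ℕ → ℂ := fun n => ((n.factorial : ℂ))⁻¹ * iteratedDeriv n Q 0 with hq
  have hsum : ∀ z ∈ ball (0 : ℂ) 1, HasSum (fun n => q n * z ^ n) (Q z) := by
    intro z hz
    have := Complex.hasSum_taylorSeries_on_ball (r := 1) (c := 0) (by simpa using hQ)
      (by simpa using hz)
    simpa [hq, mul_comm, mul_assoc, mul_left_comm] using this
  have hqB : Bd q := by
    intro ρ h0 h1
    have := (hsum (ρ : ℂ) (by simp [abs_of_pos h0, h1])).summable.norm.tendsto_atTop_zero
    obtain ⟨M, hM⟩ := this.bddAbove_range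
    refine ⟨M, fun n => ?_⟩
    have := hM ⟨n, rfl⟩
    simpa [abs_of_pos h0] using this
  have cB := cf_bd hqB α β
  set c := cf q α β with hc
  refine ⟨psum c, psum (fun n => ((n : ℂ) + 1) * c (n + 1)), ?_, ?_, ?_, ?_⟩
  · rw [psum_zero, hc, cf]
  · rw [psum_zero, hc]; simp [cf]
  · intro z hz; exact cB.hasDerivAt (by simpa using hz)
  · intro z hz
    have hz' : ‖z‖ < 1 := by simpa using hz
    refine (cB.shift.hasDerivAt hz').congr_deriv ?_
    have s1 : Summable fun n => ‖q n * z ^ n‖ :=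
      (hqB.summable (norm_nonneg z) hz').congr fun n => by simp only [norm_mul, norm_pow]
    have s2 : Summable fun n => ‖c n * z ^ n‖ :=
      (cB.summable (norm_nonneg z) hz').congr fun n => by simp only [norm_mul, norm_pow]
    have := tsum_mul_tsum_eq_tsum_sum_range_of_summable_norm s1 s2
    rw [(hsum z hz).tsum_eq] at this
    rw [psum, psum, this]
    refine tsum_congr fun n => ?_
    have e := cf_succ q α β n
    rw [← hc] at e
    have e2 : ∑ k ∈ Finset.range (n + 1), q k * z ^ k * (c (n - k) * z ^ (n - k)) =
        (∑ k ∈ Finset.range (n + 1), q k * c (n - k)) * z ^ n := by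
      rw [Finset.sum_mul]
      refine Finset.sum_congr rfl fun k hk => ?_
      have : k ≤ n := by have := Finset.mem_range.1 hk; omega
      have e3 : z ^ n = z ^ k * z ^ (n - k) := by rw [← pow_add]; congr 1; omega
      rw [e3]; ring
    rw [e2, ← e]
    push_cast; ring_nf
def UH : Set ℂ := {z | 0 < z.im}
lemma isOpen_UH : IsOpen UH := isOpen_lt continuous_const Complex.continuous_im
lemma UH_pre : IsPreconnected UH := (convex_halfSpace_im_gt 0).isPreconnected
lemma hp_exists {Q : ℂ → ℂ} (hQ : DifferentiableOn ℂ Q UH) (a b : ℂ) :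
    ∃ y y1 : ℂ → ℂ, y I = a ∧ y1 I = b ∧ (∀ z ∈ UH, HasDerivAt y (y1 z) z) ∧
      ∀ z ∈ UH, HasDerivAt y1 (Q z * y z) z := by
  have hmap : ∀ ζ ∈ ball (0 : ℂ) 1, I * (1 + ζ) / (1 - ζ) ∈ UH := by
    intro ζ hζ
    have h1 : ‖ζ‖ < 1 := by simpa using hζ
    have hne : (1 : ℂ) - ζ ≠ 0 := by
      intro h; have : ζ = 1 := by linear_combination -h
      rw [this] at h1; simp at h1
    have e : I * (1 + ζ) / (1 - ζ) =
        I * (1 + ζ) * conj (1 - ζ) * ((Complex.normSq (1 - ζ))⁻¹ : ℝ) := by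
      rw [div_eq_mul_inv, Complex.inv_def]; ring
    show 0 < (I * (1 + ζ) / (1 - ζ)).im
    rw [e, Complex.im_mul_ofReal]
    have h2 : 0 < Complex.normSq (1 - ζ) := Complex.normSq_pos.2 hne
    have h3 : Complex.normSq ζ < 1 := by
      rw [Complex.normSq_eq_norm_sq]; nlinarith [norm_nonneg ζ]
    rw [Complex.normSq_apply] at h3
    have : 0 < (I * (1 + ζ) * conj (1 - ζ)).im := by
      simp [Complex.mul_re, Complex.mul_im]; nlinarith
    positivity
  have hne : ∀ ζ ∈ ball (0 : ℂ) 1, (1 : ℂ) - ζ ≠ 0 := by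
    intro ζ hζ h
    have h1 : ‖ζ‖ < 1 := by simpa using hζ
    have : ζ = 1 := by linear_combination -h
    rw [this] at h1; simp at h1
  have hQ2 : DifferentiableOn ℂ (fun ζ => -(1 / 4) * (2 * I / (1 - ζ)) ^ 4 *
      Q (I * (1 + ζ) / (1 - ζ))) (ball 0 1) := by
    intro ζ hζ
    have h1 := hne ζ hζ
    have hq := (hQ.differentiableAt (isOpen_UH.mem_nhds (hmap ζ hζ)))
    have d1 : DifferentiableAt ℂ (fun ζ : ℂ => I * (1 + ζ) / (1 - ζ)) ζ := by
      fun_prop (disch := assumption)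
    have d2 : DifferentiableAt ℂ (fun ζ : ℂ => -(1 / 4) * (2 * I / (1 - ζ)) ^ 4) ζ := by
      fun_prop (disch := assumption)
    exact (d2.mul (DifferentiableAt.comp ζ hq d1)).differentiableWithinAt
  obtain ⟨η, η1, e0, e1, hd, hd1⟩ := ps_exists hQ2 (a / (2 * I)) (b - a / (2 * I))
  have hI : I ≠ 0 := Complex.I_ne_zero
  have hnz : ∀ z ∈ UH, z + I ≠ 0 := by
    intro z hz h
    have hz' : 0 < z.im := hz
    have := congrArg Complex.im h
    simp at this; linarith
  have hm : ∀ z ∈ UH, (z - I) / (z + I) ∈ ball (0 : ℂ) 1 := by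
    intro z hz
    have hz' : 0 < z.im := hz
    have h1 := norm_pos_iff.2 (hnz z hz)
    rw [mem_ball_zero_iff, norm_div, div_lt_one h1]
    apply lt_of_pow_lt_pow_left₀ 2 h1.le
    rw [← Complex.normSq_eq_norm_sq, ← Complex.normSq_eq_norm_sq, Complex.normSq_apply,
      Complex.normSq_apply]
    simp; nlinarith
  have hζ : ∀ z ∈ UH, HasDerivAt (fun z => (z - I) / (z + I))
      (2 * I / (z + I) ^ 2) z := by
    intro z hz
    have := ((hasDerivAt_id z).sub_const I).div ((hasDerivAt_id z).add_const I)
      (hnz z hz)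
    refine this.congr_deriv ?_
    simp only [id]; ring
  refine ⟨fun z => (z + I) * η ((z - I) / (z + I)),
    fun z => η ((z - I) / (z + I)) +
      2 * I / (z + I) * η1 ((z - I) / (z + I)), ?_, ?_, ?_, ?_⟩
  · simp only [sub_self, zero_div, e0]; field_simp; ring
  · simp only [sub_self, zero_div, e0, e1]
    have : 2 * I / (I + I) = 1 := by field_simp; ring
    rw [this]; ring
  · intro z hz
    have h2 := HasDerivAt.comp z (hd _ (hm z hz)) (hζ z hz)
    have := ((hasDerivAt_id z).add_const I).mul h2
    refine this.congr_deriv ?_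
    have := hnz z hz
    simp only [id, Function.comp]; field_simp
  · intro z hz
    have h2 := HasDerivAt.comp z (hd _ (hm z hz)) (hζ z hz)
    have h3 := HasDerivAt.comp z (hd1 _ (hm z hz)) (hζ z hz)
    have hn := hnz z hz
    have h4 : HasDerivAt (fun z => 2 * I / (z + I))
        (-(2 * I) / (z + I) ^ 2) z := by
      have := (hasDerivAt_const z (2 * I)).div ((hasDerivAt_id z).add_const I) hn
      refine this.congr_deriv ?_
      simp
    have := h2.add (h4.mul h3)
    refine this.congr_deriv ?_
    have e1 : 1 - (z - I) / (z + I) = 2 * I / (z + I) := by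
      field_simp; ring
    have e2 : I * (1 + (z - I) / (z + I)) /
        (1 - (z - I) / (z + I)) = z := by
      rw [e1]; field_simp; ring
    rw [e2, e1]
    have e3 : 2 * I / (2 * I / (z + I)) = z + I := by
      field_simp
    rw [e3]
    have I2 : I ^ 2 = -1 := Complex.I_sq
    have I3 : I ^ 3 = -I := by rw [pow_succ, I2]; ring
    have I4 : I ^ 4 = 1 := Complex.I_pow_four
    have I5 : I ^ 5 = I := by rw [pow_succ, I4]; ring
    simp only [Function.comp]; field_simp; ring_nf
    simp only [I2, I3, I4, I5]; ring
open Function.Periodic in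
lemma EL {G : ℂ → ℂ} (hG : DifferentiableOn ℂ G UH) {lam : ℂ} (hl : ‖lam‖ = 1)
    (hper : ∀ z, G (z + 1) = lam * G z) {M : ℝ}
    (hM : ∀ z ∈ UH, ‖G z‖ ≤ M * Real.exp (3 * π * z.im)) :
    (∃ g : ℂ → ℂ, AnalyticAt ℂ g 0 ∧ g 0 ≠ 0 ∧
      ∀ z, G z = Complex.exp (-3 * π * I * z) * g (Complex.exp (2 * π * I * z))) ∨
    Tendsto (fun z => ‖G z‖ * Real.exp (-(3 * π * z.im))) (comap Complex.im atTop) (𝓝 0) := by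
  set θ : ℝ := lam.arg / (2 * π) - ⌈lam.arg / (2 * π) + 3 / 2⌉ with hθ
  have hpi := Real.pi_pos
  have hθ1 : θ ≤ -3 / 2 := by
    have := Int.le_ceil (lam.arg / (2 * π) + 3 / 2); rw [hθ]; linarith
  have hθ2 : -5 / 2 < θ := by
    have := Int.ceil_lt_add_one (lam.arg / (2 * π) + 3 / 2); rw [hθ]; linarith
  have hlam : lam = Complex.exp (2 * π * I * θ) := by
    have h1 := Complex.norm_mul_exp_arg_mul_I lam
    rw [hl] at h1
    have : (2 * π * I * θ : ℂ) = lam.arg * I -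
        (⌈lam.arg / (2 * π) + 3 / 2⌉ : ℤ) * (2 * π * I) := by
      rw [hθ]; push_cast
      have : (π : ℂ) ≠ 0 := by exact_mod_cast hpi.ne'
      field_simp
    rw [this, Complex.exp_sub, Complex.exp_int_mul_two_pi_mul_I, div_one]
    rw [Complex.ofReal_one, one_mul] at h1; exact h1.symm
  set f : ℂ → ℂ := fun z => G z * Complex.exp (-(2 * π * I * θ * z)) with hf
  have hnf : ∀ z, ‖f z‖ = ‖G z‖ * Real.exp (2 * π * θ * z.im) := by
    intro z
    rw [hf]; simp only [norm_mul, Complex.norm_exp]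
    congr 2
    simp [Complex.mul_re, Complex.mul_im]
  have hfper : Function.Periodic f ((1 : ℝ) : ℂ) := by
    intro z
    simp only [hf, Complex.ofReal_one, hper]
    have : -(2 * π * I * θ * (z + 1)) =
      -(2 * π * I * θ * z) + -(2 * π * I * θ) := by ring
    rw [this, Complex.exp_add, Complex.exp_neg (2 * π * I * θ), hlam]
    field_simp
  have ev : ∀ᶠ z in comap Complex.im atTop, z ∈ UH :=
    (eventually_gt_atTop (0 : ℝ)).comap Complex.im
  have hhol : ∀ᶠ z in comap Complex.im atTop, DifferentiableAt ℂ f z := by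
    filter_upwards [ev] with z hz
    have := hG.differentiableAt (isOpen_UH.mem_nhds hz)
    simp only [hf]; fun_prop
  have hM0 : 0 ≤ M := by
    have := hM I (by simp [UH])
    by_contra hcon
    push Not at hcon
    have h2 := Real.exp_pos (3 * π * I.im)
    nlinarith [norm_nonneg (G I)]
  have hfb : ∀ z ∈ UH, ‖f z‖ ≤ M * Real.exp ((3 + 2 * θ) * π * z.im) := by
    intro z hz
    rw [hnf]
    calc _ ≤ M * Real.exp (3 * π * z.im) * Real.exp (2 * π * θ * z.im) := by
          gcongr; exact hM z hz
      _ = _ := by rw [mul_assoc, ← Real.exp_add]; ring_nf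
  have hbd : BoundedAtFilter (comap Complex.im atTop) f := by
    rw [BoundedAtFilter, Asymptotics.isBigO_iff]
    refine ⟨M, ?_⟩
    filter_upwards [ev] with z hz
    have hz' : 0 < z.im := hz
    refine (hfb z hz).trans ?_
    have : Real.exp ((3 + 2 * θ) * π * z.im) ≤ 1 := by
      rw [Real.exp_le_one_iff]
      have : (3 + 2 * θ) ≤ 0 := by linarith
      have h2 : 0 ≤ π * z.im := by positivity
      nlinarith
    simp
    nlinarith
  have tinf := tendsto_at_I_inf one_pos hfper hhol hbd
  have tim : Tendsto Complex.im (comap Complex.im atTop) atTop := tendsto_comap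
  rcases eq_or_lt_of_le hθ1 with heq | hlt
  · by_cases h0 : cuspFunction 1 f 0 = 0
    · right
      rw [h0] at tinf
      refine tinf.norm.congr' ?_ |>.trans (by simp)
      refine Eventually.of_forall fun z => ?_
      show ‖f z‖ = _
      rw [hnf, heq]; congr 2; ring
    · left
      refine ⟨cuspFunction 1 f, ?_, h0, ?_⟩
      · rw [Complex.analyticAt_iff_eventually_differentiableAt]
        have h1 := eventually_differentiableAt_cuspFunction_nhds_ne_zero one_pos hfper hhol
        have h2 := differentiableAt_cuspFunction_zero one_pos hfper hhol hbd
        rw [eventually_nhdsWithin_iff] at h1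
        filter_upwards [h1] with q hq
        by_cases hq0 : q = 0
        · rw [hq0]; exact h2
        · exact hq hq0
      · intro z
        have := eq_cuspFunction one_ne_zero hfper z
        simp only [qParam, Complex.ofReal_one, div_one] at this
        rw [this, hf]
        simp only
        rw [heq, mul_left_comm, ← Complex.exp_add]
        have : -3 * π * I * z + -(2 * π * I * ((-3 / 2 : ℝ) : ℂ) * z) = 0 := by
          push_cast; ring
        rw [this]; simp
  · right
    have hz0 : ZeroAtFilter (comap Complex.im atTop) f := by
      rw [ZeroAtFilter, tendsto_zero_iff_norm_tendsto_zero]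
      refine squeeze_zero' (Eventually.of_forall fun z => norm_nonneg _)
        (ev.mono hfb) ?_
      rw [← mul_zero M]
      refine Tendsto.const_mul M (Real.tendsto_exp_atBot.comp ?_)
      refine Tendsto.const_mul_atTop_of_neg ?_ tim
      nlinarith
    have := exp_decay_of_zero_at_inf one_pos hfper hhol hz0
    obtain ⟨C, hC⟩ := this.bound
    have ht : Tendsto (fun z : ℂ => C * Real.exp ((-5 - 2 * θ) * π * z.im))
        (comap Complex.im atTop) (𝓝 0) := by
      rw [← mul_zero C]
      refine Tendsto.const_mul C (Real.tendsto_exp_atBot.comp ?_)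
      refine Tendsto.const_mul_atTop_of_neg ?_ tim
      nlinarith
    refine squeeze_zero' (Eventually.of_forall fun z => by positivity) ?_ ht
    filter_upwards [hC] with z hz
    have e : ‖G z‖ = ‖f z‖ * Real.exp (-(2 * π * θ * z.im)) := by
      rw [hnf, mul_assoc, ← Real.exp_add]; simp
    rw [Real.norm_eq_abs, abs_of_pos (Real.exp_pos _)] at hz
    rw [e, mul_assoc, ← Real.exp_add]
    calc _ ≤ C * Real.exp (-2 * π * z.im / 1) *
          Real.exp (-(2 * π * θ * z.im) + -(3 * π * z.im)) := by gcongr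
      _ = _ := by rw [mul_assoc, ← Real.exp_add]; congr 2; ring
section
variable {U : Set ℂ} {Q h h1 h12 y y1 : ℂ → ℂ} {c : ℝ} {z : ℂ}
lemma HasW.shift {g : ℂ → ℂ} {a b t z : ℂ} (h : HasW g a b (z + t)) :
    HasW (fun w => g (w + t)) a b z := by
  have := HasW.comp (g := g) (φ := fun w => w + t) h ((hasDerivAt_id z).add_const t)
  exact this.to (by simp) (by simp)
lemma Pot.hne (P : Pot U Q h h1 h12 c) (hz : z ∈ U) : h z ≠ 0 := by
  intro h0; have := P.pos z hz; rw [h0] at this; simp at this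
lemma Pot.per (P : Pot U Q h h1 h12 c) {t : ℂ} (hU : ∀ z ∈ U, z + t ∈ U)
    (hh : ∀ z ∈ U, h (z + t) = h z) :
    ∀ z ∈ U, h1 (z + t) = h1 z ∧ h12 (z + t) = h12 z ∧ Q (z + t) = Q z := by
  have e1 : ∀ z ∈ U, h1 (z + t) = h1 z := by
    intro z hz
    have a := (P.d0 _ (hU z hz)).shift
    have b := (P.d0 z hz).congr (k := fun w => h (w + t))
      (by filter_upwards [P.opn.mem_nhds hz] with w hw; exact hh w hw)
    exact (a.uniq b).1
  intro z hz
  have a := (P.d1 _ (hU z hz)).shift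
  have b := (P.d1 z hz).congr (k := fun w => h1 (w + t))
      (by filter_upwards [P.opn.mem_nhds hz] with w hw; exact e1 w hw)
  obtain ⟨u1, u2⟩ := a.uniq b
  rw [hh z hz] at u1
  exact ⟨e1 z hz, u2, mul_right_cancel₀ (P.hne hz) u1⟩
lemma Pot.bf_const (P : Pot U Q h h1 h12 c) (hc : IsPreconnected U)
    (hy : ∀ z ∈ U, HasDerivAt y (y1 z) z) (hy1 : ∀ z ∈ U, HasDerivAt y1 (Q z * y z) z)
    {z w : ℂ} (hz : z ∈ U) (hw : w ∈ U) : Bf h h1 h12 y y1 z = Bf h h1 h12 y y1 w :=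
  HasW.eq_const P.opn hc (fun x hx => P.bf_d hx (hy x hx) (hy1 x hx)) hz hw
lemma Pot.uniq_zero (P : Pot U Q h h1 h12 c) (hc : IsPreconnected U)
    (hy : ∀ z ∈ U, HasDerivAt y (y1 z) z) (hy1 : ∀ z ∈ U, HasDerivAt y1 (Q z * y z) z)
    {z0 : ℂ} (h0 : z0 ∈ U) (e0 : y z0 = 0) (e1 : y1 z0 = 0) :
    ∀ z ∈ U, y z = 0 ∧ y1 z = 0 := by
  intro z hz
  by_contra hcon
  have h3 := P.bf_pos (y := y) (y1 := y1) hz (by tauto)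
  rw [P.bf_const hc hy hy1 hz h0] at h3
  simp [Bf, e0, e1] at h3
lemma Pot.bf_norm (P : Pot U Q h h1 h12 c) (hz : z ∈ U) :
    (h z).re * (Bf h h1 h12 y y1 z).re = ‖Df h h1 y y1 z‖ ^ 2 + c * ‖y z‖ ^ 2 := by
  have := P.bf_id (y := y) (y1 := y1) hz
  rw [← P.hre hz, ← Complex.conj_eq_iff_re.1 (P.bf_conj (y := y) (y1 := y1) hz), Complex.mul_conj,
    Complex.mul_conj] at this
  rw [← Complex.normSq_eq_norm_sq, ← Complex.normSq_eq_norm_sq]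
  exact_mod_cast this
end
lemma UH_shift : ∀ z ∈ UH, z + 1 ∈ UH := by
  intro z hz; have : 0 < z.im := hz
  simpa [UH] using this
lemma I_mem : I ∈ UH := by simp [UH]
lemma quad_root (a b c d : ℂ) : ∃ l : ℂ, (l - a) * (l - d) = b * c := by
  obtain ⟨s, hs⟩ := IsAlgClosed.exists_pow_nat_eq (((a - d) / 2) ^ 2 + b * c) (n := 2) (by norm_num)
  exact ⟨(a + d) / 2 + s, by linear_combination hs⟩
lemma hp_eig {Q h h1 h12 : ℂ → ℂ} {c : ℝ} (P : Pot UH Q h h1 h12 c)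
    (hQ : DifferentiableOn ℂ Q UH) (hper : ∀ z ∈ UH, h (z + 1) = h z) :
    ∃ y y1 : ℂ → ℂ, ∃ lam : ℂ, ‖lam‖ = 1 ∧ (∀ z ∈ UH, HasDerivAt y (y1 z) z) ∧
      (∀ z ∈ UH, HasDerivAt y1 (Q z * y z) z) ∧ (y I ≠ 0 ∨ y1 I ≠ 0) ∧
      ∀ z ∈ UH, y (z + 1) = lam * y z ∧ y1 (z + 1) = lam * y1 z := by
  have PP := P.per UH_shift hper
  obtain ⟨Y, Y', a0, a1, a2, a3⟩ := hp_exists hQ 1 0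
  obtain ⟨Z, Z', b0, b1, b2, b3⟩ := hp_exists hQ 0 1
  have lin : ∀ y y1 : ℂ → ℂ, (∀ z ∈ UH, HasDerivAt y (y1 z) z) →
      (∀ z ∈ UH, HasDerivAt y1 (Q z * y z) z) → ∀ z ∈ UH,
      y z = y I * Y z + y1 I * Z z ∧
      y1 z = y I * Y' z + y1 I * Z' z := by
    intro y y1 hy hy1 z hz
    have := P.uniq_zero UH_pre
      (y := fun z => y z - (y I * Y z + y1 I * Z z))
      (y1 := fun z => y1 z - (y I * Y' z + y1 I * Z' z))
      (fun z hz => (hy z hz).sub (((a2 z hz).const_mul _).add ((b2 z hz).const_mul _)))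
      (fun z hz => ((hy1 z hz).sub (((a3 z hz).const_mul _).add ((b3 z hz).const_mul _))).congr_deriv
        (by ring)) I_mem (by simp [a0, b0]) (by simp [a1, b1]) z hz
    exact ⟨sub_eq_zero.1 this.1, sub_eq_zero.1 this.2⟩
  have sh : ∀ y y1 : ℂ → ℂ, (∀ z ∈ UH, HasDerivAt y (y1 z) z) →
      (∀ z ∈ UH, HasDerivAt y1 (Q z * y z) z) →
      (∀ z ∈ UH, HasDerivAt (fun z => y (z + 1)) (y1 (z + 1)) z) ∧
      (∀ z ∈ UH, HasDerivAt (fun z => y1 (z + 1)) (Q z * y (z + 1)) z) := by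
    intro y y1 hy hy1
    refine ⟨fun z hz => (hy _ (UH_shift z hz)).comp_add_const z 1, fun z hz => ?_⟩
    have := (hy1 _ (UH_shift z hz)).comp_add_const z 1
    rwa [(PP z hz).2.2] at this
  have SY := lin _ _ (sh _ _ a2 a3).1 (sh _ _ a2 a3).2
  have SZ := lin _ _ (sh _ _ b2 b3).1 (sh _ _ b2 b3).2
  set a := Y (I + 1)
  set b := Y' (I + 1)
  set cc := Z (I + 1)
  set d := Z' (I + 1)
  obtain ⟨p, q, lam, hpq, e1, e2⟩ : ∃ p q lam : ℂ, (p ≠ 0 ∨ q ≠ 0) ∧ p * a + q * cc = lam * p ∧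
      p * b + q * d = lam * q := by
    by_cases hb : b = 0
    · exact ⟨1, 0, a, by simp, by ring, by rw [hb]; ring⟩
    · obtain ⟨l, hl⟩ := quad_root a b cc d
      exact ⟨l - d, b, l, Or.inr hb, by linear_combination -hl, by ring⟩
  have key : ∀ z ∈ UH, p * Y (z + 1) + q * Z (z + 1) = lam * (p * Y z + q * Z z) ∧
      p * Y' (z + 1) + q * Z' (z + 1) = lam * (p * Y' z + q * Z' z) := by
    intro z hz
    constructor
    · rw [(SY z hz).1, (SZ z hz).1]; linear_combination Y z * e1 + Z z * e2
    · rw [(SY z hz).2, (SZ z hz).2]; linear_combination Y' z * e1 + Z' z * e2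
  have hd : ∀ z ∈ UH, HasDerivAt (fun z => p * Y z + q * Z z) (p * Y' z + q * Z' z) z :=
    fun z hz => ((a2 z hz).const_mul _).add ((b2 z hz).const_mul _)
  have hd1 : ∀ z ∈ UH, HasDerivAt (fun z => p * Y' z + q * Z' z) (Q z * (p * Y z + q * Z z)) z :=
    fun z hz => (((a3 z hz).const_mul _).add ((b3 z hz).const_mul _)).congr_deriv (by ring)
  have hnz : p * Y I + q * Z I ≠ 0 ∨ p * Y' I + q * Z' I ≠ 0 := by
    rw [a0, b0, a1, b1]; simpa using hpq
  refine ⟨fun z => p * Y z + q * Z z, fun z => p * Y' z + q * Z' z, lam, ?_, hd, hd1, hnz, key⟩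
  have hp := P.bf_pos (y := fun z => p * Y z + q * Z z) (y1 := fun z => p * Y' z + q * Z' z)
    I_mem hnz
  have hB := P.bf_const UH_pre hd hd1 (UH_shift _ I_mem) I_mem
  have hB2 : Bf h h1 h12 (fun z => p * Y z + q * Z z) (fun z => p * Y' z + q * Z' z) (I + 1)
      = (lam * conj lam) * Bf h h1 h12 (fun z => p * Y z + q * Z z)
        (fun z => p * Y' z + q * Z' z) (I) := by
    simp only [Bf]
    rw [(key _ I_mem).1, (key _ I_mem).2, hper _ I_mem, (PP _ I_mem).1, (PP _ I_mem).2.1]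
    simp only [map_mul]; ring
  rw [hB, Complex.mul_conj] at hB2
  have hB0 : Bf h h1 h12 (fun z => p * Y z + q * Z z) (fun z => p * Y' z + q * Z' z) I ≠ 0 := by
    intro h0; rw [h0] at hp; simp at hp
  have : ((Complex.normSq lam : ℝ) : ℂ) = 1 :=
    mul_right_cancel₀ hB0 (by rw [one_mul]; exact hB2.symm)
  have h2 : Complex.normSq lam = 1 := by exact_mod_cast this
  rw [Complex.normSq_eq_norm_sq] at h2
  exact (pow_eq_one_iff_of_nonneg (norm_nonneg lam) two_ne_zero).1 h2
lemma EL2 {G : ℂ → ℂ} (hG : DifferentiableOn ℂ G UH) {lam : ℂ} (hl : ‖lam‖ = 1)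
    (hper : ∀ z ∈ UH, G (z + 1) = lam * G z) {M : ℝ}
    (hM : ∀ z ∈ UH, ‖G z‖ ≤ M * Real.exp (3 * π * z.im)) :
    (∃ g : ℂ → ℂ, AnalyticAt ℂ g 0 ∧ g 0 ≠ 0 ∧
      ∀ z ∈ UH, G z = Complex.exp (-3 * π * I * z) * g (Complex.exp (2 * π * I * z))) ∨
    Tendsto (fun z => ‖G z‖ * Real.exp (-(3 * π * z.im))) (comap Complex.im atTop) (𝓝 0) := by
  classical
  have e : ∀ z ∈ UH, UH.indicator G z = G z := fun z hz => indicator_of_mem hz _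
  have p1 : ∀ z, UH.indicator G (z + 1) = lam * UH.indicator G z := by
    intro z
    by_cases hz : z ∈ UH
    · rw [e z hz, e _ (UH_shift z hz), hper z hz]
    · have : z + 1 ∉ UH := by simpa [UH] using hz
      rw [indicator_of_notMem hz, indicator_of_notMem this, mul_zero]
  rcases EL (G := UH.indicator G) (hG.congr e) hl p1 (M := M)
    (by intro z hz; rw [e z hz]; exact hM z hz) with ⟨g, a, b, c⟩ | h
  · exact Or.inl ⟨g, a, b, fun z hz => by rw [← e z hz]; exact c z⟩
  · right
    refine h.congr' ?_
    filter_upwards [(eventually_gt_atTop (0 : ℝ)).comap Complex.im] with z hz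
    rw [e z hz]
lemma hp_main {Q h h1 h12 : ℂ → ℂ} {c : ℝ} (P : Pot UH Q h h1 h12 c)
    (hQ : DifferentiableOn ℂ Q UH) (hper : ∀ z ∈ UH, h (z + 1) = h z) {A A' : ℝ} (hA : 0 < A)
    (hlo : ∀ z ∈ UH, A * Real.exp (6 * π * z.im) ≤ (h z).re)
    (hhi : ∀ z ∈ UH, (h z).re ≤ A' * Real.exp (6 * π * z.im)) :
    ∃ G G1 : ℂ → ℂ, (∀ z ∈ UH, HasDerivAt G (G1 z) z) ∧ (∀ z ∈ UH, HasDerivAt G1 (Q z * G z) z) ∧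
      ∃ g : ℂ → ℂ, AnalyticAt ℂ g 0 ∧ g 0 ≠ 0 ∧
      ∀ z ∈ UH, G z = Complex.exp (-3 * π * I * z) * g (Complex.exp (2 * π * I * z)) := by
  have PP := P.per UH_shift hper
  obtain ⟨y, y1, lam, hl, hy, hy1, hnz, hk⟩ := hp_eig P hQ hper
  set B := (Bf h h1 h12 y y1 I).re with hB
  have Bpos : 0 < B := P.bf_pos I_mem hnz
  have hn : ∀ z ∈ UH, (h z).re * B = ‖Df h h1 y y1 z‖ ^ 2 + c * ‖y z‖ ^ 2 := by
    intro z hz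
    rw [hB, ← P.bf_const UH_pre hy hy1 hz I_mem]; exact P.bf_norm hz
  have hc := P.cpos
  have ex2 : ∀ z : ℂ, Real.exp (6 * π * z.im) = Real.exp (3 * π * z.im) ^ 2 := by
    intro z; rw [← Real.exp_nat_mul]; congr 1; push_cast; ring
  have hA' : 0 < A' := by
    have := (hlo _ I_mem).trans (hhi _ I_mem)
    have h2 := Real.exp_pos (6 * π * I.im)
    nlinarith
  have by1 : ∀ z ∈ UH, ‖y z‖ ≤ √(A' * B / c) * Real.exp (3 * π * z.im) := by
    intro z hz
    apply le_of_sq_le_sq _ (by positivity)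
    rw [mul_pow, Real.sq_sqrt (by positivity), ← ex2, div_mul_eq_mul_div, le_div_iff₀ hc]
    nlinarith [hn z hz, hhi z hz, sq_nonneg ‖Df h h1 y y1 z‖]
  have by2 : ∀ z ∈ UH, ‖Df h h1 y y1 z‖ ≤ √(A' * B) * Real.exp (3 * π * z.im) := by
    intro z hz
    apply le_of_sq_le_sq _ (by positivity)
    rw [mul_pow, Real.sq_sqrt (by positivity), ← ex2]
    nlinarith [hn z hz, hhi z hz, mul_nonneg hc.le (sq_nonneg ‖y z‖)]
  have hD : ∀ z ∈ UH, HasDerivAt (Df h h1 y y1) (Df1 h1 h12 y y1 z) z :=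
    fun z hz => P.df hz (hy z hz) (hy1 z hz)
  rcases EL2 (fun z hz => (hy z hz).differentiableAt.differentiableWithinAt) hl
    (fun z hz => (hk z hz).1) by1 with h1' | t1
  · exact ⟨y, y1, hy, hy1, h1'⟩
  rcases EL2 (G := Df h h1 y y1) (lam := conj lam)
    (fun z hz => (hD z hz).differentiableAt.differentiableWithinAt) (by simpa using hl)
    (fun z hz => by
      simp only [Df]
      rw [(hk z hz).1, (hk z hz).2, hper z hz, (PP z hz).1]; simp only [map_mul]; ring)
    by2 with h2' | t2
  · exact ⟨_, _, hD, fun z hz => P.df1 hz (hy z hz) (hy1 z hz), h2'⟩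
  exfalso
  have t3 := (t2.pow 2).add ((t1.pow 2).const_mul c)
  haveI : (comap Complex.im atTop).NeBot := NeBot.comap_of_surj inferInstance
    (fun x => ⟨⟨0, x⟩, rfl⟩)
  have : A * B ≤ 0 ^ 2 + c * 0 ^ 2 := by
    refine ge_of_tendsto t3 ?_
    filter_upwards [(eventually_gt_atTop (0 : ℝ)).comap Complex.im] with z hz
    have e1 := hn z hz
    have e2 := hlo z hz
    rw [ex2] at e2
    have e3 : Real.exp (3 * π * z.im) * Real.exp (-(3 * π * z.im)) = 1 := by
      rw [← Real.exp_add]; simp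
    have e4 : (‖Df h h1 y y1 z‖ ^ 2 + c * ‖y z‖ ^ 2) * Real.exp (-(3 * π * z.im)) ^ 2 ≥
        A * B := by
      rw [← e1]
      calc A * B = (A * Real.exp (3 * π * z.im) ^ 2) * B * Real.exp (-(3 * π * z.im)) ^ 2 := by
            linear_combination -(A * B) * (1 + Real.exp (3 * π * z.im) * Real.exp (-(3 * π * z.im))) * e3
        _ ≤ _ := by gcongr
    calc A * B ≤ _ := e4
      _ = _ := by ring
  have := mul_pos hA Bpos
  norm_num at *
  linarith
lemma L1 {Q h h1 h12 : ℂ → ℂ} {c ε A A' : ℝ} (hε : 0 < ε)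
    (P : Pot (ball 0 ε \ {0}) Q h h1 h12 c)
    (hQ : DifferentiableOn ℂ Q (ball 0 ε \ {0})) (hA : 0 < A)
    (hlo : ∀ x ∈ ball (0 : ℂ) ε \ {0}, A / ‖x‖ ^ 2 ≤ (h x).re)
    (hhi : ∀ x ∈ ball (0 : ℂ) ε \ {0}, (h x).re ≤ A' / ‖x‖ ^ 2) :
    ∃ g : ℂ → ℂ, AnalyticAt ℂ g 0 ∧ g 0 ≠ 0 ∧
      ∀ᶠ x in 𝓝[≠] 0, x ^ 2 * deriv (deriv g) x - 2 * x * deriv g x + 2 * g x = x ^ 2 * Q x * g x := by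
  set p : ℂ := 2 * π * I with hp
  have hpi := Real.pi_pos
  have hpne : p ≠ 0 := by
    rw [hp]; simp [hpi.ne']
  have hεc : (ε : ℂ) ≠ 0 := by exact_mod_cast hε.ne'
  set φ : ℂ → ℂ := fun ξ => ε * Complex.exp (p * ξ) with hφ
  set α : ℂ → ℂ := fun ξ => Complex.exp (-(p / 2) * ξ) with hα
  have nφ : ∀ ξ, ‖φ ξ‖ = ε * Real.exp (-(2 * π * ξ.im)) := by
    intro ξ
    simp only [hφ, norm_mul, Complex.norm_real, Complex.norm_exp, Real.norm_eq_abs, abs_of_pos hε]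
    congr 2; rw [hp]; simp [Complex.mul_re, Complex.mul_im]
  have nα : ∀ ξ, α ξ * conj (α ξ) = ((Real.exp (2 * π * ξ.im) : ℝ) : ℂ) := by
    intro ξ
    rw [Complex.mul_conj, Complex.normSq_eq_norm_sq, Complex.norm_exp, ← Real.exp_nat_mul]
    congr 2; rw [hp]; simp [Complex.mul_re, Complex.mul_im]; ring
  have mφ : ∀ ξ ∈ UH, φ ξ ∈ ball (0 : ℂ) ε \ {0} := by
    intro ξ hξ
    have hξ' : 0 < ξ.im := hξ
    refine ⟨?_, ?_⟩
    · rw [mem_ball_zero_iff, nφ]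
      have : Real.exp (-(2 * π * ξ.im)) < 1 := by
        rw [Real.exp_lt_one_iff]
        have : 0 < 2 * π * ξ.im := by positivity
        linarith
      nlinarith
    · simp [hφ, hεc]
  have dφ : ∀ ξ, HasDerivAt φ (p * φ ξ) ξ := by
    intro ξ
    have := (((hasDerivAt_id ξ).const_mul p).cexp).const_mul (ε : ℂ)
    exact this.congr_deriv (by simp only [hφ, id]; ring)
  have dα : ∀ ξ, HasDerivAt α (-(p / 2) * α ξ) ξ := by
    intro ξ
    have := (((hasDerivAt_id ξ).const_mul (-(p / 2))).cexp)
    exact this.congr_deriv (by simp only [hα, id]; ring)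
  have aφ : ∀ ξ, α ξ * α ξ * φ ξ = ε := by
    intro ξ
    simp only [hφ, hα]
    rw [mul_left_comm, ← Complex.exp_add, ← Complex.exp_add]
    ring_nf; simp
  set Q' : ℂ → ℂ := fun ξ => p ^ 2 * (φ ξ ^ 2 * Q (φ ξ) + 1 / 4) with hQ'
  have PT := P.trans (V := UH) isOpen_UH (φ := φ) (φd := fun ξ => p * φ ξ) (α := α)
    (β := fun _ => 0) (γ := fun ξ => -(p / 2) * α ξ) (δ := fun ξ => α ξ * (p * φ ξ)) (Q' := Q')
    (D := p * ε) (mul_ne_zero hpne hεc) mφ (fun ξ _ => dφ ξ)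
    (fun ξ _ => (dα ξ).congr_deriv (by ring))
    (fun ξ _ => (hasDerivAt_const ξ 0).congr_deriv (by ring))
    (fun ξ _ => ((dα ξ).const_mul _).congr_deriv (by simp only [hQ']; ring))
    (fun ξ _ => ((dα ξ).mul ((dφ ξ).const_mul p)).congr_deriv (by ring))
    (fun ξ _ => by rw [← aφ ξ]; ring)
  have hQ2 : DifferentiableOn ℂ Q' UH := by
    intro ξ hξ
    have hq := hQ.differentiableAt ((isOpen_ball.sdiff isClosed_singleton).mem_nhds (mφ ξ hξ))
    have d := (dφ ξ).differentiableAt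
    exact (((d.pow 2).mul (hq.comp ξ d)).add_const _ |>.const_mul _).differentiableWithinAt
  have hφp : ∀ ξ, φ (ξ + 1) = φ ξ := by
    intro ξ; simp only [hφ]; rw [mul_add, mul_one, Complex.exp_add]
    have : Complex.exp p = 1 := by rw [hp]; exact Complex.exp_two_pi_mul_I
    rw [this, mul_one]
  have hKe : ∀ ξ, (α ξ * conj (α ξ) * h (φ ξ) + α ξ * conj (0 : ℂ) * conj (h1 (φ ξ)) +
        0 * conj (α ξ) * h1 (φ ξ) + 0 * conj (0 : ℂ) * h12 (φ ξ)) =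
        ((Real.exp (2 * π * ξ.im) : ℝ) : ℂ) * h (φ ξ) := by
    intro ξ; rw [nα]; simp
  obtain ⟨G, G1, hG, hG1, g, ga, g0, gG⟩ := hp_main (A := A / ε ^ 2) (A' := A' / ε ^ 2) PT hQ2
    (by
      intro ξ hξ
      rw [hKe, hKe, hφp]; simp)
    (by positivity)
    (by
      intro ξ hξ
      rw [hKe, Complex.re_ofReal_mul]
      have := hlo _ (mφ ξ hξ)
      rw [nφ] at this
      calc A / ε ^ 2 * Real.exp (6 * π * ξ.im) = Real.exp (2 * π * ξ.im) *
            (A / (ε * Real.exp (-(2 * π * ξ.im))) ^ 2) := by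
            rw [mul_pow, ← Real.exp_nat_mul, show (6 * π * ξ.im : ℝ) = 2 * π * ξ.im -
              ((2 : ℕ) : ℝ) * (-(2 * π * ξ.im)) by push_cast; ring, Real.exp_sub]
            field_simp
        _ ≤ _ := by gcongr)
    (by
      intro ξ hξ
      rw [hKe, Complex.re_ofReal_mul]
      have := hhi _ (mφ ξ hξ)
      rw [nφ] at this
      calc _ ≤ Real.exp (2 * π * ξ.im) *
            (A' / (ε * Real.exp (-(2 * π * ξ.im))) ^ 2) := by gcongr
        _ = A' / ε ^ 2 * Real.exp (6 * π * ξ.im) := by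
            rw [mul_pow, ← Real.exp_nat_mul, show (6 * π * ξ.im : ℝ) = 2 * π * ξ.im -
              ((2 : ℕ) : ℝ) * (-(2 * π * ξ.im)) by push_cast; ring, Real.exp_sub]
            field_simp)
  clear PT
  have hgG : ∀ ξ ∈ UH, G ξ = Complex.exp (-(3 / 2) * p * ξ) * g (Complex.exp (p * ξ)) := by
    intro ξ hξ; rw [gG ξ hξ, hp]; congr 2; ring
  -- the equation in t
  have key : ∀ t : ℂ, t ≠ 0 → ‖t‖ < 1 → AnalyticAt ℂ g t →
      t ^ 2 * deriv (deriv g) t - 2 * t * deriv g t + 2 * g t = (ε * t) ^ 2 * Q (ε * t) * g t := by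
    intro t ht0 ht1 hga
    set ξ : ℂ := Complex.log t / p with hξd
    have hexp : Complex.exp (p * ξ) = t := by
      rw [hξd, mul_div_cancel₀ _ hpne, Complex.exp_log ht0]
    have hξ : ξ ∈ UH := by
      have h1 : ‖Complex.exp (p * ξ)‖ < 1 := by rw [hexp]; exact ht1
      rw [Complex.norm_exp, Real.exp_lt_one_iff] at h1
      have : (p * ξ).re = -(2 * π * ξ.im) := by rw [hp]; simp [Complex.mul_re, Complex.mul_im]
      rw [this] at h1
      show 0 < ξ.im
      by_contra hcon
      push Not at hcon
      have : 0 < 2 * π := by positivity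
      nlinarith
    have dE : ∀ w : ℂ, HasDerivAt (fun w => Complex.exp (p * w)) (p * Complex.exp (p * w)) w := by
      intro w
      exact ((hasDerivAt_id w).const_mul p).cexp.congr_deriv (by simp only [id]; ring)
    have dE3 : ∀ w : ℂ, HasDerivAt (fun w => Complex.exp (-(3 / 2) * p * w))
        (-(3 / 2) * p * Complex.exp (-(3 / 2) * p * w)) w := by
      intro w
      exact ((hasDerivAt_id w).const_mul (-(3 / 2) * p)).cexp.congr_deriv (by simp only [id]; ring)
    have evg : ∀ᶠ w in 𝓝 ξ, w ∈ UH ∧ AnalyticAt ℂ g (Complex.exp (p * w)) := by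
      have c1 : Tendsto (fun w => Complex.exp (p * w)) (𝓝 ξ) (𝓝 t) := by
        have := (dE ξ).continuousAt.tendsto; rwa [hexp] at this
      exact (show ∀ᶠ w in 𝓝 ξ, w ∈ UH from isOpen_UH.mem_nhds hξ).and (c1.eventually hga.eventually_analyticAt)
    have d1 : ∀ w, AnalyticAt ℂ g (Complex.exp (p * w)) →
        HasDerivAt (fun w => Complex.exp (-(3 / 2) * p * w) * g (Complex.exp (p * w)))
        (Complex.exp (-(3 / 2) * p * w) * (-(3 / 2) * p * g (Complex.exp (p * w)) +
          p * Complex.exp (p * w) * deriv g (Complex.exp (p * w)))) w := by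
      intro w hw
      have a := (HasDerivAt.comp w hw.differentiableAt.hasDerivAt (dE w))
      exact ((dE3 w).mul a).congr_deriv (by simp only [Function.comp]; ring)
    have eG1 : G1 =ᶠ[𝓝 ξ] fun w => Complex.exp (-(3 / 2) * p * w) *
          (-(3 / 2) * p * g (Complex.exp (p * w)) +
          p * Complex.exp (p * w) * deriv g (Complex.exp (p * w))) := by
      filter_upwards [evg.eventually_nhds] with w hw
      obtain ⟨hw1, hw2⟩ := hw.self_of_nhds
      have := (d1 w hw2).congr_of_eventuallyEq (f₁ := G)
        (by filter_upwards [hw] with v hv; exact hgG v hv.1)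
      exact (hG w hw1).unique this
    have a := (HasDerivAt.comp ξ (h := fun w => Complex.exp (p * w)) (h₂ := g)
      (by simp only [hexp]; exact hga.differentiableAt.hasDerivAt) (dE ξ))
    have b := (HasDerivAt.comp ξ (h := fun w => Complex.exp (p * w)) (h₂ := deriv g)
      (by simp only [hexp]; exact hga.deriv.differentiableAt.hasDerivAt) (dE ξ))
    have d2 := ((dE3 ξ).mul ((a.const_mul (-(3 / 2) * p)).add
      (((dE ξ).const_mul p).mul b))).congr_of_eventuallyEq eG1
    have := (hG1 ξ hξ).unique d2
    rw [hgG ξ hξ] at this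
    simp only [hQ', hφ, Function.comp, Pi.add_apply, Pi.mul_apply, hexp] at this
    have hne := Complex.exp_ne_zero (-(3 / 2) * p * ξ)
    have h5 : Complex.exp (-(3 / 2) * p * ξ) * p ^ 2 * ((ε * t) ^ 2 * Q (ε * t) * g t) =
      Complex.exp (-(3 / 2) * p * ξ) * p ^ 2 * (t ^ 2 * deriv (deriv g) t - 2 * t * deriv g t + 2 * g t) := by
      linear_combination this
    exact (mul_left_cancel₀ (mul_ne_zero hne (pow_ne_zero 2 hpne)) h5).symm
  refine ⟨fun x => g (x / ε), ?_, by simpa using g0, ?_⟩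
  · exact AnalyticAt.comp (g := g) (f := fun x : ℂ => x / ε) (by simpa using ga)
      (by fun_prop (disch := assumption))
  · have ct : Tendsto (fun x : ℂ => x / ε) (𝓝 0) (𝓝 0) := by
      have : Continuous (fun x : ℂ => x / ε) := by fun_prop
      simpa using this.tendsto 0
    have ev1 := ct.eventually (ga.eventually_analyticAt)
    have ev2 := ct.eventually (ball_mem_nhds (0 : ℂ) one_pos)
    have ev : ∀ᶠ x : ℂ in 𝓝 0, AnalyticAt ℂ g (x / ε) ∧ ‖x / ε‖ < 1 := by
      filter_upwards [ev1, ev2] with x h1 h2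
      exact ⟨h1, by simpa using h2⟩
    have der : ∀ (k : ℂ → ℂ) (x : ℂ), DifferentiableAt ℂ k (x / ε) →
        deriv (fun x : ℂ => k (x / ε)) x = deriv k (x / ε) / ε := by
      intro k x hk
      have := HasDerivAt.comp x hk.hasDerivAt ((hasDerivAt_id x).div_const (ε : ℂ))
      rw [show (fun x : ℂ => k (x / ε)) = k ∘ (fun x => id x / (ε : ℂ)) from rfl, this.deriv]
      ring
    rw [eventually_nhdsWithin_iff]
    filter_upwards [ev.eventually_nhds] with x hx hx0
    have hx0' : x ≠ 0 := hx0
    obtain ⟨k1, k2⟩ := hx.self_of_nhds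
    have e1 : deriv (fun x : ℂ => g (x / ε)) =ᶠ[𝓝 x] fun x => deriv g (x / ε) / ε := by
      filter_upwards [hx] with v hv
      exact der g v hv.1.differentiableAt
    rw [e1.deriv_eq, e1.self_of_nhds, deriv_div_const, der _ _ k1.deriv.differentiableAt]
    have := key (x / ε) (div_ne_zero hx0' hεc) k2 k1
    rw [mul_div_cancel₀ _ hεc] at this
    rw [← this]; field_simp
noncomputable def wb (g : ℂ → ℂ) (z : ℂ) : ℂ :=
  (1 / 2) * (fderiv ℝ g z (1 : ℂ) + I * fderiv ℝ g z I)
lemma hasW_of_diff {g : ℂ → ℂ} {z : ℂ} (h : DifferentiableAt ℝ g z) :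
    HasW g (wirt g z) (wb g z) z := by
  have : fderiv ℝ g z = WL (wirt g z) (wb g z) := by
    ext v
    have e : v = (v.re : ℝ) • (1 : ℂ) + (v.im : ℝ) • I := by
      simp [Complex.re_add_im]
    have h1 : fderiv ℝ g z v = (v.re : ℂ) * fderiv ℝ g z 1 + (v.im : ℂ) * fderiv ℝ g z I := by
      conv_lhs => rw [e, map_add, map_smul, map_smul]
      simp
    have h2 : v = (v.re : ℂ) + v.im * I := (Complex.re_add_im v).symm
    have h3 : conj v = (v.re : ℂ) - v.im * I := by
      apply Complex.ext <;> simp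
    rw [h1, WL_apply, h3]
    conv_rhs => rw [h2]
    simp only [wirt, wb, Complex.add_re, Complex.add_im, Complex.ofReal_re, Complex.ofReal_im,
      Complex.mul_re, Complex.mul_im, Complex.I_re, Complex.I_im]
    simp only [mul_zero, mul_one, zero_sub, sub_zero, add_zero, zero_add, zero_mul, neg_zero]
    linear_combination ((v.im : ℂ)* fderiv ℝ g z I) * Complex.I_sq
  unfold HasW
  rw [← this]; exact h.hasFDerivAt
lemma HasW.outer {g F : ℂ → ℂ} {a b p z : ℂ} (hF : HasDerivAt F p (g z)) (h : HasW g a b z) :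
    HasW (fun w => F (g w)) (p * a) (p * b) z := by
  have := HasFDerivAt.comp z (hF.hasFDerivAt.restrictScalars ℝ) h
  refine HasFDerivAt.congr_fderiv this ?_
  ext v
  simp [WL_apply]; ring
lemma smooth_wirt {g : ℂ → ℂ} {z : ℂ} (h : ∀ n : ℕ, ContDiffAt ℝ n g z) (n : ℕ) :
    ContDiffAt ℝ n (wirt g) z := by
  have h1 : ContDiffAt ℝ n (fderiv ℝ g) z := (h (n + 1)).fderiv_right (by norm_cast)
  unfold wirt
  exact contDiffAt_const.mul ((h1.clm_apply contDiffAt_const).sub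
    (contDiffAt_const.mul (h1.clm_apply contDiffAt_const)))
lemma smooth_wb {g : ℂ → ℂ} {z : ℂ} (h : ∀ n : ℕ, ContDiffAt ℝ n g z) (n : ℕ) :
    ContDiffAt ℝ n (wb g) z := by
  have h1 : ContDiffAt ℝ n (fderiv ℝ g) z := (h (n + 1)).fderiv_right (by norm_cast)
  unfold wb
  exact contDiffAt_const.mul ((h1.clm_apply contDiffAt_const).add
    (contDiffAt_const.mul (h1.clm_apply contDiffAt_const)))
lemma smooth_W {g : ℂ → ℂ} {z : ℂ} (h : ∀ n : ℕ, ContDiffAt ℝ n g z) :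
    HasW g (wirt g z) (wb g z) z :=
  hasW_of_diff ((h 1).differentiableAt (by simp))
lemma W_symm {g a b : ℂ → ℂ} {z a1 a2 b1 b2 : ℂ} (h : ∀ᶠ w in 𝓝 z, HasW g (a w) (b w) w)
    (ha : HasW a a1 a2 z) (hb : HasW b b1 b2 z) : a2 = b1 := by
  have lin : ∀ a b : ℂ, WL a b = a • WL 1 0 + b • WL 0 1 := by
    intro a b; ext v; simp [WL_apply]
  have hx : HasFDerivAt (fun w => WL (a w) (b w))
      ((WL a1 a2).smulRight (WL 1 0) + (WL b1 b2).smulRight (WL 0 1)) z := by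
    have := (HasFDerivAt.smul_const ha (WL 1 0)).add (HasFDerivAt.smul_const hb (WL 0 1))
    refine this.congr_of_eventuallyEq (Eventually.of_forall fun w => ?_)
    exact lin _ _
  have := second_derivative_symmetric_of_eventually (𝕜 := ℝ) h hx 1 I
  simp [WL_apply] at this
  have hI := Complex.I_ne_zero
  have h2 : (2 * I) * (a2 - b1) = 0 := by linear_combination this
  have := (mul_eq_zero.1 h2).resolve_left (by simp)
  exact sub_eq_zero.1 this
lemma pot_of_u {U : Set ℂ} (hU : IsOpen U) {u : ℂ → ℝ}
    (hu : ∀ z ∈ U, (∀ n : ℕ, ContDiffAt ℝ n u z) ∧ lapl u z + Real.exp (u z) = 0) :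
    ∃ Q h1 h12 : ℂ → ℂ, Pot U Q (fun z => ((Real.exp (-(u z) / 2) : ℝ) : ℂ)) h1 h12 (1 / 8) ∧
      DifferentiableOn ℂ Q U := by
  set V : ℂ → ℂ := fun z => (u z : ℂ) with hV
  have sV : ∀ z ∈ U, ∀ n : ℕ, ContDiffAt ℝ n V z := fun z hz n =>
    Complex.ofRealCLM.contDiff.contDiffAt.comp z ((hu z hz).1 n)
  set p := wirt V with hp
  have sp : ∀ z ∈ U, ∀ n : ℕ, ContDiffAt ℝ n p z := fun z hz => smooth_wirt (sV z hz)
  set a := wirt p with ha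
  set b := wb p with hb
  have sa : ∀ z ∈ U, ∀ n : ℕ, ContDiffAt ℝ n a z := fun z hz => smooth_wirt (sp z hz)
  have sb : ∀ z ∈ U, ∀ n : ℕ, ContDiffAt ℝ n b z := fun z hz => smooth_wb (sp z hz)
  have fV : ∀ z ∈ U, ∀ v, fderiv ℝ V z v = ((fderiv ℝ u z v : ℝ) : ℂ) := by
    intro z hz v
    have d : DifferentiableAt ℝ u z := ((hu z hz).1 1).differentiableAt (by simp)
    have : HasFDerivAt V (Complex.ofRealCLM.comp (fderiv ℝ u z)) z :=
      Complex.ofRealCLM.hasFDerivAt.comp z d.hasFDerivAt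
    rw [this.fderiv]; rfl
  have pe : ∀ z ∈ U, p z = (1 / 2) * (((fderiv ℝ u z 1 : ℝ) : ℂ) -
      I * ((fderiv ℝ u z I : ℝ) : ℂ)) := by
    intro z hz; rw [hp]; simp only [wirt]; rw [fV z hz, fV z hz]
  have Wb : ∀ z ∈ U, HasW V (p z) (conj (p z)) z := by
    intro z hz
    refine (smooth_W (sV z hz)).to rfl ?_
    rw [pe z hz]; simp only [wb]; rw [fV z hz, fV z hz]; simp [map_ofNat]
  have Wp : ∀ z ∈ U, HasW p (a z) (b z) z := fun z hz => smooth_W (sp z hz)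
  have bre : ∀ z ∈ U, b z = conj (b z) := by
    intro z hz
    exact W_symm (by filter_upwards [hU.mem_nhds hz] with w hw; exact Wb w hw) (Wp z hz)
      (Wp z hz).conj
  have be : ∀ z ∈ U, b z = ((-(Real.exp (u z)) / 4 : ℝ) : ℂ) := by
    intro z hz
    have d1 : ∀ e : ℂ, DifferentiableAt ℝ (fun w => fderiv ℝ u w e) z := by
      intro e
      have h1 : ContDiffAt ℝ 1 (fderiv ℝ u) z := ((hu z hz).1 2).fderiv_right (by norm_cast)
      exact (h1.clm_apply contDiffAt_const).differentiableAt (by simp)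
    have Ux := Complex.ofRealCLM.hasFDerivAt.comp z (d1 1).hasFDerivAt
    have Uy := Complex.ofRealCLM.hasFDerivAt.comp z (d1 I).hasFDerivAt
    have hpd := (Ux.sub (Uy.const_mul I)).const_mul (1 / 2 : ℂ)
    have hpd2 := hpd.congr_of_eventuallyEq (f₁ := p)
      (by filter_upwards [hU.mem_nhds hz] with w hw; rw [pe w hw]; rfl)
    have h0 : (b z).re = lapl u z / 4 := by
      rw [hb]; simp only [wb, lapl]; rw [hpd2.fderiv]
      simp
      ring
    rw [← Complex.conj_eq_iff_re.1 (bre z hz).symm, h0]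
    congr 1; linarith [(hu z hz).2]
  set h : ℂ → ℂ := fun z => ((Real.exp (-(u z) / 2) : ℝ) : ℂ) with hh
  have hh2 : ∀ z, h z = Complex.exp (-(V z) / 2) := by
    intro z; simp [hh, hV]
  have hne : ∀ z, h z ≠ 0 := fun z => by rw [hh2]; exact Complex.exp_ne_zero _
  have hre : ∀ z, conj (h z) = h z := fun z => Complex.conj_ofReal _
  have Wh : ∀ z ∈ U, HasW h (-(1 / 2) * p z * h z) (-(1 / 2) * conj (p z) * h z) z := by
    intro z hz
    have e : HasDerivAt (fun t : ℂ => Complex.exp (-t / 2)) (-(1 / 2) * Complex.exp (-(V z) / 2)) (V z) := by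
      have := (((hasDerivAt_id (V z)).neg).div_const 2).cexp
      exact this.congr_deriv (by simp only [id, Pi.neg_apply]; ring)
    refine ((HasW.outer e (Wb z hz)).congr (Eventually.of_forall fun w => hh2 w)).to ?_ ?_ <;>
    · rw [hh2]; ring
  have eu : ∀ z, ((Real.exp (u z) : ℝ) : ℂ) * h z * h z = 1 := by
    intro z
    simp only [hh]
    rw [← Complex.ofReal_mul, ← Complex.ofReal_mul, ← Real.exp_add, ← Real.exp_add]
    ring_nf; simp
  set h1 : ℂ → ℂ := fun z => -(1 / 2) * p z * h z with hh1
  set h12 : ℂ → ℂ := fun z => (1 / 8 + h1 z * conj (h1 z)) * (h z)⁻¹ with hh12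
  set Q : ℂ → ℂ := fun z => -(1 / 2) * a z + 1 / 4 * p z ^ 2 with hQ
  have cj1 : ∀ z, conj (h1 z) = -(1 / 2) * conj (p z) * h z := by
    intro z; simp only [hh1, map_mul, hre]; simp [map_ofNat]
  have D1 : ∀ z ∈ U, HasW h1 (Q z * h z) (h12 z) z := by
    intro z hz
    refine (((HasW.const (-(1 / 2)) z).mul (Wp z hz)).mul (Wh z hz)).to ?_ ?_
    · simp only [hQ]; ring
    · simp only [hh12]
      rw [cj1]; simp only [hh1]
      rw [be z hz]; push_cast
      have := hne z
      field_simp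
      have e := eu z
      push_cast at e
      linear_combination 16 * e
  have D0 : ∀ z ∈ U, HasW h (h1 z) (conj (h1 z)) z := fun z hz => (Wh z hz).to rfl (cj1 z).symm
  refine ⟨Q, h1, h12, ⟨hU, D0, D1, ?_, fun z _ => hre z, ?_, ?_, by norm_num, ?_⟩, ?_⟩
  · intro z hz
    have einv : HasDerivAt (fun t : ℂ => t⁻¹) (-(h z ^ 2)⁻¹) (h z) := hasDerivAt_inv (hne z)
    have r12 : conj (h12 z) = h12 z := by
      simp only [hh12, map_mul, map_add, map_inv₀, hre, Complex.conj_conj, map_div₀, map_one, map_ofNat]; ring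
    have := (((HasW.const (1 / 8) z).add ((D1 z hz).mul (D1 z hz).conj)).mul
      (HasW.outer einv (D0 z hz)))
    have e12 : 1 / 8 + h1 z * conj (h1 z) = h12 z * h z := by
      simp only [hh12]; rw [inv_mul_cancel_right₀ (hne z)]
    have := hne z
    refine (by assumption : HasW _ _ _ z).to ?_ ?_
    · simp only [r12, map_mul, hre, e12]
      field_simp; ring
    · simp only [r12, map_mul, hre, e12]
      field_simp; ring
  · intro z hz
    simp only [hh12, map_mul, map_add, map_inv₀, hre, Complex.conj_conj, map_div₀, map_one, map_ofNat]; ring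
  · intro z hz
    simp only [hh, Complex.ofReal_re]; exact Real.exp_pos _
  · intro z hz
    simp only [hh12]
    have := hne z
    field_simp; push_cast; ring
  · intro z hz
    have Wa : HasW a (wirt a z) (wb a z) z := smooth_W (sa z hz)
    have eb : HasW b (-(Real.exp (u z) : ℂ) / 4 * p z) (-(Real.exp (u z) : ℂ) / 4 * conj (p z)) z := by
      have e : HasDerivAt (fun t : ℂ => -Complex.exp t / 4) (-Complex.exp (V z) / 4) (V z) :=
        ((Complex.hasDerivAt_exp (V z)).neg).div_const 4
      refine ((HasW.outer e (Wb z hz)).congr ?_).to ?_ ?_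
      · filter_upwards [hU.mem_nhds hz] with w hw
        rw [be w hw]; simp [hV]
      · simp [hV]
      · simp [hV]
    have e2 : wb a z = -(Real.exp (u z) : ℂ) / 4 * p z :=
      W_symm (by filter_upwards [hU.mem_nhds hz] with w hw; exact Wp w hw) Wa eb
    have WQ := ((HasW.const (-(1 / 2)) z).mul Wa).add ((HasW.const (1 / 4) z).mul
      ((Wp z hz).mul (Wp z hz)))
    have WQ2 : HasW Q (-(1 / 2) * wirt a z + 1 / 4 * (2 * p z * a z)) 0 z := by
      refine (WQ.congr (Eventually.of_forall fun w => ?_)).to ?_ ?_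
      · simp only [hQ]; ring
      · ring
      · rw [e2, be z hz]; push_cast; ring
    exact WQ2.hasDerivAt.differentiableAt.differentiableWithinAt
noncomputable section
def pn (b : ℝ) : ℝ := Real.exp (-(2 * π * b))
def PP (b : ℝ) (x : ℂ) : ℂ := ∏' n : ℕ, (1 + -((pn b : ℂ) ^ (n + 1) * x))
def ee (z : ℂ) : ℂ := Complex.exp (2 * π * I * z)
def Sg (b : ℝ) (z : ℂ) : ℂ := Complex.sin (π * z) * PP b (ee z) * PP b (ee (-z))
def Zc (b : ℝ) (z : ℂ) : ℂ := logDeriv (Sg b) z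
end
lemma pn_pos (b : ℝ) : 0 < pn b := Real.exp_pos _
lemma pn_lt {b : ℝ} (hb : 0 < b) : pn b < 1 := by
  rw [pn, Real.exp_lt_one_iff]; have := Real.pi_pos
  have : 0 < 2 * π * b := by positivity
  linarith
lemma pn_norm (b : ℝ) (x : ℂ) (n : ℕ) : ‖-((pn b : ℂ) ^ (n + 1) * x)‖ = pn b ^ (n + 1) * ‖x‖ := by
  rw [norm_neg, norm_mul, norm_pow, Complex.norm_real, Real.norm_eq_abs, abs_of_pos (pn_pos b)]
lemma pn_sum {b : ℝ} (hb : 0 < b) (R : ℝ) : Summable (fun n : ℕ => pn b ^ (n + 1) * R) :=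
  ((summable_nat_add_iff 1).mpr (summable_geometric_of_lt_one (pn_pos b).le (pn_lt hb))).mul_right R
lemma PP_mult {b : ℝ} (hb : 0 < b) (x : ℂ) :
    Multipliable (fun n : ℕ => (1 + -((pn b : ℂ) ^ (n + 1) * x))) := by
  apply multipliable_one_add_of_summable
  simp only [pn_norm]; exact pn_sum hb _
lemma PP_lu {b : ℝ} (hb : 0 < b) (R : ℝ) :
    MultipliableLocallyUniformlyOn (fun (n : ℕ) (x : ℂ) => (1 + -((pn b : ℂ) ^ (n + 1) * x)))
      (ball (0 : ℂ) R) := by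
  refine Summable.multipliableLocallyUniformlyOn_nat_one_add isOpen_ball (pn_sum hb R) ?_
    (fun n => by fun_prop)
  refine Eventually.of_forall fun n x hx => ?_
  rw [pn_norm]
  have := pn_pos b
  have h2 : ‖x‖ ≤ R := by simpa using (mem_ball_zero_iff.1 hx).le
  gcongr
lemma PP_diff {b : ℝ} (hb : 0 < b) : Differentiable ℂ (PP b) := by
  intro x
  have h := (PP_lu hb (‖x‖ + 1)).hasProdLocallyUniformlyOn.differentiableOn
    (.of_forall fun _ ↦ by simpa [Finset.prod_fn] using
      DifferentiableOn.finsetProd (fun _ _ ↦ by fun_prop)) Metric.isOpen_ball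
  exact h.differentiableAt (isOpen_ball.mem_nhds (by simp))
lemma PP_fun {b : ℝ} (hb : 0 < b) (x : ℂ) : PP b x = (1 - pn b * x) * PP b (pn b * x) := by
  have := tprod_eq_zero_mul' (f := fun n : ℕ => (1 + -((pn b : ℂ) ^ (n + 1) * x)))
    (by
      have := PP_mult hb (pn b * x)
      refine this.congr fun n => ?_
      ring)
  rw [PP, this, PP]
  congr 1
  · ring
  · congr 1; ext n; ring
lemma PP_ne {b : ℝ} (hb : 0 < b) {x : ℂ} (hx : ∀ n : ℕ, 1 - (pn b : ℂ) ^ (n + 1) * x ≠ 0) :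
    PP b x ≠ 0 := by
  apply tprod_one_add_ne_zero_of_summable
  · intro n; rw [← sub_eq_add_neg]; exact hx n
  · simp only [pn_norm]; exact pn_sum hb _
lemma PP_zero {b : ℝ} (hb : 0 < b) {x : ℂ} {n : ℕ} (hx : 1 - (pn b : ℂ) ^ (n + 1) * x = 0) :
    PP b x = 0 := by
  apply tprod_of_exists_eq_zero
  exact ⟨n, by rw [← sub_eq_add_neg]; exact hx⟩
lemma PP_im {b : ℝ} (hb : 0 < b) {x : ℂ} (hx : ∀ n : ℕ, 1 - (pn b : ℂ) ^ (n + 1) * x ≠ 0) :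
    ∃ T : ℝ, 0 ≤ T ∧ (x * logDeriv (PP b) x).im = -T * x.im := by
  have hp := pn_pos b
  have ld : ∀ n : ℕ, logDeriv (fun x : ℂ => (1 + -((pn b : ℂ) ^ (n + 1) * x))) x =
      -(pn b : ℂ) ^ (n + 1) / (1 - (pn b : ℂ) ^ (n + 1) * x) := by
    intro n
    rw [logDeriv_apply]
    have : HasDerivAt (fun x : ℂ => (1 + -((pn b : ℂ) ^ (n + 1) * x))) (-(pn b : ℂ) ^ (n + 1)) x := by
      exact ((((hasDerivAt_id x).const_mul ((pn b : ℂ) ^ (n + 1))).neg).const_add 1).congr_deriv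
        (by simp)
    rw [this.deriv]; congr 1
  have sm : Summable fun n : ℕ => logDeriv (fun x : ℂ => (1 + -((pn b : ℂ) ^ (n + 1) * x))) x := by
    simp only [ld]
    have t0 : Tendsto (fun n : ℕ => pn b ^ (n + 1) * ‖x‖) atTop (𝓝 0) := (pn_sum hb ‖x‖).tendsto_atTop_zero
    refine Summable.of_norm_bounded_eventually_nat (pn_sum hb 2) ?_
    filter_upwards [t0.eventually (gt_mem_nhds (show (0 : ℝ) < 1 / 2 by norm_num))] with n hn
    rw [norm_div, norm_neg, norm_pow, Complex.norm_real, Real.norm_eq_abs, abs_of_pos hp,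
      div_le_iff₀ (norm_pos_iff.2 (hx n))]
    have h3 : 1 / 2 ≤ ‖1 - (pn b : ℂ) ^ (n + 1) * x‖ := by
      have := norm_sub_norm_le (1 : ℂ) ((pn b : ℂ) ^ (n + 1) * x)
      rw [norm_one] at this
      have e := pn_norm b x n
      rw [norm_neg] at e
      linarith
    have : 0 < pn b ^ (n + 1) := by positivity
    nlinarith
  have key := logDeriv_tprod_eq_tsum (s := ball (0 : ℂ) (‖x‖ + 1)) isOpen_ball (x := x) (by simp)
    (f := fun (n : ℕ) (x : ℂ) => (1 + -((pn b : ℂ) ^ (n + 1) * x)))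
    (fun n => by rw [← sub_eq_add_neg]; exact hx n)
    (fun n => by fun_prop) sm (PP_lu hb _) (PP_ne hb hx)
  refine ⟨∑' n : ℕ, pn b ^ (n + 1) / Complex.normSq (1 - (pn b : ℂ) ^ (n + 1) * x),
    tsum_nonneg fun n => by have := Complex.normSq_nonneg (1 - (pn b : ℂ) ^ (n + 1) * x); positivity, ?_⟩
  have e : logDeriv (PP b) x = ∑' n : ℕ, logDeriv (fun x : ℂ => (1 + -((pn b : ℂ) ^ (n + 1) * x))) x := key
  rw [e, ← tsum_mul_left, Complex.im_tsum (sm.mul_left x), neg_mul, ← tsum_mul_right, ← tsum_neg]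
  congr 1; ext n
  rw [ld n]
  have hn := Complex.normSq_pos.2 (hx n)
  have e2 : x * (-(pn b : ℂ) ^ (n + 1) / (1 - (pn b : ℂ) ^ (n + 1) * x)) =
    (-((pn b ^ (n + 1) / Complex.normSq (1 - (pn b : ℂ) ^ (n + 1) * x) : ℝ)) : ℂ) *
      (x * conj (1 - (pn b : ℂ) ^ (n + 1) * x)) := by
    rw [div_eq_mul_inv, Complex.inv_def]; push_cast; field_simp
  rw [e2, ← Complex.ofReal_neg, Complex.im_ofReal_mul]
  have e3 : (x * conj (1 - (pn b : ℂ) ^ (n + 1) * x)).im = x.im := by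
    have : x * conj (1 - (pn b : ℂ) ^ (n + 1) * x) = x - ((pn b ^ (n + 1) * Complex.normSq x : ℝ) : ℂ) := by
      simp only [map_sub, map_mul, map_pow, map_one, Complex.conj_ofReal]
      push_cast
      rw [← Complex.mul_conj]; ring
    rw [this]; simp only [Complex.sub_im, Complex.ofReal_im, sub_zero]
  rw [e3]; ring
lemma ee_ne (z : ℂ) : ee z ≠ 0 := Complex.exp_ne_zero _
lemma ee_add (z w : ℂ) : ee (z + w) = ee z * ee w := by
  simp only [ee]; rw [← Complex.exp_add]; congr 1; ring
lemma ee_neg (z : ℂ) : ee (-z) = (ee z)⁻¹ := by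
  simp only [ee]; rw [← Complex.exp_neg]; congr 1; ring
lemma ee_one : ee 1 = 1 := by simp [ee, Complex.exp_two_pi_mul_I]
lemma ee_ib (b : ℝ) : ee (I * b) = pn b := by
  simp only [ee, pn]; push_cast; congr 1
  linear_combination (2 * π * b : ℂ) * Complex.I_sq
lemma ee_eq_one {z : ℂ} : ee z = 1 ↔ ∃ n : ℤ, z = n := by
  simp only [ee, Complex.exp_eq_one_iff]
  have : (2 * π * I : ℂ) ≠ 0 := by simp [Real.pi_ne_zero]
  constructor
  · rintro ⟨n, hn⟩
    exact ⟨n, mul_left_cancel₀ this (by rw [hn]; ring)⟩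
  · rintro ⟨n, hn⟩; exact ⟨n, by rw [hn]; ring⟩
lemma ee_d (z : ℂ) : HasDerivAt ee (2 * π * I * ee z) z := by
  exact ((hasDerivAt_id z).const_mul (2 * π * I)).cexp.congr_deriv (by simp only [id, ee]; ring)
lemma ee_im (z : ℂ) : (ee z).im = Real.exp (-(2 * π * z.im)) * Real.sin (2 * π * z.re) := by
  simp only [ee, Complex.exp_im]; congr 2 <;> simp [Complex.mul_re, Complex.mul_im]
lemma pn_pow_ee (b : ℝ) (n : ℕ) (z : ℂ) : (pn b : ℂ) ^ n * ee z = ee (z + n * (I * b)) := by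
  induction n with
  | zero => simp
  | succ n ih =>
    rw [pow_succ, mul_right_comm, ih, ← ee_ib, ← ee_add]; congr 1; push_cast; ring
abbrev LL (b : ℝ) : Set ℂ := lat (I * (b : ℂ))
lemma LL_add {b : ℝ} {z w : ℂ} (h : z ∈ LL b) (h' : w ∈ LL b) : z + w ∈ LL b := by
  obtain ⟨m, n, rfl⟩ := h; obtain ⟨m', n', rfl⟩ := h'
  exact ⟨m + m', n + n', by push_cast; ring⟩
lemma LL_neg {b : ℝ} {z : ℂ} (h : z ∈ LL b) : -z ∈ LL b := by
  obtain ⟨m, n, rfl⟩ := h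
  exact ⟨-m, -n, by push_cast; ring⟩
lemma LL_zero (b : ℝ) : (0 : ℂ) ∈ LL b := ⟨0, 0, by simp⟩
lemma LL_one (b : ℝ) : (1 : ℂ) ∈ LL b := ⟨1, 0, by simp⟩
lemma LL_ib (b : ℝ) : (I * b : ℂ) ∈ LL b := ⟨0, 1, by simp⟩
lemma LL_sub {b : ℝ} {z w : ℂ} (h : z ∈ LL b) (h' : w ∈ LL b) : z - w ∈ LL b := by
  rw [sub_eq_add_neg]; exact LL_add h (LL_neg h')
lemma LL_iff {b : ℝ} {z : ℂ} : z ∈ LL b ↔ ∃ m n : ℤ, z.re = m ∧ z.im = n * b := by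
  constructor
  · rintro ⟨m, n, rfl⟩; exact ⟨m, n, by simp, by simp⟩
  · rintro ⟨m, n, h1, h2⟩; exact ⟨m, n, by apply Complex.ext <;> simp [h1, h2]⟩
lemma one_sub_ne {b : ℝ} {z : ℂ} (hz : z ∉ LL b) (n : ℕ) : 1 - (pn b : ℂ) ^ (n + 1) * ee z ≠ 0 := by
  intro h
  have h2 : (pn b : ℂ) ^ (n + 1) * ee z = 1 := by linear_combination -h
  rw [pn_pow_ee, ee_eq_one] at h2
  obtain ⟨m, hm⟩ := h2
  apply hz
  exact ⟨m, -(n + 1), by push_cast; push_cast at hm; linear_combination hm⟩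
lemma sin_ne {b : ℝ} {z : ℂ} (hz : z ∉ LL b) : Complex.sin (π * z) ≠ 0 := by
  intro h
  rw [Complex.sin_eq_zero_iff] at h
  obtain ⟨k, hk⟩ := h
  have hpi : (π : ℂ) ≠ 0 := by exact_mod_cast Real.pi_ne_zero
  apply hz
  exact ⟨k, 0, by apply mul_left_cancel₀ hpi; rw [hk]; push_cast; ring⟩
lemma Sg_ne {b : ℝ} (hb : 0 < b) {z : ℂ} (hz : z ∉ LL b) : Sg b z ≠ 0 := by
  have hz' : -z ∉ LL b := fun h => hz (by simpa using LL_neg h)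
  exact mul_ne_zero (mul_ne_zero (sin_ne hz) (PP_ne hb (one_sub_ne hz))) (PP_ne hb (one_sub_ne hz'))
lemma Sg_diff {b : ℝ} (hb : 0 < b) : Differentiable ℂ (Sg b) := by
  have h1 := PP_diff hb
  have h2 : Differentiable ℂ ee := fun z => (ee_d z).differentiableAt
  unfold Sg
  exact ((Complex.differentiable_sin.comp (by fun_prop)).mul (h1.comp h2)).mul
    (h1.comp (h2.comp differentiable_neg))
lemma Sg_neg (b : ℝ) (z : ℂ) : Sg b (-z) = -Sg b z := by
  simp only [Sg, mul_neg, Complex.sin_neg, neg_neg]; ring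
lemma Sg_one (b : ℝ) (z : ℂ) : Sg b (z + 1) = -Sg b z := by
  simp only [Sg]
  rw [neg_add, ee_add, ee_add, ee_neg 1, ee_one, mul_add, mul_one, Complex.sin_add_pi]; simp
lemma sin_ee (z : ℂ) : Complex.sin (π * z) =
    I / 2 * Complex.exp (-(π * I * z)) * (1 - ee z) := by
  rw [Complex.sin]
  have : Complex.exp (π * z * I) = Complex.exp (-(π * I * z)) * ee z := by
    simp only [ee]; rw [← Complex.exp_add]; congr 1; ring
  rw [this, show -(π * z) * I = -(π * I * z) by ring]; ring
lemma Sg_ib {b : ℝ} (hb : 0 < b) (z : ℂ) :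
    Sg b (z + I * b) = -(Complex.exp (π * b) * ee (-z)) * Sg b z := by
  have hp : (pn b : ℂ) ≠ 0 := by exact_mod_cast (pn_pos b).ne'
  simp only [Sg]
  have e1 : ee (z + I * b) = pn b * ee z := by rw [ee_add, ee_ib, mul_comm]
  have e2 : ee (-(z + I * b)) = (pn b : ℂ)⁻¹ * ee (-z) := by
    rw [neg_add, ee_add, ee_neg (I * b), ee_ib, mul_comm]
  rw [e1, e2, PP_fun hb ((pn b : ℂ)⁻¹ * ee (-z)), PP_fun hb (ee z), mul_inv_cancel_left₀ hp,
    sin_ee, sin_ee, e1]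
  have e3 : Complex.exp (-(π * I * (z + I * b))) =
      Complex.exp (-(π * I * z)) * Complex.exp (π * b) := by
    rw [← Complex.exp_add]; congr 1; linear_combination (-(π * b : ℂ)) * Complex.I_sq
  rw [e3, ee_neg]
  have := ee_ne z
  field_simp
  ring
lemma PP_one_ne {b : ℝ} (hb : 0 < b) : PP b 1 ≠ 0 := by
  apply PP_ne hb
  intro n h
  have h2 : pn b ^ (n + 1) < 1 := pow_lt_one₀ (pn_pos b).le (pn_lt hb) (by simp)
  have : (1 : ℂ) - ((pn b ^ (n + 1) : ℝ) : ℂ) = 0 := by push_cast; linear_combination h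
  have h3 : 1 - pn b ^ (n + 1) = 0 := by exact_mod_cast this
  linarith
lemma Sg_d0 {b : ℝ} (hb : 0 < b) : deriv (Sg b) 0 ≠ 0 := by
  have h1 : Differentiable ℂ (fun z => PP b (ee z) * PP b (ee (-z))) := by
    have h1 := PP_diff hb
    have h2 : Differentiable ℂ ee := fun z => (ee_d z).differentiableAt
    exact (h1.comp h2).mul (h1.comp (h2.comp differentiable_neg))
  have h2 : HasDerivAt (fun z : ℂ => Complex.sin (π * z)) (π : ℂ) 0 := by
    have := ((hasDerivAt_id (0 : ℂ)).const_mul (π : ℂ)).csin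
    exact this.congr_deriv (by simp)
  have h3 := h2.mul (h1 0).hasDerivAt
  have h4 : HasDerivAt (Sg b) (π * (PP b 1 * PP b 1)) 0 := by
    refine (h3.congr_of_eventuallyEq (Eventually.of_forall fun z => ?_)).congr_deriv ?_
    · simp only [Sg, Pi.mul_apply]; ring
    · simp [ee]
  rw [h4.deriv]
  have hpi : (π : ℂ) ≠ 0 := by exact_mod_cast Real.pi_ne_zero
  exact mul_ne_zero hpi (mul_ne_zero (PP_one_ne hb) (PP_one_ne hb))
lemma Zc_re {b : ℝ} (hb : 0 < b) {z : ℂ} (hz : z ∉ LL b) :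
    ∃ T : ℝ, 0 < T ∧ (Zc b z).re = T * Real.sin (2 * π * z.re) := by
  have hz' : -z ∉ LL b := fun h => hz (by simpa using LL_neg h)
  obtain ⟨T1, h1, e1⟩ := PP_im hb (one_sub_ne hz)
  obtain ⟨T2, h2, e2⟩ := PP_im hb (one_sub_ne hz')
  have hD := PP_diff hb
  have hs := sin_ne hz
  have n1 := PP_ne hb (one_sub_ne hz)
  have n2 := PP_ne hb (one_sub_ne hz')
  have d0 : HasDerivAt (fun z : ℂ => Complex.sin (π * z)) (π * Complex.cos (π * z)) z :=
    ((hasDerivAt_id z).const_mul (π : ℂ)).csin.congr_deriv (by simp only [id]; ring)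
  have d1 : HasDerivAt (fun z => PP b (ee z)) (deriv (PP b) (ee z) * (2 * π * I * ee z)) z :=
    HasDerivAt.comp z (hD _).hasDerivAt (ee_d z)
  have d2 : HasDerivAt (fun z => PP b (ee (-z)))
      (deriv (PP b) (ee (-z)) * (-(2 * π * I * ee (-z)))) z := by
    have a : HasDerivAt (fun z => ee (-z)) (-(2 * π * I * ee (-z))) z :=
      (HasDerivAt.comp z (ee_d (-z)) (hasDerivAt_neg z)).congr_deriv (by ring)
    exact HasDerivAt.comp z (hD _).hasDerivAt a
  have d3 : HasDerivAt (Sg b) _ z := (d0.mul d1).mul d2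
  have e : Zc b z = π * (Complex.cos (π * z) / Complex.sin (π * z)) +
      2 * π * (I * (ee z * logDeriv (PP b) (ee z))) -
      2 * π * (I * (ee (-z) * logDeriv (PP b) (ee (-z)))) := by
    rw [Zc, logDeriv_apply, d3.deriv, logDeriv_apply, logDeriv_apply]
    simp only [Sg, Pi.mul_apply]
    field_simp
    ring
  have c1 : (Complex.cos (π * z) / Complex.sin (π * z)).re =
      Real.sin (2 * π * z.re) / (2 * Complex.normSq (Complex.sin (π * z))) := by
    have hn := Complex.normSq_pos.2 hs
    have e : Complex.cos (π * z) / Complex.sin (π * z) =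
      ((Complex.normSq (Complex.sin (π * z)))⁻¹ : ℝ) * (Complex.cos (π * z) * conj (Complex.sin (π * z))) := by
      rw [div_eq_mul_inv, Complex.inv_def]; push_cast; ring
    rw [e, Complex.re_ofReal_mul]
    have h5 : (Complex.cos (π * z) * conj (Complex.sin (π * z))).re = Real.sin (2 * π * z.re) / 2 := by
      have hsin := Complex.sin_eq (π * z)
      have hcos := Complex.cos_eq (π * z)
      rw [hsin, hcos]
      have r1 : ((π : ℂ) * z).re = π * z.re := by simp
      have r2 : ((π : ℂ) * z).im = π * z.im := by simp
      rw [r1, r2, show 2 * π * z.re = 2 * (π * z.re) by ring, Real.sin_two_mul,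
        ← Complex.ofReal_cosh, ← Complex.ofReal_sinh, ← Complex.ofReal_cos, ← Complex.ofReal_sin]
      simp only [Complex.mul_re, Complex.conj_re, Complex.conj_im, Complex.sub_re, Complex.sub_im,
        Complex.add_re, Complex.add_im, Complex.ofReal_re, Complex.ofReal_im, Complex.mul_im,
        Complex.I_re, Complex.I_im]
      have := Real.cosh_sq (π * z.im)
      linear_combination Real.sin (π * z.re) * Real.cos (π * z.re) * this
    rw [h5]; field_simp
  have hpi := Real.pi_pos
  refine ⟨π / (2 * Complex.normSq (Complex.sin (π * z))) +
    2 * π * T1 * Real.exp (-(2 * π * z.im)) + 2 * π * T2 * Real.exp (2 * π * z.im), ?_, ?_⟩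
  · have hn := Complex.normSq_pos.2 hs
    positivity
  · have i1 := ee_im z
    have i2 := ee_im (-z)
    have i3 : (ee (-z)).im = -(Real.exp (2 * π * z.im) * Real.sin (2 * π * z.re)) := by
      rw [i2]; simp
    rw [i1] at e1
    rw [i3] at e2
    have r : (Zc b z).re = π * (Complex.cos (π * z) / Complex.sin (π * z)).re -
        2 * π * (ee z * logDeriv (PP b) (ee z)).im + 2 * π * (ee (-z) * logDeriv (PP b) (ee (-z))).im := by
      rw [e, Complex.sub_re, Complex.add_re, Complex.re_ofReal_mul,
        show (2 * π : ℂ) = ((2 * π : ℝ) : ℂ) by push_cast; rfl, Complex.re_ofReal_mul,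
        Complex.re_ofReal_mul, Complex.I_mul_re, Complex.I_mul_re]; ring
    rw [r, c1, e1, e2]; ring
def AE (F : ℂ → ℂ) (z : ℂ) : Prop := ∃ g, AnalyticAt ℂ g z ∧ F =ᶠ[𝓝[≠] z] g
section
variable {F G : ℂ → ℂ} {z : ℂ}
lemma AnalyticAt.ae (h : AnalyticAt ℂ F z) : AE F z := ⟨F, h, EventuallyEq.rfl⟩
lemma AE.congr (h : AE G z) (e : F =ᶠ[𝓝[≠] z] G) : AE F z := by
  obtain ⟨g, h1, h2⟩ := h; exact ⟨g, h1, e.trans h2⟩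
lemma AE.sub (h : AE F z) (h' : AE G z) : AE (fun x => F x - G x) z := by
  obtain ⟨g, h1, h2⟩ := h; obtain ⟨g', h1', h2'⟩ := h'
  exact ⟨_, h1.sub h1', by filter_upwards [h2, h2'] with x a b; simp [a, b]⟩
lemma AE.add (h : AE F z) (h' : AE G z) : AE (fun x => F x + G x) z := by
  obtain ⟨g, h1, h2⟩ := h; obtain ⟨g', h1', h2'⟩ := h'
  exact ⟨_, h1.add h1', by filter_upwards [h2, h2'] with x a b; simp [a, b]⟩
lemma AE.mul (h : AE F z) (h' : AE G z) : AE (fun x => F x * G x) z := by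
  obtain ⟨g, h1, h2⟩ := h; obtain ⟨g', h1', h2'⟩ := h'
  exact ⟨_, h1.mul h1', by filter_upwards [h2, h2'] with x a b; simp [a, b]⟩
lemma AE.const (c : ℂ) : AE (fun _ => c) z := analyticAt_const.ae
lemma tendsto_shift (z t : ℂ) : Tendsto (fun x => x + t) (𝓝[≠] z) (𝓝[≠] (z + t)) := by
  refine tendsto_nhdsWithin_iff.2 ⟨?_, ?_⟩
  · exact ((continuous_id.add continuous_const).tendsto z).mono_left nhdsWithin_le_nhds
  · filter_upwards [self_mem_nhdsWithin] with x hx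
    simpa using hx
lemma ev_shift {p : ℂ → Prop} {t w : ℂ} (h : ∀ᶠ x in 𝓝[≠] w, p x) (hw : w = z + t) :
    ∀ᶠ x in 𝓝[≠] z, p (x + t) := by
  subst hw; exact (tendsto_shift z t).eventually h
lemma AE.shift {t w : ℂ} (h : AE F w) (hw : w = z + t) : AE (fun x => F (x + t)) z := by
  obtain ⟨g, h1, h2⟩ := h
  subst hw
  refine ⟨fun x => g (x + t), ?_, ev_shift h2 rfl⟩
  exact AnalyticAt.comp' (f := fun x => x + t) h1 (by fun_prop)
lemma pe_eq {g k : ℂ → ℂ} (hg : ContinuousAt g z) (hk : ContinuousAt k z)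
    (h : g =ᶠ[𝓝[≠] z] k) : g z = k z :=
  tendsto_nhds_unique ((hg.mono_left nhdsWithin_le_nhds).congr' h) (hk.mono_left nhdsWithin_le_nhds)
lemma pe_self {p : ℂ → Prop} (h : ∀ᶠ x in 𝓝[≠] z, p x) : ∀ᶠ x in 𝓝[≠] z, ∀ᶠ y in 𝓝 x, p y := by
  have h1 := eventually_nhdsWithin_iff.1 h
  rw [eventually_nhdsWithin_iff]
  filter_upwards [h1.eventually_nhds] with x hx hxz
  filter_upwards [hx, isOpen_ne.mem_nhds hxz] with y hy hyz
  exact hy hyz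
lemma ae_entire (h : ∀ z, AE F z) : ∃ G : ℂ → ℂ, Differentiable ℂ G ∧ ∀ z, F =ᶠ[𝓝[≠] z] G := by
  choose g h1 h2 using h
  have key : ∀ z, (fun x => g x x) =ᶠ[𝓝 z] g z := by
    intro z
    have a := eventually_nhdsWithin_iff.1 ((pe_self (h2 z)).and
      ((h1 z).eventually_analyticAt.filter_mono nhdsWithin_le_nhds))
    filter_upwards [a] with x hx
    by_cases hxz : x = z
    · rw [hxz]
    · obtain ⟨b1, b2⟩ := hx hxz
      exact pe_eq (h1 x).continuousAt b2.continuousAt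
        ((h2 x).symm.trans (b1.filter_mono nhdsWithin_le_nhds))
  exact ⟨fun x => g x x, fun z => ((h1 z).congr (EventuallyEq.symm (key z))).differentiableAt,
    fun z => (h2 z).trans ((EventuallyEq.symm (key z)).filter_mono nhdsWithin_le_nhds)⟩
lemma bdd_of_per {b : ℝ} (hb : 0 < b) {G : ℂ → ℂ} (hG : Differentiable ℂ G)
    (h1 : ∀ z, G (z + 1) = G z) (h2 : ∀ z, G (z + I * b) = G z) (z w : ℂ) : G z = G w := by
  apply hG.apply_eq_apply_of_bounded
  have a1 : ∀ (n : ℤ) z, G (z + n) = G z := by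
    intro n z
    have := Function.Periodic.int_mul (f := G) (c := 1) h1 n z
    simpa using this
  have a2 : ∀ (n : ℤ) z, G (z + n * (I * b)) = G z := by
    intro n z
    exact Function.Periodic.int_mul (f := G) (c := I * b) h2 n z
  have hK : IsCompact (Icc (0 : ℝ) 1 ×ℂ Icc (0 : ℝ) b) := IsCompact.reProdIm isCompact_Icc isCompact_Icc
  refine (hK.image hG.continuous).isBounded.subset ?_
  rintro _ ⟨z, rfl⟩
  refine ⟨z + ((-⌊z.re⌋ : ℤ) : ℂ) + ((-⌊z.im / b⌋ : ℤ) : ℂ) * (I * b), ?_, by rw [a2, a1]⟩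
  have b1 := Int.floor_le z.re
  have b2 := Int.lt_floor_add_one z.re
  have b3 := Int.floor_le (z.im / b)
  have b4 := Int.lt_floor_add_one (z.im / b)
  rw [le_div_iff₀ hb] at b3
  rw [div_lt_iff₀ hb] at b4
  rw [Complex.mem_reProdIm]
  simp only [mem_Icc]
  simp
  refine ⟨⟨b1, by linarith⟩, b3, by linarith⟩
lemma int_shift {t p : ℂ} (h : ∀ z, ∀ᶠ x in 𝓝[≠] z, F (x + t) = F x + p) (n : ℤ) :
    ∀ z, ∀ᶠ x in 𝓝[≠] z, F (x + n * t) = F x + n * p := by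
  induction n using Int.induction_on with
  | zero => intro z; simp
  | succ n ih =>
    intro z
    filter_upwards [ih z, ev_shift (h (z + n * t)) rfl] with x h1 h2
    push_cast at h1 ⊢
    rw [add_mul, one_mul, ← add_assoc, h2, h1]; ring
  | pred n ih =>
    intro z
    filter_upwards [ih z, ev_shift (t := ((-n - 1 : ℤ) : ℂ) * t) (h (z + ((-n - 1 : ℤ) : ℂ) * t)) rfl] with x h1 h2
    push_cast at h1 h2 ⊢
    have e : x + (-n - 1) * t + t = x + -n * t := by ring
    rw [e, h1] at h2
    linear_combination -h2
lemma EQ {b : ℝ} (hb : 0 < b) {p1 p2 : ℂ} (hAE : ∀ z, ∃ l ∈ LL b, AE F (z + l))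
    (h1 : ∀ z, ∀ᶠ x in 𝓝[≠] z, F (x + 1) = F x + p1)
    (h2 : ∀ z, ∀ᶠ x in 𝓝[≠] z, F (x + I * b) = F x + p2) :
    p2 = p1 * (I * b) ∧ ∃ d, ∀ z, ∀ᶠ x in 𝓝[≠] z, F x = p1 * x + d := by
  have hA : ∀ z, AE F z := by
    intro z
    obtain ⟨l, ⟨m, n, hl⟩, h⟩ := hAE z
    have h3 : AE (fun x => F (x + l) - (m * p1 + n * p2)) z := (h.shift rfl).sub (AE.const _)
    refine h3.congr ?_
    filter_upwards [int_shift h2 n z, ev_shift (t := n * (I * b)) (int_shift h1 m _) rfl] with x a1 a2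
    rw [show x + l = x + n * (I * b) + m * 1 by rw [hl]; ring, a2, a1]; ring
  obtain ⟨G, hG, hF⟩ := ae_entire hA
  have key : ∀ t p, (∀ z, ∀ᶠ x in 𝓝[≠] z, F (x + t) = F x + p) → ∀ z, G (z + t) = G z + p := by
    intro t p h z
    have hc := hG.continuous
    refine pe_eq (g := fun x => G (x + t)) (k := fun x => G x + p)
      (by fun_prop) (by fun_prop) ?_
    filter_upwards [h z, hF z, ev_shift (hF (z + t)) rfl] with x a1 a2 a3
    rw [← a3, ← a2, a1]
  have g1 := key _ _ h1
  have g2 := key _ _ h2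
  have dper : ∀ t p, (∀ z, G (z + t) = G z + p) → ∀ z, deriv G (z + t) = deriv G z := by
    intro t p h z
    have := congrArg (fun f => deriv f z) (funext h)
    simpa [deriv_comp_add_const] using this
  have hd : ∀ z, deriv G z = deriv G 0 := fun z =>
    bdd_of_per hb (fun z => ((hG.analyticAt z).deriv).differentiableAt) (dper _ _ g1) (dper _ _ g2) z 0
  set c := deriv G 0
  have hlin : ∀ z, G z = c * z + G 0 := by
    intro z
    have := is_const_of_deriv_eq_zero (f := fun z => G z - c * z) (by fun_prop) (by
      intro x
      have : HasDerivAt (fun z => G z - c * z) (c - c) x :=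
        ((hG x).hasDerivAt.congr_deriv (hd x)).sub (((hasDerivAt_id x).const_mul c).congr_deriv (by simp))
      rw [this.deriv, sub_self]) z 0
    simp at this
    linear_combination this
  have e1 := g1 0
  have e2 := g2 0
  rw [hlin] at e1 e2
  have hc : c = p1 := by linear_combination e1
  refine ⟨by linear_combination -e2 + (I * b) * hc, G 0, fun z => ?_⟩
  filter_upwards [hF z] with x hx
  rw [hx, hlin, hc]
lemma E0 {b : ℝ} (hb : 0 < b) (hAE : ∀ z, ∃ l ∈ LL b, AE F (z + l))
    (h1 : ∀ z, ∀ᶠ x in 𝓝[≠] z, F (x + 1) = F x)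
    (h2 : ∀ z, ∀ᶠ x in 𝓝[≠] z, F (x + I * b) = F x) :
    ∃ d, ∀ z, ∀ᶠ x in 𝓝[≠] z, F x = d := by
  obtain ⟨_, d, h⟩ := EQ hb (p1 := 0) (p2 := 0) hAE (by simpa using h1) (by simpa using h2)
  exact ⟨d, by simpa using h⟩
end
section
variable {b : ℝ} {z q : ℂ}
lemma Sg_zero (b : ℝ) : Sg b 0 = 0 := by simp [Sg]
lemma Sg_LL (hb : 0 < b) (z : ℂ) {l : ℂ} (hl : l ∈ LL b) : ∃ c : ℂ → ℂ, (∀ x, c x ≠ 0) ∧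
    Differentiable ℂ c ∧ (∀ x, Sg b (x + l) = c x * Sg b x) := by
  have i1 : ∀ m : ℤ, ∃ c : ℂ, c ≠ 0 ∧ ∀ x, Sg b (x + m) = c * Sg b x := by
    intro m
    induction m using Int.induction_on with
    | zero => exact ⟨1, by simp, by simp⟩
    | succ n ih =>
      obtain ⟨c, h1, h2⟩ := ih
      exact ⟨-c, by simpa, fun x => by push_cast at h2 ⊢; rw [← add_assoc, Sg_one, h2]; ring⟩
    | pred n ih =>
      obtain ⟨c, h1, h2⟩ := ih
      refine ⟨-c, by simpa, fun x => ?_⟩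
      push_cast at h2 ⊢
      have := Sg_one b (x + (-n - 1))
      rw [show x + (-n - 1 : ℂ) + 1 = x + -n by ring, h2] at this
      linear_combination this
  have i2 : ∀ m : ℤ, ∃ c : ℂ → ℂ, (∀ x, c x ≠ 0) ∧ Differentiable ℂ c ∧
      ∀ x, Sg b (x + m * (I * b)) = c x * Sg b x := by
    have he : Differentiable ℂ ee := fun z => (ee_d z).differentiableAt
    intro m
    induction m using Int.induction_on with
    | zero => exact ⟨fun _ => 1, by simp, by fun_prop, by simp⟩
    | succ n ih =>
      obtain ⟨c, h1, h2, h3⟩ := ih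
      refine ⟨fun x => -(Complex.exp (π * b) * ee (-(x + n * (I * b)))) * c x, fun x => ?_, by fun_prop, fun x => ?_⟩
      · simp [ee_ne, h1]
      · have := h3 x
        push_cast at this ⊢
        rw [add_mul, one_mul, ← add_assoc, Sg_ib hb, this]; ring
    | pred n ih =>
      obtain ⟨c, h1, h2, h3⟩ := ih
      refine ⟨fun x => -((Complex.exp (π * b))⁻¹ * ee ((x + (-n - 1) * (I * b)))) * c x, fun x => ?_, by fun_prop, fun x => ?_⟩
      · simp [ee_ne, h1]
      · have := h3 x
        push_cast at this ⊢
        have h4 := Sg_ib hb (x + (-n - 1) * (I * b))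
        rw [show x + (-n - 1) * (I * b) + I * b = x + -n * (I * b) by ring, this, ee_neg] at h4
        have h5 := ee_ne (x + (-n - 1) * (I * b))
        have h6 := Complex.exp_ne_zero (π * b)
        rw [neg_mul, neg_mul, mul_assoc, h4]
        generalize x + (-(n : ℂ) - 1) * (I * b) = X at h5 ⊢
        field_simp
  obtain ⟨m, n, rfl⟩ := hl
  obtain ⟨c1, a1, a2⟩ := i1 m
  obtain ⟨c2, b1, b2, b3⟩ := i2 n
  refine ⟨fun x => c2 (x + m) * c1, fun x => mul_ne_zero (b1 _) a1, by fun_prop, fun x => ?_⟩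
  rw [← add_assoc, b3, a2, mul_assoc]
lemma Sg_iff (hb : 0 < b) : Sg b z = 0 ↔ z ∈ LL b := by
  refine ⟨fun h => by_contra fun h2 => Sg_ne hb h2 h, fun h => ?_⟩
  obtain ⟨c, _, _, h2⟩ := Sg_LL hb z h
  have := h2 0
  rwa [Sg_zero, mul_zero, zero_add] at this
lemma LL_closed (hb : 0 < b) : IsClosed (LL b) := by
  have : LL b = Sg b ⁻¹' {0} := by ext z; simp [Sg_iff hb]
  rw [this]; exact isClosed_singleton.preimage (Sg_diff hb).continuous
lemma LL_countable (b : ℝ) : (LL b).Countable := by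
  have : LL b = range (fun p : ℤ × ℤ => (p.1 : ℂ) + p.2 * (I * b)) := by
    ext z; simp only [LL, lat, mem_setOf_eq, mem_range, Prod.exists]
    constructor <;> rintro ⟨m, n, h⟩ <;> exact ⟨m, n, h.symm⟩
  rw [this]; exact countable_range _
lemma LL_ev0 (hb : 0 < b) (z : ℂ) : ∀ᶠ x in 𝓝[≠] z, x ∉ LL b := by
  rcases ((Sg_diff hb).analyticAt z).eventually_eq_zero_or_eventually_ne_zero with h | h
  · exfalso
    have := AnalyticOnNhd.eq_of_eventuallyEq (f := Sg b) (g := 0)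
      (fun z _ => (Sg_diff hb).analyticAt z) (fun z _ => analyticAt_const) h
    apply Sg_d0 hb
    rw [this]; simp
  · filter_upwards [h] with x hx; rwa [← Sg_iff hb]
lemma LL_ev (hb : 0 < b) (z q : ℂ) : ∀ᶠ x in 𝓝[≠] z, x - q ∉ LL b := by
  have := ev_shift (z := z) (t := -q) (LL_ev0 hb (z + -q)) rfl
  simpa [sub_eq_add_neg] using this
lemma Zc_d (hb : 0 < b) (hz : z ∉ LL b) : AnalyticAt ℂ (Zc b) z := by
  have h := (Sg_diff hb).analyticAt z
  have : AnalyticAt ℂ (fun z => deriv (Sg b) z / Sg b z) z := h.deriv.div h (Sg_ne hb hz)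
  exact this
lemma Sg_hd (hb : 0 < b) (z : ℂ) (hz : z ∉ LL b) : HasDerivAt (Sg b) (Zc b z * Sg b z) z := by
  have := ((Sg_diff hb) z).hasDerivAt
  refine this.congr_deriv ?_
  rw [Zc, logDeriv_apply, div_mul_cancel₀ _ (Sg_ne hb hz)]
lemma Zc_neg (hb : 0 < b) (z : ℂ) : Zc b (-z) = - Zc b z := by
  have h : deriv (Sg b) (-z) = deriv (Sg b) z := by
    have := congrArg (fun f => deriv f z) (funext (Sg_neg b))
    simpa [deriv_comp_neg] using this
  rw [Zc, Zc, logDeriv_apply, logDeriv_apply, h, Sg_neg, div_neg]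
lemma Zc_one (b : ℝ) (z : ℂ) : Zc b (z + 1) = Zc b z := by
  have h : deriv (Sg b) (z + 1) = - deriv (Sg b) z := by
    have := congrArg (fun f => deriv f z) (funext (Sg_one b))
    simpa [deriv_comp_add_const] using this
  rw [Zc, Zc, logDeriv_apply, logDeriv_apply, h, Sg_one, neg_div_neg_eq]
lemma LL_addr {l : ℂ} (hl : l ∈ LL b) : z + l ∈ LL b ↔ z ∈ LL b :=
  ⟨fun h => by simpa using LL_sub h hl, fun h => LL_add h hl⟩
lemma Zc_ib (hb : 0 < b) (hz : z ∉ LL b) : Zc b (z + I * b) = Zc b z - 2 * π * I := by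
  have hS := Sg_ne hb hz
  have h1 : HasDerivAt (fun x => Sg b (x + I * b)) (Zc b (z + I * b) * Sg b (z + I * b)) z :=
    (Sg_hd hb _ (by rwa [LL_addr (LL_ib b)])).comp_add_const z _
  have h0 : HasDerivAt (fun x => ee (-x)) (-(2 * π * I * ee (-z))) z :=
    (HasDerivAt.comp z (ee_d (-z)) (hasDerivAt_neg z)).congr_deriv (by ring)
  have h2 := ((h0.const_mul (Complex.exp (π * b))).neg.mul (Sg_hd hb z hz))
  have h3 := h1.unique (h2.congr_of_eventuallyEq (Eventually.of_forall fun x => Sg_ib hb x))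
  rw [Sg_ib hb] at h3
  have h4 := ee_ne (-z)
  have h5 := Complex.exp_ne_zero (π * b)
  apply mul_left_cancel₀ (mul_ne_zero (mul_ne_zero h5 h4) hS)
  simp only [Pi.neg_apply] at h3
  linear_combination -h3
lemma an_dslope {A : ℂ → ℂ} (h : AnalyticAt ℂ A z) : AnalyticAt ℂ (dslope A z) z := by
  obtain ⟨p, hp⟩ := h
  exact hp.has_fpower_series_dslope_fslope.analyticAt
lemma an_factor {A : ℂ → ℂ} (h : AnalyticAt ℂ A z) (h0 : A z = 0) :
    ∃ s, AnalyticAt ℂ s z ∧ ∀ x, A x = (x - z) * s x := by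
  refine ⟨_, an_dslope h, fun x => ?_⟩
  have := sub_smul_dslope A z x
  rw [h0, sub_zero] at this; exact this.symm
lemma Zc_zero (hb : 0 < b) : ∃ k : ℂ → ℂ, AnalyticAt ℂ k 0 ∧ ∀ᶠ x in 𝓝[≠] 0, Zc b x = 1 / x + x * k x := by
  have hS := (Sg_diff hb).analyticAt 0
  set K := dslope (Sg b) 0 with hKd
  have hK : AnalyticAt ℂ K 0 := an_dslope hS
  have hK0 : K 0 ≠ 0 := by rw [hKd, dslope_same]; exact Sg_d0 hb
  have hSK : ∀ x, Sg b x = x * K x := by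
    intro x; have := sub_smul_dslope (Sg b) 0 x
    simp [Sg_zero] at this; exact this.symm
  have hA : AnalyticAt ℂ (fun x => deriv K x / K x) 0 := hK.deriv.div hK hK0
  have e1 : ∀ᶠ x in 𝓝[≠] 0, Zc b x = 1 / x + deriv K x / K x := by
    have := (hK.eventually_analyticAt.and (hK.continuousAt.eventually_ne hK0)).filter_mono
      (nhdsWithin_le_nhds (s := {0}ᶜ))
    filter_upwards [this, self_mem_nhdsWithin] with x ⟨a1, a2⟩ a3
    have a3 : x ≠ 0 := a3
    have : HasDerivAt (Sg b) (1 * K x + x * deriv K x) x :=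
      ((hasDerivAt_id x).mul a1.differentiableAt.hasDerivAt).congr_of_eventuallyEq
        (Eventually.of_forall hSK)
    rw [Zc, logDeriv_apply, this.deriv, hSK]
    field_simp
  have e2 : deriv K 0 / K 0 = 0 := by
    have hneg : Tendsto (fun x : ℂ => -x) (𝓝[≠] 0) (𝓝[≠] 0) := by
      refine tendsto_nhdsWithin_iff.2 ⟨?_, ?_⟩
      · have := (continuous_neg (G := ℂ)).tendsto 0
        rw [neg_zero] at this; exact this.mono_left nhdsWithin_le_nhds
      · filter_upwards [self_mem_nhdsWithin] with x hx; simpa using hx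
    have hA' : ContinuousAt (fun x => -(deriv K (-x) / K (-x))) 0 := by
      have : ContinuousAt (fun x => deriv K x / K x) (-0) := by rw [neg_zero]; exact hA.continuousAt
      exact (this.comp (f := fun x : ℂ => -x) continuous_neg.continuousAt).neg
    have := pe_eq hA.continuousAt hA' (by
      filter_upwards [e1, hneg.eventually e1, self_mem_nhdsWithin] with x a1 a2 a3
      rw [Zc_neg hb, a1] at a2
      have a3 : x ≠ 0 := a3
      rw [div_neg] at a2
      linear_combination -a2)
    simp only [neg_zero] at this
    linear_combination this / 2
  refine ⟨dslope (fun x => deriv K x / K x) 0, ?_, ?_⟩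
  · exact an_dslope hA
  · filter_upwards [e1] with x hx
    rw [hx]
    have := sub_smul_dslope (fun x => deriv K x / K x) 0 x
    simp only [e2, sub_zero, smul_eq_mul] at this
    rw [this]
end
noncomputable def Pc (b : ℝ) (z : ℂ) : ℂ := -deriv (Zc b) z
noncomputable def rq (b : ℝ) (q z : ℂ) : ℂ := Zc b (z - q) - Zc b z + Zc b q
noncomputable def yq (b : ℝ) (q z : ℂ) : ℂ := Complex.exp (Zc b q * z) * Sg b (z - q) / Sg b z
section
variable {b : ℝ} {z q : ℂ}
lemma LL_negi : -z ∈ LL b ↔ z ∈ LL b := ⟨fun h => by simpa using LL_neg h, LL_neg⟩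
lemma LL_rev : q - z ∈ LL b ↔ z - q ∈ LL b := by rw [← LL_negi, neg_sub]
lemma Zc_hd (hb : 0 < b) (hz : z ∉ LL b) : HasDerivAt (Zc b) (-Pc b z) z := by
  rw [Pc, neg_neg]; exact (Zc_d hb hz).differentiableAt.hasDerivAt
lemma LL_open (hb : 0 < b) (hz : z ∉ LL b) : ∀ᶠ x in 𝓝 z, x ∉ LL b :=
  (LL_closed hb).isOpen_compl.mem_nhds hz
lemma Pc_an (hb : 0 < b) (hz : z ∉ LL b) : AnalyticAt ℂ (Pc b) z := (Zc_d hb hz).deriv.neg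
lemma Pc_neg (hb : 0 < b) (z : ℂ) : Pc b (-z) = Pc b z := by
  have := congrArg (fun f => deriv f z) (funext (Zc_neg hb))
  simp only [deriv_comp_neg, deriv.fun_neg] at this
  rw [Pc, Pc]; linear_combination this
lemma Pc_one (b : ℝ) (z : ℂ) : Pc b (z + 1) = Pc b z := by
  have := congrArg (fun f => deriv f z) (funext (Zc_one b))
  simp only [deriv_comp_add_const] at this
  rw [Pc, Pc, this]
lemma Pc_ib (hb : 0 < b) (hz : z ∉ LL b) : Pc b (z + I * b) = Pc b z := by
  have h1 : HasDerivAt (fun x => Zc b (x + I * b)) (-Pc b (z + I * b)) z :=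
    (Zc_hd hb (by rwa [LL_addr (LL_ib b)])).comp_add_const z _
  have h2 := h1.unique (((Zc_hd hb hz).sub_const (2 * π * I)).congr_of_eventuallyEq
    (by filter_upwards [LL_open hb hz] with x hx; exact Zc_ib hb hx))
  exact neg_injective h2
lemma Zc_per (hb : 0 < b) (hz : z ∉ LL b) (m n : ℤ) :
    Zc b (z + (m + n * (I * b))) = Zc b z - 2 * π * I * n := by
  have h1 : ∀ z, Zc b (z + m) = Zc b z := by
    intro z
    have := Function.Periodic.int_mul (f := Zc b) (c := 1) (Zc_one b) m z
    simpa using this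
  have h2 : ∀ z ∉ LL b, Zc b (z + n * (I * b)) = Zc b z - 2 * π * I * n := by
    induction n using Int.induction_on with
    | zero => simp
    | succ n ih =>
      intro z hz
      have := Zc_ib hb (z := z + n * (I * b)) (by rwa [LL_addr ⟨0, n, by simp⟩])
      have ih := ih z hz
      push_cast at ih ⊢
      rw [add_mul, one_mul, ← add_assoc, this, ih]; ring
    | pred n ih =>
      intro z hz
      have := Zc_ib hb (z := z + (-n - 1) * (I * b)) (by rwa [LL_addr ⟨0, -n - 1, by simp⟩])
      have ih := ih z hz
      push_cast at ih ⊢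
      rw [show z + (-n - 1) * (I * b) + I * b = z + -n * (I * b) by ring, ih] at this
      linear_combination -this
  rw [add_comm (m : ℂ), ← add_assoc, h1, h2 z hz]
lemma rq_hd (hb : 0 < b) (hz : z ∉ LL b) (hq : z - q ∉ LL b) :
    HasDerivAt (rq b q) (Pc b z - Pc b (z - q)) z := by
  have := (((Zc_hd hb hq).comp_sub_const z q).sub (Zc_hd hb hz)).add_const (Zc b q)
  exact this.congr_deriv (by ring)
lemma rq_an (hb : 0 < b) (hz : z ∉ LL b) (hq : z - q ∉ LL b) : AnalyticAt ℂ (rq b q) z := by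
  have : AnalyticAt ℂ (fun z => Zc b (z - q)) z :=
    AnalyticAt.comp' (f := fun x => x - q) (Zc_d hb hq) (by fun_prop)
  exact (this.sub (Zc_d hb hz)).add analyticAt_const
lemma rq_one (b : ℝ) (q z : ℂ) : rq b q (z + 1) = rq b q z := by
  rw [rq, rq, show z + 1 - q = z - q + 1 by ring, Zc_one, Zc_one]
lemma rq_ib (hb : 0 < b) (hz : z ∉ LL b) (hq : z - q ∉ LL b) :
    rq b q (z + I * b) = rq b q z := by
  rw [rq, rq, show z + I * b - q = z - q + I * b by ring, Zc_ib hb hz, Zc_ib hb hq]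
  ring
lemma rq_refl (hb : 0 < b) (q z : ℂ) : rq b q (q - z) = rq b q z := by
  rw [rq, rq, show q - z - q = -z by ring, show q - z = -(z - q) by ring, Zc_neg hb, Zc_neg hb]; ring
lemma yq_ne (hb : 0 < b) (hz : z ∉ LL b) (hq : z - q ∉ LL b) : yq b q z ≠ 0 :=
  div_ne_zero (mul_ne_zero (Complex.exp_ne_zero _) (Sg_ne hb hq)) (Sg_ne hb hz)
lemma yq_hd (hb : 0 < b) (hz : z ∉ LL b) (hq : z - q ∉ LL b) :
    HasDerivAt (yq b q) (rq b q z * yq b q z) z := by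
  have hS := Sg_ne hb hz
  have h1 : HasDerivAt (fun z => Complex.exp (Zc b q * z)) (Zc b q * Complex.exp (Zc b q * z)) z :=
    ((hasDerivAt_id z).const_mul (Zc b q)).cexp.congr_deriv (by simp only [id]; ring)
  have := (h1.mul ((Sg_hd hb _ hq).comp_sub_const z q)).div (Sg_hd hb z hz) hS
  refine this.congr_deriv ?_
  simp only [rq, yq, Pi.mul_apply]
  field_simp
  ring
lemma yq_one (b : ℝ) (q z : ℂ) : yq b q (z + 1) = Complex.exp (Zc b q) * yq b q z := by
  rw [yq, yq, show z + 1 - q = z - q + 1 by ring, Sg_one, Sg_one, mul_add, mul_one, Complex.exp_add, div_neg]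
  ring
lemma yq_ib (hb : 0 < b) (q z : ℂ) : yq b q (z + I * b) =
    Complex.exp (Zc b q * (I * b)) * ee q * yq b q z := by
  rw [yq, yq, show z + I * b - q = z - q + I * b by ring, Sg_ib hb, Sg_ib hb, mul_add,
    Complex.exp_add, show -(z - q) = -z + q by ring, ee_add]
  have h1 := ee_ne (-z)
  have h2 := Complex.exp_ne_zero (π * b)
  by_cases hS : Sg b z = 0
  · simp [hS]
  field_simp
lemma yq_refl (b : ℝ) (q z : ℂ) :
    yq b q (q - z) = Complex.exp (Zc b q * q) * (yq b q z)⁻¹ := by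
  rw [yq, yq, show q - z - q = -z by ring, show q - z = -(z - q) by ring, Sg_neg, Sg_neg,
    show Zc b q * -(z - q) = Zc b q * q - Zc b q * z by ring, Complex.exp_sub]
  have h2 := Complex.exp_ne_zero (Zc b q * z)
  rw [inv_div, mul_neg, neg_div_neg_eq]
  field_simp
lemma cases2 {F : ℂ → ℂ} (h0 : AE F 0) (hq : AE F q)
    (h : ∀ z, z ∉ LL b → z - q ∉ LL b → AE F z) (z : ℂ) : ∃ l ∈ LL b, AE F (z + l) := by
  by_cases h1 : z ∈ LL b
  · exact ⟨-z, LL_neg h1, by simpa using h0⟩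
  by_cases h2 : z - q ∈ LL b
  · exact ⟨-(z - q), LL_neg h2, by simpa using hq⟩
  exact ⟨0, LL_zero b, by simpa using h z h1 h2⟩
lemma AE.refl {F : ℂ → ℂ} {c w : ℂ} (h : AE F w) (hw : w = c - z) : AE (fun x => F (c - x)) z := by
  obtain ⟨g, h1, h2⟩ := h
  subst hw
  refine ⟨fun x => g (c - x), AnalyticAt.comp' (f := fun x => c - x) h1 (by fun_prop), ?_⟩
  have : Tendsto (fun x => c - x) (𝓝[≠] z) (𝓝[≠] (c - z)) := by
    refine tendsto_nhdsWithin_iff.2 ⟨?_, ?_⟩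
    · exact ((continuous_const.sub continuous_id).tendsto z).mono_left nhdsWithin_le_nhds
    · filter_upwards [self_mem_nhdsWithin] with x hx
      simpa using hx
  exact this.eventually h2
lemma pe_const {F : ℂ → ℂ} {d : ℂ} (hF : ContinuousAt F z) (h : ∀ᶠ x in 𝓝[≠] z, F x = d) : F z = d :=
  pe_eq hF (continuousAt_const (y := d)) h
lemma Zc_zero2 (hb : 0 < b) : ∃ k : ℂ → ℂ, AnalyticAt ℂ k 0 ∧ (∀ᶠ x in 𝓝[≠] 0, Zc b x = 1 / x + x * k x) ∧
    ∀ᶠ x in 𝓝[≠] 0, Pc b x = 1 / x ^ 2 - (k x + x * deriv k x) := by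
  obtain ⟨k, h1, h2⟩ := Zc_zero hb
  refine ⟨k, h1, h2, ?_⟩
  filter_upwards [pe_self h2, h1.eventually_analyticAt.filter_mono nhdsWithin_le_nhds,
    self_mem_nhdsWithin] with x a1 a2 a3
  have a3 : x ≠ 0 := a3
  have := ((hasDerivAt_inv a3).add ((hasDerivAt_id x).mul a2.differentiableAt.hasDerivAt)).congr_of_eventuallyEq
    (f₁ := Zc b) (by filter_upwards [a1] with y hy; rw [hy]; simp [one_div])
  rw [Pc, this.deriv]
  simp only [id]
  field_simp
  ring
lemma rq_zero (hb : 0 < b) (hq : q ∉ LL b) {k : ℂ → ℂ} (hk : AnalyticAt ℂ k 0)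
    (hZ : ∀ᶠ x in 𝓝[≠] 0, Zc b x = 1 / x + x * k x) :
    ∃ s, AnalyticAt ℂ s 0 ∧ s 0 = -Pc b q - k 0 ∧ ∀ᶠ x in 𝓝[≠] 0, rq b q x = -1 / x + x * s x := by
  have hq' : (0 : ℂ) - q ∉ LL b := by rw [zero_sub, LL_negi]; exact hq
  have hA : AnalyticAt ℂ (fun x => Zc b (x - q) + Zc b q) 0 :=
    (AnalyticAt.comp' (f := fun x => x - q) (Zc_d hb hq') (by fun_prop)).add analyticAt_const
  obtain ⟨s, h1, h2⟩ := an_factor hA (by simp [Zc_neg hb])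
  have hs0 : s 0 = -Pc b q := by
    have a : HasDerivAt (fun x => Zc b (x - q) + Zc b q) (-Pc b (0 - q)) 0 :=
      ((Zc_hd hb hq').comp_sub_const 0 q).add_const _
    have c := ((hasDerivAt_id (0 : ℂ)).mul h1.differentiableAt.hasDerivAt).congr_of_eventuallyEq
      (f₁ := fun x => Zc b (x - q) + Zc b q) (Eventually.of_forall fun x => by simpa using h2 x)
    have := a.unique c
    simp only [id, zero_sub, Pc_neg hb] at this
    linear_combination -this
  refine ⟨fun x => s x - k x, h1.sub hk, by simp only [hs0], ?_⟩
  filter_upwards [hZ] with x hx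
  have := h2 x
  rw [rq, hx]
  linear_combination this
lemma lame_id (hb : 0 < b) : ∃ κ : ℂ, (∃ k : ℂ → ℂ, AnalyticAt ℂ k 0 ∧ k 0 = κ ∧ (∀ᶠ x in 𝓝[≠] 0, Zc b x = 1 / x + x * k x)) ∧
    ∀ q ∉ LL b, ∀ z ∉ LL b, z - q ∉ LL b →
    rq b q z ^ 2 = Pc b z + Pc b (z - q) + Pc b q + 3 * κ := by
  obtain ⟨k, hk, hZ, hP⟩ := Zc_zero2 hb
  refine ⟨k 0, ⟨k, hk, rfl, hZ⟩, fun q hq => ?_⟩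
  obtain ⟨s, hs, hs0, hr⟩ := rq_zero hb hq hk hZ
  have hq' : (0 : ℂ) - q ∉ LL b := by rw [zero_sub, LL_negi]; exact hq
  have hPq : ∀ z, z - q ∉ LL b → AnalyticAt ℂ (fun x => Pc b (x - q)) z := fun z h =>
    AnalyticAt.comp' (f := fun x => x - q) (Pc_an hb h) (by fun_prop)
  set F := fun z => rq b q z ^ 2 - Pc b z - Pc b (z - q) with hF
  set G := fun x => -2 * s x + x ^ 2 * s x ^ 2 + (k x + x * deriv k x) - Pc b (x - q)
  have hG : AnalyticAt ℂ G 0 := by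
    have h1 := hk.deriv
    have h2 := hPq 0 hq'
    have h3 : AnalyticAt ℂ (fun x : ℂ => x) 0 := analyticAt_id
    exact (((analyticAt_const.mul hs).add ((h3.pow 2).mul (hs.pow 2))).add (hk.add (h3.mul h1))).sub h2
  have hFG : F =ᶠ[𝓝[≠] 0] G := by
    filter_upwards [hP, hr, self_mem_nhdsWithin] with x a1 a2 a3
    have a3 : x ≠ 0 := a3
    simp only [hF, G, a1, a2]
    field_simp
    ring
  have h0 : AE F 0 := ⟨G, hG, hFG⟩
  have hFr : ∀ z, F (q - z) = F z := by
    intro z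
    simp only [hF]
    rw [rq_refl hb, show q - z - q = -z by ring, show q - z = -(z - q) by ring, Pc_neg hb, Pc_neg hb]
    ring
  have hFa : ∀ z, z ∉ LL b → z - q ∉ LL b → AnalyticAt ℂ F z := fun z h1 h2 =>
    (((rq_an hb h1 h2).pow 2).sub (Pc_an hb h1)).sub (hPq z h2)
  obtain ⟨d, hd⟩ := E0 (F := F) hb (cases2 (q := q) h0
    ((h0.refl (c := q) (z := q) (by simp)).congr (Eventually.of_forall fun x => (hFr x).symm))
    fun z h1 h2 => (hFa z h1 h2).ae)
    (fun z => Eventually.of_forall fun x => by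
      simp only [hF]; rw [rq_one, Pc_one, show x + 1 - q = x - q + 1 by ring, Pc_one])
    (fun z => by
      filter_upwards [LL_ev0 hb z, LL_ev hb z q] with x a1 a2
      simp only [hF]
      rw [rq_ib hb a1 a2, Pc_ib hb a1, show x + I * b - q = x - q + I * b by ring, Pc_ib hb a2])
  have hd0 : G 0 = d := pe_const hG.continuousAt (by
    filter_upwards [hd 0, hFG] with x a1 a2; rw [← a2, a1])
  intro z h1 h2
  have := pe_const (hFa z h1 h2).continuousAt (hd z)
  simp only [G, hs0, zero_sub, Pc_neg hb] at hd0
  simp only [hF] at this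
  linear_combination this - hd0
lemma Pc_surj (hb : 0 < b) (B : ℂ) : ∃ q ∉ LL b, Pc b q = B := by
  by_contra hcon
  push Not at hcon
  obtain ⟨k, hk, hZ, hP⟩ := Zc_zero2 hb
  set F := fun z => (Pc b z - B)⁻¹ with hF
  set G := fun x => x ^ 2 * (1 - x ^ 2 * (k x + x * deriv k x + B))⁻¹ with hGd
  have h3 : AnalyticAt ℂ (fun x : ℂ => x) 0 := analyticAt_id
  have hG : AnalyticAt ℂ G 0 := (h3.pow 2).mul ((analyticAt_const.sub ((h3.pow 2).mul
    ((hk.add (h3.mul hk.deriv)).add analyticAt_const))).inv (by simp))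
  have hFG : F =ᶠ[𝓝[≠] 0] G := by
    filter_upwards [hP, self_mem_nhdsWithin] with x a1 a3
    have a3 : x ≠ 0 := a3
    simp only [hF, hGd, a1]
    rw [show 1 / x ^ 2 - (k x + x * deriv k x) - B = (x ^ 2)⁻¹ * (1 - x ^ 2 * (k x + x * deriv k x + B)) by
      field_simp; ring, mul_inv, inv_inv]
  have hFa : ∀ z ∉ LL b, AnalyticAt ℂ F z := fun z hz =>
    ((Pc_an hb hz).sub analyticAt_const).inv (sub_ne_zero.2 (hcon z hz))
  obtain ⟨d, hd⟩ := E0 (F := F) hb (cases2 (q := 0) ⟨G, hG, hFG⟩ ⟨G, hG, hFG⟩ fun z h1 _ => (hFa z h1).ae)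
    (fun z => Eventually.of_forall fun x => by simp only [hF]; rw [Pc_one])
    (fun z => by filter_upwards [LL_ev0 hb z] with x a1; simp only [hF]; rw [Pc_ib hb a1])
  have hd0 : G 0 = d := pe_const hG.continuousAt (by
    filter_upwards [hd 0, hFG] with x a1 a2; rw [← a2, a1])
  obtain ⟨x, h1, h2⟩ := ((hd 0).and (LL_ev0 hb 0)).exists
  rw [← hd0] at h1
  simp [hF, hGd, sub_eq_zero, hcon x h2] at h1
lemma half_mult (hb : 0 < b) (hq : q ∉ LL b) (h2 : 2 * q ∈ LL b) :
    Complex.exp (Zc b q) ^ 2 = 1 ∧ (Complex.exp (Zc b q * (I * b)) * ee q) ^ 2 = 1 := by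
  obtain ⟨m, n, hmn⟩ := h2
  have h := Zc_per hb (z := -q) (by rwa [LL_negi]) m n
  rw [← hmn, show -q + 2 * q = q by ring, Zc_neg hb] at h
  have hz : 2 * Zc b q = -n * (2 * π * I) := by linear_combination h
  constructor
  · rw [← Complex.exp_nat_mul, Nat.cast_ofNat, hz, Complex.exp_eq_one_iff]
    exact ⟨-n, by push_cast; ring⟩
  · rw [ee, ← Complex.exp_add, ← Complex.exp_nat_mul, Complex.exp_eq_one_iff]
    refine ⟨m, ?_⟩
    push_cast
    linear_combination (I * b) * hz + 2 * π * I * hmn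
lemma yq_sq (hb : 0 < b) (hq : q ∉ LL b) (h2 : 2 * q ∈ LL b) :
    ∃ α : ℂ, α ≠ 0 ∧ ∀ z ∉ LL b, yq b q z ^ 2 = α * (Pc b z - Pc b q) := by
  obtain ⟨m1, m2⟩ := half_mult hb hq h2
  obtain ⟨k, hk, hZ, hP⟩ := Zc_zero2 hb
  have hya : ∀ z ∉ LL b, AnalyticAt ℂ (fun z => yq b q z ^ 2) z := by
    intro z hz
    have hS := Sg_diff hb
    have : AnalyticAt ℂ (yq b q) z := by
      refine AnalyticAt.div (AnalyticAt.mul ?_ ?_) (hS.analyticAt z) (Sg_ne hb hz)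
      · exact Differentiable.analyticAt (by fun_prop) z
      · exact Differentiable.analyticAt (hS.comp (by fun_prop)) z
    exact this.pow 2
  have hz0 : ∃ A : ℂ → ℂ, AnalyticAt ℂ A 0 ∧ A 0 ≠ 0 ∧ ∀ x, x ≠ 0 → yq b q x ^ 2 = A x / x ^ 2 := by
    have hS := Sg_diff hb
    have h3 := an_dslope (hS.analyticAt 0)
    refine ⟨fun x => (Complex.exp (Zc b q * x) * Sg b (x - q) / dslope (Sg b) 0 x) ^ 2, ?_, ?_, ?_⟩
    · refine AnalyticAt.pow (AnalyticAt.div (AnalyticAt.mul ?_ ?_) h3 ?_) 2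
      · exact Differentiable.analyticAt (by fun_prop) _
      · exact Differentiable.analyticAt (hS.comp (by fun_prop)) _
      · rw [dslope_same]; exact Sg_d0 hb
    · have : (0 : ℂ) - q ∉ LL b := by rw [zero_sub, LL_negi]; exact hq
      have := Sg_ne hb this
      simp [dslope_same, Sg_d0 hb] 
      simpa using this
    · intro x hx
      have := sub_smul_dslope (Sg b) 0 x
      simp only [sub_zero, Sg_zero, smul_eq_mul] at this
      rw [yq, ← this]; field_simp
  obtain ⟨A, hA, hA0, hyA⟩ := hz0
  obtain ⟨A1, hA1, hAA⟩ := an_factor (A := fun x => A x - A 0) (hA.sub analyticAt_const) (sub_self _)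
  obtain ⟨A2, hA2, hAA2⟩ := an_factor (A := fun x => A1 x - A1 0) (hA1.sub analyticAt_const) (sub_self _)
  simp only [sub_zero] at hAA hAA2
  set F := fun z => yq b q z ^ 2 - A 0 * Pc b z - A1 0 * Zc b z with hF
  have hFa : ∀ z ∉ LL b, AnalyticAt ℂ F z := fun z hz =>
    ((hya z hz).sub (analyticAt_const.mul (Pc_an hb hz))).sub (analyticAt_const.mul (Zc_d hb hz))
  have h0 : AE F 0 := by
    refine ⟨fun x => A2 x + A 0 * (k x + x * deriv k x) - A1 0 * (x * k x), ?_, ?_⟩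
    · have h3 : AnalyticAt ℂ (fun x : ℂ => x) 0 := analyticAt_id
      exact (hA2.add (analyticAt_const.mul (hk.add (h3.mul hk.deriv)))).sub (analyticAt_const.mul (h3.mul hk))
    · filter_upwards [hZ, hP, self_mem_nhdsWithin] with x a1 a2 a3
      have a3 : x ≠ 0 := a3
      simp only [hF]
      rw [hyA x a3, a1, a2]
      have e : A x = A 0 + x * (A1 0 + x * A2 x) := by
        linear_combination hAA x + x * hAA2 x
      rw [e]
      field_simp
      ring
  obtain ⟨e1, d, hd⟩ := EQ (F := F) (p1 := 0) (p2 := A1 0 * (2 * π * I)) hb (cases2 (q := 0) h0 h0 fun z h1 _ => (hFa z h1).ae)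
    (fun z => Eventually.of_forall fun x => by
      simp only [hF]; rw [yq_one, Pc_one, Zc_one, mul_pow, m1]; ring)
    (fun z => by
      filter_upwards [LL_ev0 hb z] with x a1
      simp only [hF]; rw [yq_ib hb, Pc_ib hb a1, Zc_ib hb a1, mul_pow, m2]; ring)
  have hA10 : A1 0 = 0 := by
    simpa [Real.pi_ne_zero] using e1
  have hf : ∀ z ∉ LL b, yq b q z ^ 2 = A 0 * Pc b z + d := by
    intro z hz
    have := pe_const (hFa z hz).continuousAt (d := d) (by simpa using hd z)
    simp only [hF, hA10] at this
    linear_combination this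
  refine ⟨A 0, hA0, fun z hz => ?_⟩
  have := hf q hq
  rw [yq, sub_self, Sg_zero] at this
  rw [hf z hz]
  linear_combination -this
lemma LL_rot (hb : 0 < b) : z ∈ LL b⁻¹ ↔ I * b * z ∈ LL b := by
  have hb' : (b : ℂ) ≠ 0 := by exact_mod_cast hb.ne'
  constructor
  · rintro ⟨m, n, rfl⟩
    refine ⟨-n, m, ?_⟩
    push_cast; field_simp
    linear_combination (n : ℂ) * Complex.I_sq
  · rintro ⟨m, n, h⟩
    refine ⟨n, -m, ?_⟩
    apply mul_left_cancel₀ (mul_ne_zero Complex.I_ne_zero hb')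
    rw [h]; push_cast; field_simp
    linear_combination (m : ℂ) * Complex.I_sq
lemma rq_rot (hb : 0 < b) {q' : ℂ} (hq' : q' ∉ LL b⁻¹) (hz : z ∉ LL b⁻¹) (hzq : z - q' ∉ LL b⁻¹) :
    rq b⁻¹ q' z = I * b * rq b (I * b * q') (I * b * z) := by
  have hb1 : 0 < b⁻¹ := inv_pos.2 hb
  have hbc : (b : ℂ) ≠ 0 := by exact_mod_cast hb.ne'
  set j : ℂ := I * b with hj
  have hj0 : j ≠ 0 := mul_ne_zero Complex.I_ne_zero hbc
  have hq : j * q' ∉ LL b := by rwa [← LL_rot hb]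
  have hsub : ∀ x, j * x - j * q' ∈ LL b ↔ x - q' ∈ LL b⁻¹ := fun x => by
    rw [← mul_sub, LL_rot hb]
  have tj : Tendsto (fun x : ℂ => j * x) (𝓝[≠] 0) (𝓝[≠] 0) := by
    refine tendsto_nhdsWithin_iff.2 ⟨?_, ?_⟩
    · have : Tendsto (fun x : ℂ => j * x) (𝓝 0) (𝓝 (j * 0)) := (continuous_const.mul continuous_id).tendsto 0
      rw [mul_zero] at this; exact this.mono_left nhdsWithin_le_nhds
    · filter_upwards [self_mem_nhdsWithin] with x hx
      simpa [hj0] using hx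
  obtain ⟨k, hk, hZ⟩ := Zc_zero hb
  obtain ⟨k1, hk1, hZ1⟩ := Zc_zero hb1
  obtain ⟨s, hs, _, hr⟩ := rq_zero hb hq hk hZ
  obtain ⟨s1, hs1, _, hr1⟩ := rq_zero hb1 hq' hk1 hZ1
  set F := fun z => rq b⁻¹ q' z - j * rq b (j * q') (j * z) with hF
  set G := fun x => x * s1 x - j * (j * x * s (j * x))
  have hG : AnalyticAt ℂ G 0 := by
    have h3 : AnalyticAt ℂ (fun x : ℂ => x) 0 := analyticAt_id
    have h4 : AnalyticAt ℂ (fun x => s (j * x)) 0 :=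
      AnalyticAt.comp' (f := fun x => j * x) (by simpa using hs) (by fun_prop)
    exact (h3.mul hs1).sub (analyticAt_const.mul ((analyticAt_const.mul h3).mul h4))
  have hFG : F =ᶠ[𝓝[≠] 0] G := by
    filter_upwards [hr1, tj.eventually hr, self_mem_nhdsWithin] with x a1 a2 a3
    have a3 : x ≠ 0 := a3
    simp only [hF, G, a1, a2]
    field_simp
    ring
  have h0 : AE F 0 := ⟨G, hG, hFG⟩
  have hFr : ∀ z, F (q' - z) = F z := by
    intro z; simp only [hF]; rw [rq_refl hb1, mul_sub, rq_refl hb]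
  have hFa : ∀ z, z ∉ LL b⁻¹ → z - q' ∉ LL b⁻¹ → AnalyticAt ℂ F z := fun z h1 h2 =>
    (rq_an hb1 h1 h2).sub (analyticAt_const.mul (AnalyticAt.comp' (f := fun x => j * x)
      (rq_an hb (by rwa [← LL_rot hb]) (by rwa [hsub])) (by fun_prop)))
  obtain ⟨d, hd⟩ := E0 (F := F) hb1 (cases2 (q := q') h0
    ((h0.refl (c := q') (z := q') (by simp)).congr (Eventually.of_forall fun x => (hFr x).symm))
    fun z h1 h2 => (hFa z h1 h2).ae)
    (fun z => by
      filter_upwards [LL_ev0 hb1 z, LL_ev hb1 z q'] with x a1 a2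
      simp only [hF]; rw [rq_one, mul_add, mul_one, rq_ib hb (by rwa [← LL_rot hb]) (by rwa [hsub])])
    (fun z => by
      filter_upwards [LL_ev0 hb1 z, LL_ev hb1 z q'] with x a1 a2
      simp only [hF]
      have e : j * (x + I * ((b⁻¹ : ℝ) : ℂ)) + 1 = j * x := by
        rw [hj]; push_cast; field_simp; linear_combination Complex.I_sq
      rw [rq_ib hb1 a1 a2, ← rq_one b (j * q') (j * (x + I * ((b⁻¹ : ℝ) : ℂ))), e])
  have hd0 : G 0 = d := pe_const hG.continuousAt (by
    filter_upwards [hd 0, hFG] with x a1 a2; rw [← a2, a1])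
  have := pe_const (hFa z hz hzq).continuousAt (hd z)
  rw [← hd0] at this
  simp only [hF, G] at this
  linear_combination this
end
section
variable {b : ℝ} {q : ℂ} {U : Set ℂ} {Q h h1 h12 : ℂ → ℂ} {c : ℝ}
lemma yq_y1 (hb : 0 < b) (hUL : ∀ z ∈ U, z ∉ LL b ∧ z - q ∉ LL b)
    (hQ : ∀ z ∈ U, HasDerivAt (rq b q) (Q z - rq b q z ^ 2) z) :
    ∀ z ∈ U, HasDerivAt (fun z => rq b q z * yq b q z) (Q z * yq b q z) z := by
  intro z hz
  exact ((hQ z hz).mul (yq_hd hb (hUL z hz).1 (hUL z hz).2)).congr_deriv (by ring)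
lemma lame_half (hb : 0 < b) (hq : q ∉ LL b) (hU : IsPreconnected U) (hne : U.Nonempty)
    (hUL : ∀ z ∈ U, z ∉ LL b ∧ z - q ∉ LL b) (hU2 : ∀ z ∈ U, z + 2 ∈ U)
    (P : Pot U Q h h1 h12 c) (hQ : ∀ z ∈ U, HasDerivAt (rq b q) (Q z - rq b q z ^ 2) z)
    (hper : ∀ z ∈ U, h (z + 2) = h z) : ∃ m : ℤ, 2 * q.re = m := by
  obtain ⟨z, hz⟩ := hne
  obtain ⟨p1, p2, _⟩ := P.per hU2 hper z hz
  have hy : ∀ z ∈ U, HasDerivAt (yq b q) (rq b q z * yq b q z) z := fun z hz =>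
    yq_hd hb (hUL z hz).1 (hUL z hz).2
  have hB := P.bf_const (y := yq b q) (y1 := fun z => rq b q z * yq b q z) hU hy
    (yq_y1 hb hUL hQ) hz (hU2 z hz)
  have hpos := P.bf_pos (y := yq b q) (y1 := fun z => rq b q z * yq b q z) hz
    (Or.inl (yq_ne hb (hUL z hz).1 (hUL z hz).2))
  set M := Complex.exp (Zc b q) with hM
  have e1 : yq b q (z + 2) = M ^ 2 * yq b q z := by
    rw [show z + 2 = z + 1 + 1 by ring, yq_one, yq_one]; ring
  have e2 : rq b q (z + 2) = rq b q z := by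
    rw [show z + 2 = z + 1 + 1 by ring, rq_one, rq_one]
  have hB2 : Bf h h1 h12 (yq b q) (fun z => rq b q z * yq b q z) (z + 2) =
      ((‖M‖ ^ 4 : ℝ) : ℂ) * Bf h h1 h12 (yq b q) (fun z => rq b q z * yq b q z) z := by
    have : ((‖M‖ ^ 4 : ℝ) : ℂ) = M ^ 2 * conj M ^ 2 := by
      rw [← mul_pow, Complex.mul_conj, Complex.normSq_eq_norm_sq]; push_cast; ring
    rw [this]
    simp only [Bf, e1, e2, p1, p2, hper z hz, map_mul, map_pow]
    ring
  rw [hB2] at hB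
  have h4 := congrArg Complex.re hB
  rw [Complex.re_ofReal_mul] at h4
  have h5 : ‖M‖ ^ 4 = 1 := by
    apply mul_right_cancel₀ hpos.ne'; linarith
  have h6 : ‖M‖ = 1 := (pow_eq_one_iff_of_nonneg (norm_nonneg _) (by norm_num)).1 h5
  rw [hM, Complex.norm_exp, Real.exp_eq_one_iff] at h6
  obtain ⟨T, hT, e⟩ := Zc_re hb hq
  rw [h6] at e
  have h7 : Real.sin (2 * π * q.re) = 0 := by
    rcases mul_eq_zero.1 e.symm with h | h
    · linarith
    · exact h
  rw [Real.sin_eq_zero_iff] at h7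
  obtain ⟨m, hm⟩ := h7
  exact ⟨m, mul_left_cancel₀ Real.pi_ne_zero (by linarith)⟩
lemma lame_full (hb : 0 < b) (hq : q ∉ LL b) (hU : IsPreconnected U) (hne : U.Nonempty)
    (hUL : ∀ z ∈ U, z ∉ LL b ∧ z - q ∉ LL b) (hU2 : ∀ z ∈ U, z + 2 ∈ U)
    (hU3 : ∀ z ∈ U, z + 2 * (I * b) ∈ U)
    (P : Pot U Q h h1 h12 c) (hQ : ∀ z ∈ U, HasDerivAt (rq b q) (Q z - rq b q z ^ 2) z)
    (hper : ∀ z ∈ U, h (z + 2) = h z) (hper2 : ∀ z ∈ U, h (z + 2 * (I * b)) = h z) : False := by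
  obtain ⟨m, hm⟩ := lame_half hb hq hU hne hUL hU2 P hQ hper
  have hbc : (b : ℂ) ≠ 0 := by exact_mod_cast hb.ne'
  have hj0 : I * b ≠ 0 := mul_ne_zero Complex.I_ne_zero hbc
  have hn : ∃ n : ℤ, 2 * (q / (I * b)).re = n := by
    have hb1 : 0 < b⁻¹ := inv_pos.2 hb
    have hjq : I * b * (q / (I * b)) = q := by field_simp
    have hq' : q / (I * b) ∉ LL b⁻¹ := by rwa [LL_rot hb, hjq]
    set V := (fun z : ℂ => I * b * z) ⁻¹' U with hV
    have hVo : IsOpen V := P.opn.preimage (by fun_prop)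
    have hVi : V = (fun z : ℂ => (I * b)⁻¹ * z) '' U := by
      ext z; simp only [hV, mem_preimage, mem_image]
      constructor
      · intro h; exact ⟨_, h, by field_simp⟩
      · rintro ⟨x, hx, rfl⟩; rwa [mul_inv_cancel_left₀ hj0]
    have hVL : ∀ z ∈ V, z ∉ LL b⁻¹ ∧ z - q / (I * b) ∉ LL b⁻¹ := by
      intro z hz
      obtain ⟨a1, a2⟩ := hUL _ hz
      rw [LL_rot hb, LL_rot hb, mul_sub, hjq]
      exact ⟨a1, a2⟩
    have P' := P.trans (V := V) hVo (φ := fun z => I * b * z) (φd := fun _ => I * b)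
      (α := fun _ => 1) (β := fun _ => 0) (γ := fun _ => 0) (δ := fun _ => I * b)
      (Q' := fun z => (I * b) ^ 2 * Q (I * b * z)) (D := I * b)
      hj0 (fun z hz => hz)
      (fun z hz => ((hasDerivAt_id z).const_mul _).congr_deriv (by simp))
      (fun z hz => (hasDerivAt_const z _).congr_deriv (by ring))
      (fun z hz => (hasDerivAt_const z _).congr_deriv (by ring))
      (fun z hz => (hasDerivAt_const z _).congr_deriv (by ring))
      (fun z hz => (hasDerivAt_const z _).congr_deriv (by ring))
      (fun z hz => by ring)
    refine lame_half hb1 hq' ?_ ?_ hVL ?_ P' ?_ ?_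
    · rw [hVi]; exact hU.image _ (by fun_prop)
    · rw [hVi]; exact hne.image _
    · intro z hz
      have := hU3 _ hz
      simp only [hV, mem_preimage] at this ⊢
      convert this using 1; ring
    · intro z hz
      have e : ∀ x ∈ V, rq b⁻¹ (q / (I * b)) x = I * b * rq b q (I * b * x) := by
        intro x hx
        rw [rq_rot hb hq' (hVL x hx).1 (hVL x hx).2, hjq]
      have a : HasDerivAt (fun x => rq b q (I * b * x)) _ z :=
        HasDerivAt.comp z (hQ _ hz) (((hasDerivAt_id z).const_mul (I * b)))
      refine ((a.const_mul (I * b)).congr_of_eventuallyEq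
        (by filter_upwards [hVo.mem_nhds hz] with x hx; exact e x hx)).congr_deriv ?_
      rw [e z hz]; ring
    · intro z hz
      have := hper2 _ hz
      simp only [map_one, map_zero, mul_one, mul_zero, zero_mul, add_zero, one_mul]
      rw [← this]; congr 1; ring
  obtain ⟨n, hn⟩ := hn
  have h2q : 2 * q ∈ LL b := by
    rw [LL_iff]
    refine ⟨m, n, by simpa using hm, ?_⟩
    rw [← hn]
    generalize hp : q / (I * b) = p
    have : q = I * b * p := by rw [← hp]; field_simp
    rw [this]
    simp
    ring
  obtain ⟨m1, m2⟩ := half_mult hb hq h2q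
  obtain ⟨α, hα, hsq⟩ := yq_sq hb hq h2q
  have hy : ∀ z ∈ U, HasDerivAt (yq b q) (rq b q z * yq b q z) z := fun z hz =>
    yq_hd hb (hUL z hz).1 (hUL z hz).2
  have hy1 := yq_y1 hb hUL hQ
  obtain ⟨z0, hz0⟩ := hne
  set y1 := fun z => rq b q z * yq b q z with hy1d
  set B := Bf h h1 h12 (yq b q) y1 z0 with hBd
  have hB : B ≠ 0 := by
    intro h0
    have := P.bf_pos (y := yq b q) (y1 := y1) hz0 (Or.inl (yq_ne hb (hUL z0 hz0).1 (hUL z0 hz0).2))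
    rw [← hBd, h0] at this; simp at this
  set e := Complex.exp (Zc b q * q) with he
  have he0 : e ≠ 0 := Complex.exp_ne_zero _
  -- inverse square
  have hinv : ∀ z ∈ U, ((yq b q z) ^ 2)⁻¹ = α / e ^ 2 * (Pc b (z - q) - Pc b q) := by
    intro z hz
    have := hsq (q - z) (by rw [LL_rev]; exact (hUL z hz).2)
    rw [yq_refl, ← he, mul_pow, show q - z = -(z - q) by ring, Pc_neg hb, inv_pow] at this
    field_simp
    field_simp at this
    exact this
  set R := fun z => Df h h1 (yq b q) y1 z / yq b q z - B * (α / e ^ 2) * (Zc b (z - q) + Pc b q * z) with hR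
  have hRd : ∀ z ∈ U, HasDerivAt R 0 z := by
    intro z hz
    have hne := yq_ne hb (hUL z hz).1 (hUL z hz).2
    have d1 := (P.df hz (y1 := y1) (hy z hz) (hy1 z hz)).div (hy z hz) hne
    have d2 := ((Zc_hd hb (hUL z hz).2).comp_sub_const z q).add ((hasDerivAt_id z).const_mul (Pc b q))
    refine (d1.sub (d2.const_mul (B * (α / e ^ 2)))).congr_deriv ?_
    have hBz : Bf h h1 h12 (yq b q) y1 z = B := P.bf_const hU hy hy1 hz hz0
    rw [Bf_eq] at hBz
    have hi := hinv z hz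
    have : (Df1 h1 h12 (yq b q) y1 z * yq b q z - Df h h1 (yq b q) y1 z * (rq b q z * yq b q z)) / yq b q z ^ 2
        = -B * ((yq b q z) ^ 2)⁻¹ := by
      rw [← hBz]; simp only [hy1d]; rw [div_eq_mul_inv]; ring
    rw [this, hi]; ring
  have hRc : ∀ z ∈ U, ∀ w ∈ U, R z = R w := fun z hz w hw =>
    HasW.eq_const P.opn hU (fun x hx => (hRd x hx).hasW) hz hw
  have e1 : yq b q (z0 + 2) = yq b q z0 := by
    rw [show z0 + 2 = z0 + 1 + 1 by ring, yq_one, yq_one]; linear_combination yq b q z0 * m1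
  have e2 : rq b q (z0 + 2) = rq b q z0 := by
    rw [show z0 + 2 = z0 + 1 + 1 by ring, rq_one, rq_one]
  have e3 : Zc b (z0 + 2 - q) = Zc b (z0 - q) := by
    rw [show z0 + 2 - q = z0 - q + 1 + 1 by ring, Zc_one, Zc_one]
  have f1 : yq b q (z0 + 2 * (I * b)) = yq b q z0 := by
    rw [show z0 + 2 * (I * b) = z0 + I * b + I * b by ring, yq_ib hb, yq_ib hb]
    linear_combination yq b q z0 * m2
  have g1 : z0 + I * b ∉ LL b := by rw [LL_addr (LL_ib b)]; exact (hUL z0 hz0).1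
  have g2 : z0 - q + I * b ∉ LL b := by rw [LL_addr (LL_ib b)]; exact (hUL z0 hz0).2
  have f2 : rq b q (z0 + 2 * (I * b)) = rq b q z0 := by
    rw [show z0 + 2 * (I * b) = z0 + I * b + I * b by ring,
      rq_ib hb g1 (by convert g2 using 1; ring), rq_ib hb (hUL z0 hz0).1 (hUL z0 hz0).2]
  have f3 : Zc b (z0 + 2 * (I * b) - q) = Zc b (z0 - q) - 4 * π * I := by
    rw [show z0 + 2 * (I * b) - q = z0 - q + I * b + I * b by ring,
      Zc_ib hb g2, Zc_ib hb (hUL z0 hz0).2]; ring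
  have k1 := hRc _ (hU2 z0 hz0) _ hz0
  have k2 := hRc _ (hU3 z0 hz0) _ hz0
  obtain ⟨p1, p2, _⟩ := P.per hU2 hper z0 hz0
  obtain ⟨r1, r2, _⟩ := P.per hU3 hper2 z0 hz0
  simp only [hR, Df, hy1d, e1, e2, e3, p1, hper z0 hz0] at k1
  simp only [hR, Df, hy1d, f1, f2, f3, r1, hper2 z0 hz0] at k2
  have hc : B * (α / e ^ 2) ≠ 0 := mul_ne_zero hB (div_ne_zero hα (pow_ne_zero _ he0))
  have k3 : Pc b q = 0 := by
    apply mul_left_cancel₀ hc; linear_combination -k1 / 2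
  rw [k3] at k2
  have k4 : B * (α / e ^ 2) * (4 * π * I) = 0 := by linear_combination k2
  have hpi : (π : ℂ) ≠ 0 := by exact_mod_cast Real.pi_ne_zero
  simp [hc, hpi] at k4
lemma lame {C : Set ℂ} (hb : 0 < b) (hC : IsClosed C) (hCc : C.Countable) (hLC : LL b ⊆ C)
    (hC2 : ∀ z ∉ C, z + 2 ∉ C) (hC3 : ∀ z ∉ C, z + 2 * (I * b) ∉ C)
    (P : Pot Cᶜ Q h h1 h12 c) {B : ℂ} (hQ : ∀ z ∉ C, Q z = 2 * Pc b z + B)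
    (hper : ∀ z ∉ C, h (z + 2) = h z) (hper2 : ∀ z ∉ C, h (z + 2 * (I * b)) = h z) : False := by
  obtain ⟨κ, -, hκ⟩ := lame_id hb
  obtain ⟨q, hq, hqB⟩ := Pc_surj hb (B - 3 * κ)
  set C' := C ∪ (fun z => z - q) ⁻¹' LL b with hC'
  have hcl : IsClosed C' := hC.union ((LL_closed hb).preimage (by fun_prop))
  have hco : C'.Countable := by
    refine hCc.union ?_
    refine (LL_countable b).preimage_of_injOn ?_
    intro x _ y _ h; simpa using h
  have hcon : IsPathConnected C'ᶜ := hco.isPathConnected_compl_of_one_lt_rank (by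
    rw [Complex.rank_real_complex]; norm_num)
  have hUL : ∀ z ∈ C'ᶜ, z ∉ C ∧ z ∉ LL b ∧ z - q ∉ LL b := by
    intro z hz
    simp only [hC', mem_compl_iff, mem_union, mem_preimage, not_or] at hz
    exact ⟨hz.1, fun h => hz.1 (hLC h), hz.2⟩
  have hadd : ∀ t ∈ LL b, (∀ z ∉ C, z + t ∉ C) → ∀ z ∈ C'ᶜ, z + t ∈ C'ᶜ := by
    intro t ht h z hz
    simp only [hC', mem_compl_iff, mem_union, mem_preimage, not_or] at hz ⊢
    refine ⟨h z hz.1, ?_⟩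
    rw [show z + t - q = z - q + t by ring, LL_addr ht]; exact hz.2
  refine lame_full hb hq hcon.isConnected.isPreconnected hcon.nonempty (fun z hz => (hUL z hz).2)
    (hadd 2 ⟨2, 0, by simp⟩ hC2) (hadd _ ⟨0, 2, by simp⟩ hC3)
    (P.mono hcl.isOpen_compl (compl_subset_compl.2 subset_union_left)) (fun z hz => ?_)
    (fun z hz => hper z (hUL z hz).1) (fun z hz => hper2 z (hUL z hz).1)
  obtain ⟨a1, a2, a3⟩ := hUL z hz
  refine (rq_hd hb a2 a3).congr_deriv ?_
  rw [hκ q hq z a2 a3, hQ z a1, hqB]; ring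
end
section
variable {b : ℝ} {w : ℂ} {Q r g s : ℂ → ℂ}
lemma rq_odd (hb : 0 < b) (hw : w ∉ LL b) (h2 : 2 * w ∈ LL b) {z : ℂ} (hz : z - w ∉ LL b) :
    rq b w (-z) = - rq b w z := by
  obtain ⟨m, n, hmn⟩ := h2
  have h := Zc_per hb (z := -w) (by rwa [LL_negi]) m n
  have h' := Zc_per hb hz m n
  rw [← hmn, show -w + 2 * w = w by ring, Zc_neg hb] at h
  rw [← hmn, show z - w + 2 * w = z + w by ring] at h'
  rw [rq, rq, show -z - w = -(z + w) by ring, Zc_neg hb, Zc_neg hb, h']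
  linear_combination h
lemma rq_w (hb : 0 < b) (hw : w ∉ LL b) (h2 : 2 * w ∈ LL b) {z : ℂ} (hz : z - w ∉ LL b) :
    rq b w (z + w) = - rq b w z := by
  rw [← rq_odd hb hw h2 hz, ← rq_refl hb w (-z)]; congr 1; ring
lemma coef1 {k : ℂ → ℂ} {a : ℂ} (hk : ContinuousAt k 0) (h : ∀ᶠ x in 𝓝[≠] (0:ℂ), a + x * k x = 0) :
    a = 0 ∧ ∀ᶠ x in 𝓝[≠] (0:ℂ), k x = 0 := by
  have h1 : a = 0 := by
    have := pe_const (F := fun x => a + x * k x) (z := 0) (by fun_prop) h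
    simpa using this
  refine ⟨h1, ?_⟩
  filter_upwards [h, self_mem_nhdsWithin] with x hx hx0
  rw [h1, zero_add] at hx
  exact (mul_eq_zero.1 hx).resolve_left hx0
lemma coef3 {k : ℂ → ℂ} {a b c : ℂ} (hk : ContinuousAt k 0)
    (h : ∀ᶠ x in 𝓝[≠] (0:ℂ), a + b * x + c * x ^ 2 + x ^ 3 * k x = 0) : a = 0 ∧ b = 0 ∧ c = 0 := by
  obtain ⟨h1, h2⟩ := coef1 (a := a) (k := fun x => b + x * (c + x * k x)) (by fun_prop)
    (by filter_upwards [h] with x hx; linear_combination hx)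
  obtain ⟨h3, h4⟩ := coef1 (by fun_prop) h2
  exact ⟨h1, h3, (coef1 hk h4).1⟩
lemma an_taylor {A : ℂ → ℂ} (h : AnalyticAt ℂ A 0) :
    ∃ s, AnalyticAt ℂ s 0 ∧ ∀ x, A x = A 0 + x * s x := by
  obtain ⟨s, h1, h2⟩ := an_factor (A := fun x => A x - A 0) (h.sub analyticAt_const) (sub_self _)
  exact ⟨s, h1, fun x => by have := h2 x; simp at this; linear_combination this⟩
lemma loc1 (hg : AnalyticAt ℂ g 0) (hg0 : g 0 ≠ 0) (hs : AnalyticAt ℂ s 0)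
    (hr : ∀ᶠ x in 𝓝[≠] (0:ℂ), r x = -1 / x + x * s x)
    (hE : ∀ᶠ x in 𝓝[≠] (0:ℂ), x^2*deriv (deriv g) x - 2*x*deriv g x + 2*g x = x^2*Q x*g x) :
    ∃ T, AE (fun x => Q x - 2 * r x ^ 2 - T * r x) 0 := by
  set T := 2 * deriv g 0 / g 0 with hT
  obtain ⟨a, ha, haE⟩ := an_factor (A := fun x => -2 * deriv g x + T * g x)
    ((analyticAt_const.mul hg.deriv).add (analyticAt_const.mul hg)) (by simp only [hT]; field_simp; ring)
  refine ⟨T, fun x => (deriv (deriv g) x + a x) / g x + 4 * s x - 2 * x ^ 2 * s x ^ 2 - T * x * s x, ?_, ?_⟩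
  · have := (hg.deriv.deriv.add ha).div hg hg0
    have h2 := hs
    fun_prop (disch := assumption)
  · filter_upwards [hr, hE, self_mem_nhdsWithin,
      (hg.continuousAt.eventually_ne hg0).filter_mono nhdsWithin_le_nhds] with x h1 h2 hx hgx
    have hx' : x ≠ 0 := hx
    have h3 := haE x
    simp only [sub_zero] at h3
    have h4 : Q x = (x^2*deriv (deriv g) x - 2*x*deriv g x + 2*g x) / (x^2 * g x) := by
      rw [h2]; field_simp
    rw [h1, h4]
    field_simp
    linear_combination h3 * x
lemma loc2 {T d : ℂ} (hg : AnalyticAt ℂ g 0) (hg0 : g 0 ≠ 0) (hs : AnalyticAt ℂ s 0)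
    (hse : ∀ᶠ x in 𝓝[≠] (0:ℂ), s (-x) = s x)
    (hr : ∀ᶠ x in 𝓝[≠] (0:ℂ), r x = -1 / x + x * s x)
    (hE : ∀ᶠ x in 𝓝[≠] (0:ℂ), x^2*deriv (deriv g) x - 2*x*deriv g x + 2*g x = x^2*Q x*g x)
    (hQ : ∀ᶠ x in 𝓝[≠] (0:ℂ), Q x = 2 * r x ^ 2 + T * r x + d) :
    T = 0 ∨ d = T ^ 2 / 4 + 3 * s 0 := by
  obtain ⟨s1, hs1, es1⟩ := an_taylor hs
  obtain ⟨s2, hs2, es2⟩ := an_taylor hs1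
  have hs10 : s1 0 = 0 := by
    have := (coef3 (a := 0) (b := -2 * s1 0) (c := 0) (k := fun x => 0 * x) (by fun_prop) ?_).2.1
    · simpa using this
    have : ∀ᶠ x in 𝓝[≠] (0:ℂ), 2 * s1 0 + x * (s2 x - s2 (-x)) = 0 := by
      filter_upwards [hse, self_mem_nhdsWithin] with x hx hx0
      rw [es1, es1 x, es2, es2 x] at hx
      apply mul_left_cancel₀ (show x ≠ 0 from hx0)
      linear_combination -hx
    have hc2 : ContinuousAt (fun x => s2 (-x)) 0 :=
      ContinuousAt.comp (g := s2) (f := fun x => -x) (by simpa using hs2.continuousAt) (by fun_prop)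
    have h5 := (coef1 (hs2.continuousAt.sub hc2) this).1
    exact Eventually.of_forall fun x => by linear_combination -x * h5
  obtain ⟨g1, hg1, eg1⟩ := an_taylor hg
  obtain ⟨g2, hg2, eg2⟩ := an_taylor hg1
  obtain ⟨G, hG, eG⟩ := an_taylor hg2
  set a0 := g 0
  set a1 := g1 0
  set a2 := g2 0
  have eg : g = fun x => a0 + a1 * x + a2 * x ^ 2 + x ^ 3 * G x := by
    funext x; rw [eg1, eg2, eG]; ring
  have d1 : ∀ x, AnalyticAt ℂ G x → HasDerivAt g (a1 + 2 * a2 * x + 3 * x ^ 2 * G x + x ^ 3 * deriv G x) x := by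
    intro x hx
    rw [eg]
    have h1 := hasDerivAt_id x
    have := (((h1.const_mul a1).const_add a0).add ((h1.pow 2).const_mul a2)).add
      ((h1.pow 3).mul hx.differentiableAt.hasDerivAt)
    refine (this.congr_of_eventuallyEq (Eventually.of_forall fun x => ?_)).congr_deriv ?_
    · simp
    · simp; ring
  have d2 : ∀ x, AnalyticAt ℂ G x → HasDerivAt (deriv g)
      (2 * a2 + 6 * x * G x + 6 * x ^ 2 * deriv G x + x ^ 3 * deriv (deriv G) x) x := by
    intro x hx
    have h1 := hasDerivAt_id x
    have := (((h1.const_mul (2 * a2)).const_add a1).add (((h1.pow 2).const_mul 3).mul hx.differentiableAt.hasDerivAt)).add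
      ((h1.pow 3).mul hx.deriv.differentiableAt.hasDerivAt)
    refine (this.congr_of_eventuallyEq ?_).congr_deriv ?_
    · filter_upwards [hx.eventually_analyticAt] with y hy
      rw [(d1 y hy).deriv]; simp
    · simp; ring
  -- right-hand side expansion
  obtain ⟨h1, h2, h3⟩ := coef3
    (a := -2 * a1 + T * a0)
    (b := -2 * a2 - (d - 4 * s 0) * a0 + T * a1)
    (c := - T * s 0 * a0 - (d - 4 * s 0) * a1 + T * a2)
    (k := fun x => 6 * deriv G x + x * deriv (deriv G) x - 2 * deriv G x + T * G x
      - (d - 4 * s 0) * a2 - (d - 4 * s 0) * x * G x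
      + 4 * s2 x * g x - T * s2 x * x * g x - T * s 0 * (a1 + a2 * x + x ^ 2 * G x)
      - 2 * s x ^ 2 * g x)
    (by
      have := hG.deriv.continuousAt
      have := hG.deriv.deriv.continuousAt
      have := hG.continuousAt
      have := hg.continuousAt
      have := hs.continuousAt
      have := hs2.continuousAt
      fun_prop)
    (by
      filter_upwards [hr, hE, hQ, self_mem_nhdsWithin, hG.eventually_analyticAt.filter_mono nhdsWithin_le_nhds]
        with x e1 e2 e3 hx hGx
      have hx' : x ≠ 0 := hx
      rw [e3, e1, (d1 x hGx).deriv, (d2 x hGx).deriv] at e2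
      have e4 : g x = a0 + a1 * x + a2 * x ^ 2 + x ^ 3 * G x := congrFun eg x
      have e5 : s x = s 0 + x ^ 2 * s2 x := by rw [es1, es2, hs10]; ring
      rw [e5]
      rw [e5] at e2
      field_simp at e2
      apply mul_left_cancel₀ hx'
      rw [e4] at e2 ⊢
      linear_combination e2)
  have ha0 : a0 ≠ 0 := hg0
  have key : T * (d - T ^ 2 / 4 - 3 * s 0) = 0 := by
    apply mul_left_cancel₀ ha0
    linear_combination -h3 + ((d - 4 * s 0)/2 - T ^ 2 / 4) * h1 + (-T/2) * h2 
  rcases mul_eq_zero.1 key with h | h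
  · exact Or.inl h
  · right; linear_combination h
end
lemma Pot.aff {U V : Set ℂ} {Q h h1 h12 : ℂ → ℂ} {c : ℝ} (P : Pot U Q h h1 h12 c)
    (hV : IsOpen V) {a : ℂ} (ha : a ≠ 0) (t : ℂ) (hVU : ∀ z ∈ V, a * z + t ∈ U) :
    Pot V (fun z => a ^ 2 * Q (a * z + t)) (fun z => h (a * z + t)) (fun z => a * h1 (a * z + t))
      (fun z => a * conj a * h12 (a * z + t)) (c * Complex.normSq a) := by
  have := P.trans (V := V) hV (φ := fun z => a * z + t) (φd := fun _ => a)
      (α := fun _ => 1) (β := fun _ => 0) (γ := fun _ => 0) (δ := fun _ => a)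
      (Q' := fun z => a ^ 2 * Q (a * z + t)) (D := a)
      ha hVU
      (fun z hz => (((hasDerivAt_id z).const_mul _).add_const t).congr_deriv (by simp))
      (fun z hz => (hasDerivAt_const z _).congr_deriv (by ring))
      (fun z hz => (hasDerivAt_const z _).congr_deriv (by ring))
      (fun z hz => (hasDerivAt_const z _).congr_deriv (by ring))
      (fun z hz => (hasDerivAt_const z _).congr_deriv (by ring))
      (fun z hz => by ring)
  simpa using this
def SS (b : ℝ) (w : ℂ) : Set ℂ := {z | z ∈ LL b ∨ z - w ∈ LL b}
def Blo (h : ℂ → ℂ) (p : ℂ) : Prop := ∃ ε A A' : ℝ, 0 < ε ∧ 0 < A ∧ ∀ x : ℂ, x ≠ 0 → ‖x‖ < ε →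
  A / ‖x‖ ^ 2 ≤ (h (x + p)).re ∧ (h (x + p)).re ≤ A' / ‖x‖ ^ 2
section
variable {b : ℝ} {w : ℂ} {Q h h1 h12 : ℂ → ℂ} {c : ℝ}
lemma SS_iff {z : ℂ} : z ∉ SS b w ↔ z ∉ LL b ∧ z - w ∉ LL b := by
  simp only [SS, mem_setOf_eq, not_or]
lemma SS_closed (hb : 0 < b) (w : ℂ) : IsClosed (SS b w) :=
  (LL_closed hb).union ((LL_closed hb).preimage (f := fun z => z - w) (by fun_prop))
lemma SS_countable (b : ℝ) (w : ℂ) : (SS b w).Countable := by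
  refine (LL_countable b).union ((LL_countable b).preimage_of_injOn (f := fun z => z - w) ?_)
  intro x _ y _ h; simpa using h
lemma SS_ev (hb : 0 < b) (w z : ℂ) : ∀ᶠ x in 𝓝[≠] z, x ∉ SS b w := by
  filter_upwards [LL_ev0 hb z, LL_ev hb z w] with x h1 h2
  exact SS_iff.2 ⟨h1, h2⟩
lemma SS_add {l z : ℂ} (hl : l ∈ LL b) : z + l ∈ SS b w ↔ z ∈ SS b w := by
  simp only [SS, mem_setOf_eq]
  rw [show z + l - w = z - w + l by ring, LL_addr hl, LL_addr hl]
lemma SS_neg (h2 : 2 * w ∈ LL b) {z : ℂ} : -z ∈ SS b w ↔ z ∈ SS b w := by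
  simp only [SS, mem_setOf_eq]
  rw [LL_negi, show -z - w = -(z - w + 2 * w) by ring, LL_negi, LL_addr h2]
lemma locg (hb : 0 < b) (P : Pot (SS b w)ᶜ Q h h1 h12 c) (hQd : DifferentiableOn ℂ Q (SS b w)ᶜ)
    {p : ℂ} (hB : Blo h p) : ∃ g : ℂ → ℂ, AnalyticAt ℂ g 0 ∧ g 0 ≠ 0 ∧
      ∀ᶠ x in 𝓝[≠] 0, x ^ 2 * deriv (deriv g) x - 2 * x * deriv g x + 2 * g x = x ^ 2 * Q (x + p) * g x := by
  obtain ⟨ε, A, A', hε, hA, hB⟩ := hB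
  have hev := ev_shift (z := 0) (t := p) (SS_ev hb w p) (by simp)
  rw [eventually_nhdsWithin_iff, Metric.eventually_nhds_iff] at hev
  obtain ⟨ε', hε', hev⟩ := hev
  have hsub : ∀ x ∈ ball (0:ℂ) (min ε ε') \ {0}, x + p ∈ (SS b w)ᶜ ∧ x ≠ 0 ∧ ‖x‖ < ε := by
    rintro x ⟨hx, hx0⟩
    rw [mem_ball, lt_min_iff] at hx
    exact ⟨hev hx.2 hx0, hx0, by simpa using hx.1⟩
  have hVo : IsOpen (ball (0:ℂ) (min ε ε') \ {0}) := isOpen_ball.sdiff isClosed_singleton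
  have P' := P.aff hVo one_ne_zero p (fun z hz => by rw [one_mul]; exact (hsub z hz).1)
  simp only [one_mul, one_pow, map_one, mul_one] at P'
  refine L1 (lt_min hε hε') P' ?_ hA (fun x hx => (hB x (hsub x hx).2.1 (hsub x hx).2.2).1)
    (fun x hx => (hB x (hsub x hx).2.1 (hsub x hx).2.2).2)
  exact hQd.comp (f := fun x => x + p) (by fun_prop) (fun x hx => (hsub x hx).1)
lemma glob (hb : 0 < b) (hw : w ∉ LL b) (h2 : 2 * w ∈ LL b)
    (P : Pot (SS b w)ᶜ Q h h1 h12 c) (hQd : DifferentiableOn ℂ Q (SS b w)ᶜ)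
    (hp1 : ∀ z, h (z + 1) = h z) (hp2 : ∀ z, h (z + I * b) = h z)
    (hB0 : Blo h 0) (hBw : Blo h w) {k : ℂ → ℂ} (hk : AnalyticAt ℂ k 0)
    (hZ : ∀ᶠ x in 𝓝[≠] 0, Zc b x = 1 / x + x * k x) :
    ∃ T d : ℂ, (∀ z ∉ SS b w, Q z = 2 * rq b w z ^ 2 + T * rq b w z + d) ∧
      (T = 0 ∨ d = T ^ 2 / 4 - 3 * (Pc b w + k 0)) := by
  obtain ⟨g, hg, hg0, hgE⟩ := locg hb P hQd hB0
  obtain ⟨g', hg', hg0', hgE'⟩ := locg hb P hQd hBw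
  obtain ⟨s, hs, hs0, hr⟩ := rq_zero hb hw hk hZ
  simp only [add_zero] at hgE
  obtain ⟨T, hT⟩ := loc1 (Q := Q) hg hg0 hs hr hgE
  obtain ⟨T', hT'⟩ := loc1 (Q := fun x => Q (x + w)) hg' hg0' hs hr hgE'
  have hQan : ∀ z ∉ SS b w, AnalyticAt ℂ Q z := fun z hz =>
    hQd.analyticAt ((SS_closed hb w).isOpen_compl.mem_nhds hz)
  have hw0 : ∀ᶠ x in 𝓝[≠] (0:ℂ), x - w ∉ LL b := LL_ev hb 0 w
  have hZw : ∀ z, z - w ∉ LL b → AnalyticAt ℂ (fun z => Zc b (z - w)) z := fun z hz =>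
    AnalyticAt.comp' (f := fun x => x - w) (Zc_d hb hz) (by fun_prop)
  set F := fun z => Q z - 2 * rq b w z ^ 2 - T * rq b w z + (T + T') * Zc b (z - w) with hF
  have hAw : AE F w := by
    have a1 : AE (fun x => Q x - 2 * rq b w x ^ 2 + T' * rq b w x) w := by
      have := hT'.shift (z := w) (t := -w) (by simp)
      refine this.congr ?_
      have e := ev_shift (z := w) (t := -w) hw0 (by simp)
      filter_upwards [e] with x hx
      have := rq_w hb hw h2 hx
      simp only [neg_add_cancel_right] at this ⊢
      rw [this]; ring
    have a2 : AE (fun x => Zc b (x - w) - rq b w x) w := by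
      refine AE.congr ((Zc_d hb hw).sub (analyticAt_const (v := Zc b w))).ae ?_
      exact Eventually.of_forall fun x => by simp [rq]; ring
    have := a1.add ((AE.const (T + T')).mul a2)
    refine this.congr (Eventually.of_forall fun x => ?_)
    simp only [hF]; ring
  have hA0 : AE F 0 := hT.add ((AE.const _).mul (hZw 0 (by rw [zero_sub, LL_negi]; exact hw)).ae)
  have hAn : ∀ z ∉ SS b w, AnalyticAt ℂ F z := by
    intro z hz
    obtain ⟨z1, z2⟩ := SS_iff.1 hz
    have a1 := hQan z hz
    have a2 := rq_an hb z1 z2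
    have a3 := hZw z z2
    exact ((a1.sub (analyticAt_const.mul (a2.pow 2))).sub (analyticAt_const.mul a2)).add (analyticAt_const.mul a3)
  have hQ1 := P.per (t := 1) (fun z hz => by rw [mem_compl_iff, SS_add (LL_one b)]; exact hz) (fun z _ => hp1 z)
  have hQ2 := P.per (t := I * b) (fun z hz => by rw [mem_compl_iff, SS_add (LL_ib b)]; exact hz) (fun z _ => hp2 z)
  obtain ⟨e1, d, hd⟩ := EQ hb (F := F) (p1 := 0) (p2 := -(T + T') * (2 * π * I))
    (cases2 hA0 hAw (fun z z1 z2 => (hAn z (SS_iff.2 ⟨z1, z2⟩)).ae))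
    (fun z => by
      filter_upwards [SS_ev hb w z] with x hx
      simp only [hF]
      rw [(hQ1 x hx).2.2, rq_one, show x + 1 - w = x - w + 1 by ring, Zc_one, add_zero])
    (fun z => by
      filter_upwards [SS_ev hb w z] with x hx
      obtain ⟨z1, z2⟩ := SS_iff.1 hx
      simp only [hF]
      rw [(hQ2 x hx).2.2, rq_ib hb z1 z2, show x + I * b - w = x - w + I * b by ring, Zc_ib hb z2]
      ring)
  have hTT : T + T' = 0 := by
    have hpi : (π : ℂ) ≠ 0 := by exact_mod_cast Real.pi_ne_zero
    rw [zero_mul] at e1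
    rcases mul_eq_zero.1 e1 with h | h
    · linear_combination -h
    · simp [hpi] at h
  have hQF : ∀ z ∉ SS b w, Q z = 2 * rq b w z ^ 2 + T * rq b w z + d := by
    intro z hz
    have := pe_const (hAn z hz).continuousAt (by simpa using hd z)
    simp only [hF, hTT] at this
    linear_combination this
  refine ⟨T, d, hQF, ?_⟩
  have hse : ∀ᶠ x in 𝓝[≠] (0:ℂ), s (-x) = s x := by
    have hn : Tendsto (fun x : ℂ => -x) (𝓝[≠] 0) (𝓝[≠] 0) := by
      refine tendsto_nhdsWithin_iff.2 ⟨?_, ?_⟩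
      · have : Tendsto (fun x : ℂ => -x) (𝓝 0) (𝓝 (-0)) := continuous_neg.tendsto 0
        rw [neg_zero] at this
        exact this.mono_left nhdsWithin_le_nhds
      · filter_upwards [self_mem_nhdsWithin] with x hx; simpa using hx
    filter_upwards [hr, hn.eventually hr, hw0, self_mem_nhdsWithin] with x e1 e2 e3 hx
    have hx' : x ≠ 0 := hx
    rw [rq_odd hb hw h2 e3, e1] at e2
    have : x * (s (-x) - s x) = 0 := by
      have h3 : -1 / -x = 1 / x := by rw [neg_div_neg_eq]
      rw [h3] at e2
      linear_combination e2
    exact sub_eq_zero.1 ((mul_eq_zero.1 this).resolve_left hx')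
  rcases loc2 (Q := Q) (T := T) (d := d) hg hg0 hs hse hr hgE (by
    filter_upwards [SS_ev hb w 0] with x hx; exact hQF x hx) with h | h
  · exact Or.inl h
  · right; rw [h, hs0]; ring
end
section
variable {b : ℝ} {w : ℂ} {Q h h1 h12 : ℂ → ℂ} {c : ℝ}
lemma tne (hb : 0 < b) (hw : w ∉ LL b) (h2 : 2 * w ∈ LL b)
    (P : Pot (SS b w)ᶜ Q h h1 h12 c)
    (hp1 : ∀ z, h (z + 1) = h z) (hp2 : ∀ z, h (z + I * b) = h z)
    {κ : ℂ} (hκ : ∀ q ∉ LL b, ∀ z ∉ LL b, z - q ∉ LL b →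
    rq b q z ^ 2 = Pc b z + Pc b (z - q) + Pc b q + 3 * κ) {T : ℂ}
    (hQ : ∀ z ∉ SS b w, Q z = 2 * rq b w z ^ 2 + T * rq b w z + (T ^ 2 / 4 - 3 * (Pc b w + κ))) : False := by
  obtain ⟨A, hA, hsq⟩ := yq_sq hb hw h2
  obtain ⟨m1, m2⟩ := half_mult hb hw h2
  obtain ⟨μ, rfl⟩ : ∃ μ, T = -2 * μ := ⟨-T / 2, by ring⟩
  have hS : IsOpen (SS b w)ᶜ := (SS_closed hb w).isOpen_compl
  have hS1 : ∀ z ∈ (SS b w)ᶜ, z + 1 ∈ (SS b w)ᶜ := fun z hz => by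
    rw [mem_compl_iff, SS_add (LL_one b)]; exact hz
  have hS2 : ∀ z ∈ (SS b w)ᶜ, z + I * b ∈ (SS b w)ᶜ := fun z hz => by
    rw [mem_compl_iff, SS_add (LL_ib b)]; exact hz
  have hy : ∀ z ∈ (SS b w)ᶜ, yq b w z ≠ 0 := fun z hz => yq_ne hb (SS_iff.1 hz).1 (SS_iff.1 hz).2
  have ds : ∀ z ∈ (SS b w)ᶜ, HasDerivAt (yq b w) (rq b w z * yq b w z) z := fun z hz =>
    yq_hd hb (SS_iff.1 hz).1 (SS_iff.1 hz).2
  have hSi : ∀ z ∈ (SS b w)ᶜ, Pc b z = Pc b w + yq b w z ^ 2 / A := fun z hz => by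
    rw [hsq z (SS_iff.1 hz).1]; field_simp; ring
  have dSi : ∀ z ∈ (SS b w)ᶜ, HasDerivAt (Pc b) (2 * rq b w z * (yq b w z ^ 2 / A)) z := fun z hz => by
    have := (((ds z hz).pow 2).div_const A).const_add (Pc b w)
    refine (this.congr_of_eventuallyEq ?_).congr_deriv (by simp; ring)
    filter_upwards [hS.mem_nhds hz] with x hx
    exact hSi x hx
  have dr : ∀ z ∈ (SS b w)ᶜ, HasDerivAt (rq b w) (2 * Pc b z + Pc b w + 3 * κ - rq b w z ^ 2) z := fun z hz => by
    obtain ⟨z1, z2⟩ := SS_iff.1 hz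
    refine (rq_hd hb z1 z2).congr_deriv ?_
    rw [hκ w hw z z1 z2]; ring
  have P' := P.trans (V := (SS b w)ᶜ) hS (φ := fun z => z) (φd := fun _ => 1)
      (α := fun z => (rq b w z - μ) / yq b w z) (β := fun z => 1 / yq b w z)
      (γ := fun z => (2 * Pc b z - 2 * Pc b w + μ ^ 2 - μ * rq b w z) / yq b w z)
      (δ := fun z => -μ / yq b w z)
      (Q' := fun z => 2 * Pc b z + (μ ^ 2 - 2 * Pc b w)) (D := -2 / A)
      (div_ne_zero (by norm_num) hA) (fun z hz => hz) (fun z hz => hasDerivAt_id z)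
      (fun z hz => by
        have hn := hy z hz
        refine (((dr z hz).sub_const μ).div (ds z hz) hn).congr_deriv ?_
        rw [hQ z hz]; field_simp; ring)
      (fun z hz => by
        have hn := hy z hz
        refine ((hasDerivAt_const z (1:ℂ)).div (ds z hz) hn).congr_deriv ?_
        field_simp; ring)
      (fun z hz => by
        have hn := hy z hz
        refine ((((((dSi z hz).const_mul 2).sub_const (2 * Pc b w)).add_const (μ ^ 2)).sub
          ((dr z hz).const_mul μ)).div (ds z hz) hn).congr_deriv ?_
        simp only [Pi.sub_apply]
        rw [hQ z hz, hSi z hz]; field_simp; ring)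
      (fun z hz => by
        have hn := hy z hz
        refine ((hasDerivAt_const z (-μ)).div (ds z hz) hn).congr_deriv ?_
        field_simp; ring)
      (fun z hz => by
        have hn := hy z hz
        simp only [hSi z hz]; field_simp; ring)
  have p1 := P.per hS1 (fun z _ => hp1 z)
  have p2 := P.per hS2 (fun z _ => hp2 z)
  refine lame (B := μ ^ 2 - 2 * Pc b w) hb (SS_closed hb w) (SS_countable b w) (fun z hz => Or.inl hz) (fun z hz => ?_) (fun z hz => ?_) P'
    (fun z hz => rfl) (fun z hz => ?_) (fun z hz => ?_)
  · rw [show z + 2 = z + 1 + 1 by ring]; exact hS1 _ (hS1 _ hz)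
  · rw [show z + 2 * (I * b) = z + I * b + I * b by ring]; exact hS2 _ (hS2 _ hz)
  · have e1 : yq b w (z + 2) = yq b w z := by
      rw [show z + 2 = z + 1 + 1 by ring, yq_one, yq_one]; linear_combination yq b w z * m1
    have e2 : rq b w (z + 2) = rq b w z := by
      rw [show z + 2 = z + 1 + 1 by ring, rq_one, rq_one]
    have e3 : h (z + 2) = h z := by rw [show z + 2 = z + 1 + 1 by ring, hp1, hp1]
    have e4 : h1 (z + 2) = h1 z := by
      rw [show z + 2 = z + 1 + 1 by ring, (p1 _ (hS1 z hz)).1, (p1 z hz).1]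
    have e5 : h12 (z + 2) = h12 z := by
      rw [show z + 2 = z + 1 + 1 by ring, (p1 _ (hS1 z hz)).2.1, (p1 z hz).2.1]
    simp only [e1, e2, e3, e4, e5]
  · have e1 : yq b w (z + 2 * (I * b)) = yq b w z := by
      rw [show z + 2 * (I * b) = z + I * b + I * b by ring, yq_ib hb, yq_ib hb]
      linear_combination yq b w z * m2
    have e2 : rq b w (z + 2 * (I * b)) = rq b w z := by
      rw [show z + 2 * (I * b) = z + I * b + I * b by ring,
        rq_ib hb (SS_iff.1 (hS2 z hz)).1 (SS_iff.1 (hS2 z hz)).2, rq_ib hb (SS_iff.1 hz).1 (SS_iff.1 hz).2]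
    have e3 : h (z + 2 * (I * b)) = h z := by
      rw [show z + 2 * (I * b) = z + I * b + I * b by ring, hp2, hp2]
    have e4 : h1 (z + 2 * (I * b)) = h1 z := by
      rw [show z + 2 * (I * b) = z + I * b + I * b by ring, (p2 _ (hS2 z hz)).1, (p2 z hz).1]
    have e5 : h12 (z + 2 * (I * b)) = h12 z := by
      rw [show z + 2 * (I * b) = z + I * b + I * b by ring, (p2 _ (hS2 z hz)).2.1, (p2 z hz).2.1]
    simp only [e1, e2, e3, e4, e5]
end
section
variable {b : ℝ} {w : ℂ} {Q h h1 h12 : ℂ → ℂ} {c : ℝ}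
lemma Pc_LL (hb : 0 < b) {l z : ℂ} (hl : l ∈ LL b) (hz : z ∉ LL b) : Pc b (z + l) = Pc b z := by
  obtain ⟨m, n, rfl⟩ := hl
  have hz' : z + (m + n * (I * b)) ∉ LL b := by rw [LL_addr ⟨m, n, rfl⟩]; exact hz
  have h1 : HasDerivAt (fun x => Zc b (x + (m + n * (I * b)))) (-Pc b (z + (m + n * (I * b)))) z :=
    (Zc_hd hb hz').comp_add_const z _
  have h2 := h1.unique (((Zc_hd hb hz).sub_const (2 * π * I * n)).congr_of_eventuallyEq
    (by filter_upwards [LL_open hb hz] with x hx; exact Zc_per hb hx m n))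
  linear_combination -h2
lemma per_LL (hp1 : ∀ z, h (z + 1) = h z) (hp2 : ∀ z, h (z + I * b) = h z) {l : ℂ} (hl : l ∈ LL b)
    (z : ℂ) : h (z + l) = h z := by
  obtain ⟨m, n, rfl⟩ := hl
  have a1 := Function.Periodic.int_mul (f := h) (c := 1) hp1 m z
  have a2 := Function.Periodic.int_mul (f := h) (c := I * b) hp2 n (z + m)
  rw [mul_one] at a1
  rw [← add_assoc, a2, a1]
lemma teq (hb : 0 < b) (hw : w ∉ LL b) (h2 : 2 * w ∈ LL b)
    (P : Pot (SS b w)ᶜ Q h h1 h12 c)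
    (hp1 : ∀ z, h (z + 1) = h z) (hp2 : ∀ z, h (z + I * b) = h z)
    {B : ℂ} (hQ : ∀ z ∉ SS b w, Q z = 2 * (Pc b z + Pc b (z - w)) + B)
    {b' : ℝ} (hb' : 0 < b') {a : ℂ} (ha : a ≠ 0) (hiff : ∀ z, a * z ∈ SS b w ↔ z ∈ LL b')
    (ht1 : a ∈ LL b ∨ a = w) (ht2 : a * (I * b') ∈ LL b ∨ a * (I * b') = w) : False := by
  set G := fun z => Pc b z + Pc b (z - w) with hG
  have hGt : ∀ t, (t ∈ LL b ∨ t = w) → ∀ z ∉ SS b w, G (z + t) = G z := by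
    intro t ht z hz
    obtain ⟨z1, z2⟩ := SS_iff.1 hz
    rcases ht with ht | rfl
    · simp only [hG]
      rw [show z + t - w = z - w + t by ring, Pc_LL hb ht z1, Pc_LL hb ht z2]
    · simp only [hG]
      rw [show z + t = z - t + 2 * t by ring, Pc_LL hb h2 z2, show z - t + 2 * t - t = z by ring, add_comm]
  have h2t : ∀ t, (t ∈ LL b ∨ t = w) → 2 * t ∈ LL b := by
    intro t ht
    rcases ht with ht | rfl
    · rw [two_mul]; exact LL_add ht ht
    · exact h2
  set F := fun z => a ^ 2 * G (a * z) - Pc b' z with hF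
  have hAn : ∀ z ∉ LL b', AnalyticAt ℂ F z := by
    intro z hz
    rw [← hiff] at hz
    obtain ⟨z1, z2⟩ := SS_iff.1 hz
    rw [hiff] at hz
    have a1 : AnalyticAt ℂ (fun x => Pc b (a * x)) z :=
      AnalyticAt.comp' (f := fun x => a * x) (Pc_an hb z1) (by fun_prop)
    have a2 : AnalyticAt ℂ (fun x => Pc b (a * x - w)) z :=
      AnalyticAt.comp' (f := fun x => a * x - w) (Pc_an hb z2) (by fun_prop)
    exact (analyticAt_const.mul (a1.add a2)).sub (Pc_an hb' hz)
  have hA0 : AE F 0 := by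
    obtain ⟨k, hk, -, hP⟩ := Zc_zero2 hb
    obtain ⟨k', hk', -, hP'⟩ := Zc_zero2 hb'
    have hn : Tendsto (fun x : ℂ => a * x) (𝓝[≠] 0) (𝓝[≠] 0) := by
      refine tendsto_nhdsWithin_iff.2 ⟨?_, ?_⟩
      · have : Tendsto (fun x : ℂ => a * x) (𝓝 0) (𝓝 (a * 0)) := (by fun_prop : Continuous fun x : ℂ => a * x).tendsto 0
        rw [mul_zero] at this
        exact this.mono_left nhdsWithin_le_nhds
      · filter_upwards [self_mem_nhdsWithin] with x hx
        have : x ≠ 0 := hx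
        simp [ha, this]
    have a0 : AnalyticAt ℂ (fun x => Pc b (a * x - w)) 0 :=
      AnalyticAt.comp' (f := fun x => a * x - w) (Pc_an hb (by
        rw [mul_zero, zero_sub, LL_negi]; exact hw)) (by fun_prop)
    have a1 : AnalyticAt ℂ (fun x => k x + x * deriv k x) (a * 0) := by
      rw [mul_zero]; exact hk.add (analyticAt_id.mul hk.deriv)
    have a2 : AnalyticAt ℂ (fun x => k' x + x * deriv k' x) 0 := hk'.add (analyticAt_id.mul hk'.deriv)
    have a3 := AnalyticAt.comp' (f := fun x => a * x) a1 (by fun_prop)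
    refine ⟨_, (analyticAt_const (v := a ^ 2).mul (a0.sub a3)).add a2, ?_⟩
    filter_upwards [hn.eventually hP, hP', self_mem_nhdsWithin] with x e1 e2 hx
    have hx' : x ≠ 0 := hx
    simp only [hF, hG, e1, e2, Pi.add_apply, Pi.sub_apply, Pi.mul_apply]
    field_simp
    ring
  have hAE : ∀ z, ∃ l ∈ LL b', AE F (z + l) := by
    intro z
    by_cases hz : z ∈ LL b'
    · exact ⟨-z, LL_neg hz, by simpa using hA0⟩
    · exact ⟨0, LL_zero b', by simpa using (hAn z hz).ae⟩
  obtain ⟨d, hd⟩ := E0 hb' hAE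
    (fun z => by
      filter_upwards [LL_ev0 hb' z] with x hx
      simp only [hF]
      rw [show a * (x + 1) = a * x + a by ring, hGt a ht1 _ (by rw [hiff]; exact hx), Pc_one])
    (fun z => by
      filter_upwards [LL_ev0 hb' z] with x hx
      simp only [hF]
      rw [mul_add a x, hGt _ ht2 _ (by rw [hiff]; exact hx), Pc_ib hb' hx])
  have hFd : ∀ z ∉ LL b', F z = d := fun z hz => pe_const (hAn z hz).continuousAt (hd z)
  have P' := P.aff (V := (LL b')ᶜ) (LL_closed hb').isOpen_compl ha 0 (fun z hz => by
    rw [add_zero, mem_compl_iff, hiff]; exact hz)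
  simp only [add_zero] at P'
  refine lame (B := 2 * d + a ^ 2 * B) hb' (LL_closed hb') (LL_countable b') (fun z hz => hz) (fun z hz => ?_) (fun z hz => ?_) P'
    (fun z hz => ?_) (fun z hz => ?_) (fun z hz => ?_)
  · rw [LL_addr ⟨2, 0, by simp⟩]; exact hz
  · rw [LL_addr ⟨0, 2, by simp⟩]; exact hz
  · have := hFd z hz
    simp only [hF, hG] at this
    rw [hQ (a * z) (by rw [hiff]; exact hz)]
    linear_combination 2 * this
  · rw [show a * (z + 2) = a * z + 2 * a by ring]; exact per_LL hp1 hp2 (h2t _ ht1) _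
  · rw [show a * (z + 2 * (I * b')) = a * z + 2 * (a * (I * b')) by ring]
    exact per_LL hp1 hp2 (h2t _ ht2) _
lemma half_not (hb : 0 < b) {m n : ℤ} (h : Odd m ∨ Odd n) : (m + n * (I * b)) / 2 ∉ LL b := by
  rw [LL_iff]
  rintro ⟨p, q, h1, h2⟩
  simp at h1 h2
  have e1 : m = 2 * p := by
    have : (m : ℝ) = 2 * p := by linarith
    exact_mod_cast this
  have e2 : n = 2 * q := by
    have : (n : ℝ) * b = (2 * q) * b := by linarith
    have := mul_right_cancel₀ hb.ne' this
    exact_mod_cast this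
  rcases h with h | h
  · rw [e1] at h; exact (Int.not_odd_iff_even.2 (even_two_mul p)) h
  · rw [e2] at h; exact (Int.not_odd_iff_even.2 (even_two_mul q)) h
lemma teq1 (hb : 0 < b) (P : Pot (SS b (1 / 2))ᶜ Q h h1 h12 c)
    (hp1 : ∀ z, h (z + 1) = h z) (hp2 : ∀ z, h (z + I * b) = h z)
    {B : ℂ} (hQ : ∀ z ∉ SS b (1 / 2), Q z = 2 * (Pc b z + Pc b (z - 1 / 2)) + B) : False := by
  have hw : (1 / 2 : ℂ) ∉ LL b := by
    have := half_not hb (m := 1) (n := 0) (Or.inl (by decide)); simpa using this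
  refine teq hb hw (by simpa using LL_one b) P hp1 hp2 hQ (b' := 2 * b) (by positivity)
    (a := 1 / 2) (by norm_num) (fun z => ?_) (Or.inr rfl) (Or.inl ?_)
  · simp only [SS, mem_setOf_eq]
    constructor
    · rintro (⟨m, n, h⟩ | ⟨m, n, h⟩)
      · exact ⟨2 * m, n, by push_cast; linear_combination 2 * h⟩
      · exact ⟨2 * m + 1, n, by push_cast; linear_combination 2 * h⟩
    · rintro ⟨m, n, h⟩
      rcases Int.even_or_odd' m with ⟨p, rfl | rfl⟩
      · exact Or.inl ⟨p, n, by rw [h]; push_cast; ring⟩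
      · exact Or.inr ⟨p, n, by rw [h]; push_cast; ring⟩
  · convert LL_ib b using 1; push_cast; ring
lemma teq2 (hb : 0 < b) (P : Pot (SS b (I * b / 2))ᶜ Q h h1 h12 c)
    (hp1 : ∀ z, h (z + 1) = h z) (hp2 : ∀ z, h (z + I * b) = h z)
    {B : ℂ} (hQ : ∀ z ∉ SS b (I * b / 2), Q z = 2 * (Pc b z + Pc b (z - I * b / 2)) + B) : False := by
  have hw : (I * b / 2 : ℂ) ∉ LL b := by
    have := half_not hb (m := 0) (n := 1) (Or.inr (by decide)); simpa using this
  refine teq hb hw (by rw [mul_div_cancel₀ _ (two_ne_zero)]; exact LL_ib b) P hp1 hp2 hQ (b' := b / 2) (by positivity)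
    (a := 1) (by norm_num) (fun z => ?_) (Or.inl (LL_one b)) (Or.inr (by push_cast; ring))
  rw [one_mul]
  simp only [SS, mem_setOf_eq]
  constructor
  · rintro (⟨m, n, h⟩ | ⟨m, n, h⟩)
    · exact ⟨m, 2 * n, by push_cast; linear_combination h⟩
    · exact ⟨m, 2 * n + 1, by push_cast; linear_combination h⟩
  · rintro ⟨m, n, h⟩
    rcases Int.even_or_odd' n with ⟨p, rfl | rfl⟩
    · exact Or.inl ⟨m, p, by rw [h]; push_cast; ring⟩
    · exact Or.inr ⟨m, p, by rw [h]; push_cast; ring⟩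
end
noncomputable def hu (u : ℂ → ℝ) : ℂ → ℂ := fun z => ((Real.exp (-(u z)/2) : ℝ) : ℂ)
section
variable {b : ℝ} {u : ℂ → ℝ}
lemma sing_eq {k : ℕ} (hk : k = 1 ∨ k = 2 ∨ k = 3) (b : ℝ) :
    singSet (I * b) (starM k) = SS b (per (I * b) k / 2) := by
  have hk4 : k < 4 := by omega
  ext z
  simp only [singSet, SS, mem_setOf_eq, starM]
  constructor
  · rintro ⟨j, hj, l, hl, rfl⟩
    have : (j : ℕ) = 0 ∨ (j : ℕ) = k := by
      by_contra hcon; rw [if_neg hcon] at hj; omega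
    rcases this with h | h
    · left; rw [h]; simpa [per] using hl
    · right; rw [h]; simpa using hl
  · rintro (h | h)
    · exact ⟨0, by simp, z, h, by simp [per]⟩
    · exact ⟨⟨k, hk4⟩, by simp, _, h, by simp⟩
lemma blo_of (p : ℂ) (h : ∃ C ε : ℝ, 0 < ε ∧ ∀ z : ℂ, z ≠ p → dist z p < ε →
      |u z - 4 * Real.log (dist z p)| ≤ C) : Blo (hu u) p := by
  obtain ⟨C, ε, hε, h⟩ := h
  refine ⟨ε, Real.exp (-C / 2), Real.exp (C / 2), hε, Real.exp_pos _, fun x hx hxe => ?_⟩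
  have hd : dist (x + p) p = ‖x‖ := by simp [dist_eq_norm]
  have := h (x + p) (by simpa using hx) (by rw [hd]; exact hxe)
  rw [hd, abs_le] at this
  have hx0 : 0 < ‖x‖ := norm_pos_iff.2 hx
  have e : ∀ a : ℝ, Real.exp a / ‖x‖ ^ 2 = Real.exp (a - 2 * Real.log ‖x‖) := by
    intro a
    rw [Real.exp_sub, two_mul, Real.exp_add, Real.exp_log hx0, sq]
  simp only [hu, Complex.ofReal_re]
  rw [e, e, Real.exp_le_exp, Real.exp_le_exp]
  constructor <;> linarith [this.1, this.2]
lemma of_blo {p : ℂ} (h : Blo (hu u) p) : ∃ C ε : ℝ, 0 < ε ∧ ∀ z : ℂ, z ≠ p → dist z p < ε →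
      |u z - 4 * Real.log (dist z p)| ≤ C := by
  obtain ⟨ε, A, A', hε, hA, h⟩ := h
  have hA' : 0 < A' := by
    obtain ⟨h1, h2⟩ := h ((ε / 2 : ℝ) : ℂ) (by
      have : ε / 2 ≠ 0 := by positivity
      exact_mod_cast this) (by
        rw [Complex.norm_real, Real.norm_of_nonneg (by positivity)]; linarith)
    have h3 := h1.trans h2
    have hp : 0 < ‖((ε / 2 : ℝ) : ℂ)‖ ^ 2 := by
      rw [Complex.norm_real, Real.norm_of_nonneg (by positivity)]; positivity
    rw [div_le_div_iff_of_pos_right hp] at h3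
    linarith
  refine ⟨max (-2 * Real.log A) (2 * Real.log A'), ε, hε, fun z hz hze => ?_⟩
  obtain ⟨h1, h2⟩ := h (z - p) (sub_ne_zero.2 hz) (by rwa [← dist_eq_norm])
  have hd : ‖z - p‖ = dist z p := (dist_eq_norm _ _).symm
  have hx0 : 0 < dist z p := dist_pos.2 hz
  have e : ∀ a : ℝ, 0 < a → a / dist z p ^ 2 = Real.exp (Real.log a - 2 * Real.log (dist z p)) := by
    intro a ha
    rw [Real.exp_sub, two_mul, Real.exp_add, Real.exp_log hx0, Real.exp_log ha, sq]
  simp only [hu, Complex.ofReal_re, sub_add_cancel, hd] at h1 h2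
  rw [e _ hA, Real.exp_le_exp] at h1
  rw [e _ hA', Real.exp_le_exp] at h2
  rw [abs_le]
  constructor
  · have := le_max_right (-2 * Real.log A) (2 * Real.log A'); linarith
  · have := le_max_left (-2 * Real.log A) (2 * Real.log A'); linarith
lemma sol_main {k : ℕ} (hk : k = 1 ∨ k = 2 ∨ k = 3) (hb : 0 < b) {w : ℂ} (hw : w ∉ LL b) (h2 : 2 * w ∈ LL b)
    (hwk : w = per (I * b) k / 2)
    (hs : IsCurvatureSolution (I * b) (starM k) u) :
    ∃ Q h1 h12 : ℂ → ℂ, ∃ B : ℂ, Pot (SS b w)ᶜ Q (hu u) h1 h12 (1 / 8) ∧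
      (∀ z, hu u (z + 1) = hu u z) ∧ (∀ z, hu u (z + I * b) = hu u z) ∧
      (∀ p ∈ SS b w, Blo (hu u) p) ∧
      (∀ z ∉ SS b w, Q z = 2 * (Pc b z + Pc b (z - w)) + B) := by
  have hk4 : k < 4 := by omega
  obtain ⟨p1, p2, hS, hB⟩ := hs
  rw [sing_eq hk, ← hwk] at hS
  obtain ⟨Q, h1, h12, P, hQd⟩ := pot_of_u (SS_closed hb w).isOpen_compl hS
  have q1 : ∀ z, hu u (z + 1) = hu u z := fun z => by simp only [hu, p1]
  have q2 : ∀ z, hu u (z + I * b) = hu u z := fun z => by simp only [hu, p2]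
  have hBl : ∀ p ∈ SS b w, Blo (hu u) p := by
    rintro p (hp | hp)
    · have := hB 0 (by simp [starM]) p hp
      simp only [starM, per, Fin.val_zero, zero_div, zero_add] at this
      exact blo_of p (by simpa using this)
    · have := hB ⟨k, hk4⟩ (by simp [starM]) _ hp
      simp only [starM, ← hwk, or_true, if_true, add_sub_cancel] at this
      exact blo_of p (by simpa using this)
  obtain ⟨κ, ⟨kk, hk, rfl, hZ⟩, hκ⟩ := lame_id hb
  obtain ⟨T, d, hQ, hTd⟩ := glob hb hw h2 P hQd q1 q2 (hBl 0 (Or.inl (LL_zero b)))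
    (hBl w (Or.inr (by rw [sub_self]; exact LL_zero b))) hk hZ
  have hT : T = 0 := by
    rcases hTd with h | h
    · exact h
    · exfalso
      refine tne hb hw h2 P q1 q2 hκ (T := T) (fun z hz => ?_)
      rw [hQ z hz, h]
  refine ⟨Q, h1, h12, 2 * (Pc b w + 3 * kk 0) + d, P, q1, q2, hBl, fun z hz => ?_⟩
  obtain ⟨z1, z2⟩ := SS_iff.1 hz
  rw [hQ z hz, hT, hκ w hw z z1 z2]; ring
lemma case1 (hb : 0 < b) : ¬ ∃ u : ℂ → ℝ, IsCurvatureSolution (I * (b : ℂ)) (starM 1) u := by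
  rintro ⟨u, hs⟩
  have hw : (1 / 2 : ℂ) ∉ LL b := by
    have := half_not hb (m := 1) (n := 0) (Or.inl (by decide)); simpa using this
  obtain ⟨Q, h1, h12, B, P, q1, q2, -, hQ⟩ := sol_main (Or.inl rfl) hb hw (by simpa using LL_one b) rfl hs
  exact teq1 hb P q1 q2 hQ
lemma case2 (hb : 0 < b) : ¬ ∃ u : ℂ → ℝ, IsCurvatureSolution (I * (b : ℂ)) (starM 2) u := by
  rintro ⟨u, hs⟩
  have hw : (I * b / 2 : ℂ) ∉ LL b := by
    have := half_not hb (m := 0) (n := 1) (Or.inr (by decide)); simpa using this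
  obtain ⟨Q, h1, h12, B, P, q1, q2, -, hQ⟩ := sol_main (Or.inr (Or.inl rfl)) hb hw
    (by rw [mul_div_cancel₀ _ (two_ne_zero)]; exact LL_ib b) rfl hs
  exact teq2 hb P q1 q2 hQ
end
lemma Pot.addp {U : Set ℂ} {Q h h1 h12 k k1 k12 : ℂ → ℂ} {c c' : ℝ} (P : Pot U Q h h1 h12 c)
    (P' : Pot U Q k k1 k12 c') (hc : IsPreconnected U) (ne : U.Nonempty) :
    ∃ C : ℝ, Pot U Q (fun z => h z + k z) (fun z => h1 z + k1 z) (fun z => h12 z + k12 z) C := by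
  obtain ⟨z0, hz0⟩ := ne
  set E : ℂ → ℂ := fun z => (h z + k z) * (h12 z + k12 z) - (h1 z + k1 z) * conj (h1 z + k1 z) with hE
  have D0 : ∀ z ∈ U, HasW (fun z => h z + k z) (h1 z + k1 z) (conj (h1 z + k1 z)) z := fun z hz =>
    ((P.d0 z hz).add (P'.d0 z hz)).to rfl (map_add _ _ _).symm
  have D1 : ∀ z ∈ U, HasW (fun z => h1 z + k1 z) (Q z * (h z + k z)) (h12 z + k12 z) z := fun z hz =>
    ((P.d1 z hz).add (P'.d1 z hz)).to (by ring) rfl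
  have D2 : ∀ z ∈ U, HasW (fun z => h12 z + k12 z) (Q z * conj (h1 z + k1 z))
      (conj (Q z) * (h1 z + k1 z)) z := fun z hz =>
    ((P.d2 z hz).add (P'.d2 z hz)).to (by rw [map_add]; ring) (by ring)
  have R0 : ∀ z ∈ U, conj (h z + k z) = h z + k z := fun z hz => by
    rw [map_add, P.re0 z hz, P'.re0 z hz]
  have R2 : ∀ z ∈ U, conj (h12 z + k12 z) = h12 z + k12 z := fun z hz => by
    rw [map_add, P.re12 z hz, P'.re12 z hz]
  have DE : ∀ z ∈ U, HasW E 0 0 z := by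
    intro z hz
    have := ((D0 z hz).mul (D2 z hz)).add ((HasW.const (-1) z).mul ((D1 z hz).mul (D1 z hz).conj))
    refine (this.congr (Eventually.of_forall fun w => ?_)).to ?_ ?_
    · simp only [hE]; ring
    · rw [R2 z hz]; ring
    · rw [map_mul, R0 z hz]; ring
  have ER : conj (E z0) = E z0 := by
    simp only [hE]
    rw [map_sub, map_mul, map_mul, R0 z0 hz0, R2 z0 hz0, Complex.conj_conj]; ring
  have a1 := P.pos z0 hz0
  have a2 := P'.pos z0 hz0
  have r1 := P.hre hz0
  have r2 := P'.hre hz0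
  have cp := P.cpos
  have cp' := P'.cpos
  have EP : 0 < (E z0).re := by
    refine pos_of_id (h := h z0 * k z0) (a := h z0 * k1 z0 - k z0 * h1 z0) (b := 1)
      (c := (c + c') * (h z0).re * (k z0).re + (h z0).re ^ 2 * c' + (k z0).re ^ 2 * c) ?_ ?_ ?_ ?_ ER
      (Or.inr one_ne_zero)
    · rw [map_mul, P.re0 z0 hz0, P'.re0 z0 hz0]
    · rw [← r1, ← r2, ← Complex.ofReal_mul, Complex.ofReal_re]; positivity
    · positivity
    · push_cast
      rw [r1, r2, map_one, ← P.cc z0 hz0, ← P'.cc z0 hz0]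
      simp only [hE, map_sub, map_mul, map_add, P.re0 z0 hz0, P'.re0 z0 hz0]
      ring
  refine ⟨(E z0).re, P.opn, D0, D1, D2, R0, R2, fun z hz => ?_, EP, fun z hz => ?_⟩
  · have := P.pos z hz; have := P'.pos z hz
    rw [Complex.add_re]; positivity
  · rw [Complex.conj_eq_iff_re.1 ER, ← HasW.eq_const P.opn hc DE hz hz0]
lemma Pot.smul {U : Set ℂ} {Q h h1 h12 : ℂ → ℂ} {c κ : ℝ} (P : Pot U Q h h1 h12 c) (hκ : 0 < κ) :
    Pot U Q (fun z => κ * h z) (fun z => κ * h1 z) (fun z => κ * h12 z) (κ ^ 2 * c) := by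
  have cp := P.cpos
  have M : ∀ {g : ℂ → ℂ} {a b z : ℂ}, HasW g a b z → HasW (fun z => κ * g z) (κ * a) (κ * b) z := by
    intro g a b z hg
    exact ((HasW.const κ z).mul hg).to (by ring) (by ring)
  refine ⟨P.opn, fun z hz => (M (P.d0 z hz)).to rfl ?_, fun z hz => (M (P.d1 z hz)).to ?_ rfl,
    fun z hz => (M (P.d2 z hz)).to ?_ ?_, fun z hz => ?_, fun z hz => ?_, fun z hz => ?_, by positivity,
    fun z hz => ?_⟩
  · rw [map_mul, Complex.conj_ofReal]
  · ring
  · rw [map_mul, Complex.conj_ofReal]; ring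
  · ring
  · rw [map_mul, Complex.conj_ofReal, P.re0 z hz]
  · rw [map_mul, Complex.conj_ofReal, P.re12 z hz]
  · have := P.pos z hz
    rw [Complex.re_ofReal_mul]; positivity
  · push_cast
    rw [map_mul, Complex.conj_ofReal, ← P.cc z hz]; ring
lemma Pot.lapl {U : Set ℂ} {Q h h1 h12 : ℂ → ℂ} {v : ℂ → ℝ} (P : Pot U Q h h1 h12 (1 / 8))
    (hv : ∀ z ∈ U, v z = -2 * Real.log (h z).re) {z : ℂ} (hz : z ∈ U) :
    lapl v z + Real.exp (v z) = 0 := by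
  have dH : ∀ w ∈ U, HasFDerivAt (fun z => (h z).re) (Complex.reCLM.comp (WL (h1 w) (conj (h1 w)))) w :=
    fun w hw => Complex.reCLM.hasFDerivAt.comp w (P.d0 w hw)
  have dv : ∀ w ∈ U, HasFDerivAt v ((-2 : ℝ) • ((h w).re⁻¹ • (Complex.reCLM.comp (WL (h1 w) (conj (h1 w)))))) w := by
    intro w hw
    refine (((dH w hw).log (P.pos w hw).ne').const_mul (-2)).congr_of_eventuallyEq ?_
    filter_upwards [P.opn.mem_nhds hw] with x hx; exact hv x hx
  have e1 : ∀ w ∈ U, fderiv ℝ v w 1 = -4 * ((h1 w).re * (h w).re⁻¹) := by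
    intro w hw; rw [(dv w hw).fderiv]; simp [WL_apply]; ring
  have e2 : ∀ w ∈ U, fderiv ℝ v w I = 4 * ((h1 w).im * (h w).re⁻¹) := by
    intro w hw; rw [(dv w hw).fderiv]; simp [WL_apply]; ring
  have h0 := (P.pos z hz).ne'
  have di : HasFDerivAt (fun z => (h z).re⁻¹) (-((h z).re ^ 2)⁻¹ • (Complex.reCLM.comp (WL (h1 z) (conj (h1 z))))) z :=
    (hasDerivAt_inv h0).comp_hasFDerivAt z (dH z hz)
  have dr : HasFDerivAt (fun z => (h1 z).re) (Complex.reCLM.comp (WL (Q z * h z) (h12 z))) z :=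
    Complex.reCLM.hasFDerivAt.comp z (P.d1 z hz)
  have dm : HasFDerivAt (fun z => (h1 z).im) (Complex.imCLM.comp (WL (Q z * h z) (h12 z))) z :=
    Complex.imCLM.hasFDerivAt.comp z (P.d1 z hz)
  have f1 := ((dr.mul di).const_mul (-4)).congr_of_eventuallyEq (f₁ := fun w => fderiv ℝ v w 1)
    (by filter_upwards [P.opn.mem_nhds hz] with x hx; exact e1 x hx)
  have f2 := ((dm.mul di).const_mul 4).congr_of_eventuallyEq (f₁ := fun w => fderiv ℝ v w I)
    (by filter_upwards [P.opn.mem_nhds hz] with x hx; exact e2 x hx)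
  have cc : (h z).re * (h12 z).re - ((h1 z).re ^ 2 + (h1 z).im ^ 2) = 1 / 8 := by
    have := congrArg Complex.re (P.cc z hz)
    have im0 : (h z).im = 0 := Complex.conj_eq_iff_im.1 (P.re0 z hz)
    simp [im0] at this
    linarith
  have ev : Real.exp (v z) = ((h z).re ^ 2)⁻¹ := by
    rw [hv z hz, show -2 * Real.log (h z).re = -(Real.log ((h z).re ^ 2)) by
      rw [Real.log_pow]; push_cast; ring, Real.exp_neg, Real.exp_log (by have := P.pos z hz; positivity)]
  rw [ev]
  unfold _root_.lapl
  rw [f1.fderiv, f2.fderiv]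
  simp [WL_apply]
  field_simp
  linarith
lemma devpot {U : Set ℂ} {Q h h1 h12 f : ℂ → ℂ} {c : ℝ} {L z : ℂ} (P : Pot U Q h h1 h12 c) (hz : z ∈ U)
    (hf : AnalyticAt ℂ f z) (hf1 : deriv f z ≠ 0)
    (he : ∀ᶠ w in 𝓝 z, h w ^ 2 * (deriv f w * conj (deriv f w)) = L * (1 + f w * conj (f w)) ^ 2) :
    (c : ℂ) = L ∧ 4 * Q z * deriv f z ^ 2 = 3 * deriv (deriv f) z ^ 2 - 2 * deriv f z * deriv (deriv (deriv f)) z := by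
  set F1 := deriv f with hF1
  set F2 := deriv F1 with hF2
  set F3 := deriv F2 with hF3
  have A : ∀ w, 1 + f w * conj (f w) ≠ 0 := by
    intro w h
    rw [Complex.mul_conj] at h
    have h2 : (1 + Complex.normSq (f w) : ℝ) = 0 := by exact_mod_cast h
    linarith [Complex.normSq_nonneg (f w)]
  have key : ∀ w, AnalyticAt ℂ f w → w ∈ U → F1 w ≠ 0 →
      (∀ᶠ w in 𝓝 w, h w ^ 2 * (F1 w * conj (F1 w)) = L * (1 + f w * conj (f w)) ^ 2) →
      2 * h1 w * F1 w * (1 + f w * conj (f w)) + h w * F2 w * (1 + f w * conj (f w)) -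
        2 * conj (f w) * F1 w ^ 2 * h w = 0 := by
    intro w hfw hw hF ev
    have D := hfw.differentiableAt.hasDerivAt.hasW
    have D1 := hfw.deriv.differentiableAt.hasDerivAt.hasW
    have H := P.d0 w hw
    have lhs := ((H.mul H).mul (D1.mul D1.conj))
    have AA := (HasW.const 1 w).add (D.mul D.conj)
    have rhs := ((HasW.const L w).mul (AA.mul AA)).congr (k := fun w => h w * h w * (F1 w * conj (F1 w)))
      (by filter_upwards [ev] with x hx; rw [← sq, ← sq]; exact hx)
    have e1 := (lhs.uniq rhs).1
    have e0 := ev.self_of_nhds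
    simp only [map_zero] at e1
    have hh := P.hne hw
    have hF' : conj (F1 w) ≠ 0 := (map_ne_zero _).2 hF
    refine (mul_eq_zero.1 (?_ : (h w * conj (F1 w)) * _ = 0)).resolve_left (mul_ne_zero hh hF')
    simp only [← hF1, ← hF2] at e1
    linear_combination (1 + f w * conj (f w)) * e1 - 2 * F1 w * conj (f w) * e0
  have E := (hf.eventually_analyticAt.and (P.opn.mem_nhds hz)).and
    ((hf.deriv.continuousAt.eventually_ne hf1).and he.eventually_nhds)
  have D := hf.differentiableAt.hasDerivAt.hasW
  have D1 := hf.deriv.differentiableAt.hasDerivAt.hasW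
  have D2 := hf.deriv.deriv.differentiableAt.hasDerivAt.hasW
  have AA := (HasW.const 1 z).add (D.mul D.conj)
  have H := P.d0 z hz
  have H1 := P.d1 z hz
  have big := ((((HasW.const 2 z).mul H1).mul D1).mul AA).add (((H.mul D2).mul AA).add
    ((((HasW.const (-2) z).mul D.conj).mul (D1.mul D1)).mul H))
  have nul := (HasW.const 0 z).congr (k := fun w => 2 * h1 w * F1 w * (1 + f w * conj (f w)) +
    (h w * F2 w * (1 + f w * conj (f w)) + -2 * conj (f w) * (F1 w * F1 w) * h w)) (by
      filter_upwards [E] with w hw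
      have := key w hw.1.1 hw.1.2 hw.2.1 hw.2.2
      linear_combination this)
  obtain ⟨e1, e2⟩ := big.uniq nul
  have e0 := key z hf hz hf1 he
  have e00 := he.self_of_nhds
  simp only [map_zero, ← hF1, ← hF2, ← hF3] at e1 e2
  have hh := P.hne hz
  have cc := P.cc z hz
  constructor
  · refine mul_right_cancel₀ (pow_ne_zero 2 (A z)) (mul_left_cancel₀ hf1 ?_)
    linear_combination (F1 z) * e00 + (1 + f z * conj (f z)) / 2 * (h z * e2 - conj (h1 z) * e0)
      - f z * conj (F1 z) * h z / 2 * e0 - (F1 z) * (1 + f z * conj (f z))^2 * cc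
  · refine mul_right_cancel₀ (A z) (mul_left_cancel₀ hh ?_)
    linear_combination 2 * F1 z * e1 - 3 * F2 z * e0
lemma poleL {φ φ1 φ2 q : ℂ → ℂ} {e : ℂ} (hm : MeromorphicAt φ 0)
    (hd : ∀ᶠ x in 𝓝[≠] (0:ℂ), HasDerivAt φ (φ1 x) x ∧ HasDerivAt φ1 (φ2 x) x ∧
      2 * φ x * φ2 x - φ1 x ^ 2 - 4 * (2 * e / x ^ 2 + q x) * φ x ^ 2 = -1) (hq : AnalyticAt ℂ q 0) :
    (e = 0 → AE φ 0) ∧ (e = 1 → ∃ a : ℂ, AE (fun x => φ x - a / x ^ 2) 0) := by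
  have fin : AE φ 0 → (e = 0 → AE φ 0) ∧ (e = 1 → ∃ a : ℂ, AE (fun x => φ x - a / x ^ 2) 0) := by
    intro h
    exact ⟨fun _ => h, fun _ => ⟨0, h.congr (Eventually.of_forall fun x => by simp)⟩⟩
  by_cases ht : meromorphicOrderAt φ 0 = ⊤
  · apply fin
    rw [meromorphicOrderAt_eq_top_iff] at ht
    exact (AE.const 0).congr ht
  obtain ⟨n, hn⟩ := WithTop.ne_top_iff_exists.1 ht
  obtain ⟨g, hg, hg0, hgφ⟩ := (meromorphicOrderAt_eq_int_iff hm).1 hn.symm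
  simp only [sub_zero, smul_eq_mul] at hgφ
  rcases le_or_gt 0 n with h0 | h0
  · apply fin
    obtain ⟨m, rfl⟩ := Int.eq_ofNat_of_zero_le h0
    exact ⟨fun x => x ^ m * g x, by fun_prop, by
      filter_upwards [hgφ] with x hx; simpa using hx⟩
  obtain ⟨m, rfl⟩ : ∃ m : ℕ, n = -(m : ℤ) := ⟨n.natAbs, by omega⟩
  have hm1 : 1 ≤ m := by omega
  set g1 := deriv g with hg1
  set g2 := deriv g1 with hg2
  have a1 : AnalyticAt ℂ g1 0 := hg.deriv
  have a2 : AnalyticAt ℂ g2 0 := a1.deriv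
  have B0 : ∀ᶠ x in 𝓝[≠] (0:ℂ), x ^ m * φ x = g x := by
    filter_upwards [hgφ, self_mem_nhdsWithin] with x hx hx0
    rw [hx, zpow_neg, zpow_natCast, mul_inv_cancel_left₀ (pow_ne_zero _ hx0)]
  have pw : ∀ x : ℂ, ∀ k : ℕ, HasDerivAt (fun x : ℂ => x ^ (k + 1)) ((k + 1) * x ^ k) x := by
    intro x k
    have := hasDerivAt_pow (k + 1) x
    simpa using this
  obtain ⟨k, rfl⟩ : ∃ k, m = k + 1 := ⟨m - 1, by omega⟩
  have B1 : ∀ᶠ x in 𝓝[≠] (0:ℂ), x ^ (k + 2) * φ1 x = x * g1 x - (k + 1) * g x := by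
    filter_upwards [pe_self B0, B0, hd, hg.eventually_analyticAt.filter_mono nhdsWithin_le_nhds] with x h1 h2 h3 h4
    have d := (pw x k).mul h3.1
    have d2 := h4.differentiableAt.hasDerivAt.congr_of_eventuallyEq h1
    have := d.unique d2
    rw [← hg1] at this
    rw [← h2]
    linear_combination x * this
  have B2 : ∀ᶠ x in 𝓝[≠] (0:ℂ), x ^ (k + 3) * φ2 x = x ^ 2 * g2 x - 2 * (k + 1) * x * g1 x +
      (k + 1) * (k + 2) * g x := by
    filter_upwards [pe_self B1, B1, hd, hg.eventually_analyticAt.filter_mono nhdsWithin_le_nhds] with x h1 h2 h3 h4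
    have d := (pw x (k + 1)).mul h3.2.1
    have d2 := (((hasDerivAt_id x).mul h4.deriv.differentiableAt.hasDerivAt).sub
      (h4.differentiableAt.hasDerivAt.const_mul ((k:ℂ) + 1))).congr_of_eventuallyEq (f₁ := fun x => x ^ (k + 2) * φ1 x) h1
    have := d.unique d2
    simp only [id, ← hg1, ← hg2] at this
    push_cast at this
    linear_combination x * this - (k + 2) * h2
  have B3 : ∀ᶠ x in 𝓝[≠] (0:ℂ), 2 * g x * (x ^ 2 * g2 x - 2 * (k + 1) * x * g1 x +
      (k + 1) * (k + 2) * g x) - (x * g1 x - (k + 1) * g x) ^ 2 - 4 * (2 * e + x ^ 2 * q x) * g x ^ 2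
      = - x ^ (2 * k + 4) := by
    filter_upwards [B0, B1, B2, hd, self_mem_nhdsWithin] with x h0 h1 h2 h3 hx0
    have h4 := h3.2.2
    have hx : x ≠ 0 := hx0
    rw [← h2, ← h1, ← h0]
    have e1 : 2 * e + x ^ 2 * q x = x ^ 2 * (2 * e / x ^ 2 + q x) := by field_simp
    rw [e1]
    linear_combination x ^ (2 * k + 4) * h4
  have c0 := pe_eq (g := fun x => 2 * g x * (x ^ 2 * g2 x - 2 * (k + 1) * x * g1 x +
      (k + 1) * (k + 2) * g x) - (x * g1 x - (k + 1) * g x) ^ 2 - 4 * (2 * e + x ^ 2 * q x) * g x ^ 2)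
    (k := fun x => - x ^ (2 * k + 4)) (AnalyticAt.continuousAt (𝕜 := ℂ) (by fun_prop)) (by fun_prop) B3
  simp at c0
  have c1 : ((k:ℂ) + 1) * (k + 3) = 8 * e := by
    have : g 0 ^ 2 * (((k:ℂ) + 1) * (k + 3) - 8 * e) = 0 := by linear_combination c0
    exact sub_eq_zero.1 ((mul_eq_zero.1 this).resolve_left (pow_ne_zero 2 hg0))
  constructor
  · intro he
    exfalso
    rw [he, mul_zero] at c1
    have : (((k + 1) * (k + 3) : ℕ) : ℂ) = 0 := by push_cast; exact c1
    norm_cast at this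
  · intro he
    rw [he] at c1
    have c2 : (k + 1) * (k + 3) = 8 := by
      have : (((k + 1) * (k + 3) : ℕ) : ℂ) = (8 : ℕ) := by push_cast; rw [c1]; ring
      exact_mod_cast this
    have hk : k = 1 := by
      have : k < 2 := by nlinarith
      interval_cases k <;> omega
    subst hk he
    have B4 : ∀ᶠ x in 𝓝[≠] (0:ℂ), -4 * g x * g1 x + x * (2 * g x * g2 x - g1 x ^ 2 - 4 * q x * g x ^ 2)
      = - x ^ 5 := by
      filter_upwards [B3, self_mem_nhdsWithin] with x h1 hx0
      have hx : x ≠ 0 := hx0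
      refine mul_left_cancel₀ hx ?_
      push_cast at h1
      linear_combination h1
    have c4 := pe_eq (g := fun x => -4 * g x * g1 x + x * (2 * g x * g2 x - g1 x ^ 2 - 4 * q x * g x ^ 2))
      (k := fun x => - x ^ 5) (AnalyticAt.continuousAt (𝕜 := ℂ) (by fun_prop)) (by fun_prop) B4
    simp [hg0] at c4
    obtain ⟨s, hs, hgs⟩ := an_taylor hg
    have hs0 : s 0 = 0 := by
      have d := ((hasDerivAt_id (0:ℂ)).mul hs.differentiableAt.hasDerivAt).const_add (g 0)
      have d2 := hg.differentiableAt.hasDerivAt.congr_of_eventuallyEq (Eventually.of_forall fun x => (hgs x).symm)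
      have := d.unique d2
      rw [← hg1, c4] at this
      simpa using this
    obtain ⟨t, ht, hst⟩ := an_taylor hs
    refine ⟨g 0, t, ht, ?_⟩
    filter_upwards [hgφ, self_mem_nhdsWithin] with x h1 hx0
    have hx : x ≠ 0 := hx0
    rw [h1, hgs x, hst x, hs0, zpow_neg, zpow_natCast]
    field_simp
    ring
lemma ev_neg {p : ℂ → Prop} {z w : ℂ} (h : ∀ᶠ x in 𝓝[≠] w, p x) (hw : w = -z) : ∀ᶠ x in 𝓝[≠] z, p (-x) := by
  subst hw
  have : Tendsto (fun x : ℂ => -x) (𝓝[≠] z) (𝓝[≠] (-z)) := by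
    refine tendsto_nhdsWithin_iff.2 ⟨?_, ?_⟩
    · exact (continuous_neg.tendsto z).mono_left nhdsWithin_le_nhds
    · filter_upwards [self_mem_nhdsWithin] with x hx
      simpa using hx
  exact this.eventually h
noncomputable def Ph (f : ℂ → ℂ) (z : ℂ) : ℂ := f z / deriv f z
lemma deriv_mul_per {f : ℂ → ℂ} {t l : ℂ} (h : ∀ z, f (z + t) = l * f z) (z : ℂ) :
    deriv f (z + t) = l * deriv f z := by
  have h1 : (fun z => f (z + t)) = fun z => l * f z := funext h
  have h2 := congrArg (fun g => deriv g z) h1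
  simp only [deriv_comp_add_const, deriv_const_mul_field] at h2
  exact h2
lemma Ph_per {f : ℂ → ℂ} {t l : ℂ} (hl : l ≠ 0) (h : ∀ z, f (z + t) = l * f z) (z : ℂ) :
    Ph f (z + t) = Ph f z := by
  rw [Ph, Ph, h, deriv_mul_per h, mul_div_mul_left _ _ hl]
section
variable {b : ℝ} {w B : ℂ} {Q f : ℂ → ℂ}
lemma Ph_ode {x : ℂ} (ha : AnalyticAt ℂ f x) (h0 : deriv f x ≠ 0)
    (hid : 4 * Q x * deriv f x ^ 2 = 3 * deriv (deriv f) x ^ 2 - 2 * deriv f x * deriv (deriv (deriv f)) x) :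
    HasDerivAt (Ph f) (1 - f x * deriv (deriv f) x / deriv f x ^ 2) x ∧
    HasDerivAt (fun x => 1 - f x * deriv (deriv f) x / deriv f x ^ 2)
      (-(((deriv f x * deriv (deriv f) x + f x * deriv (deriv (deriv f)) x) * deriv f x ^ 2 -
        f x * deriv (deriv f) x * (2 * deriv f x * deriv (deriv f) x)) / (deriv f x ^ 2) ^ 2)) x ∧
    2 * Ph f x * (-(((deriv f x * deriv (deriv f) x + f x * deriv (deriv (deriv f)) x) * deriv f x ^ 2 -
        f x * deriv (deriv f) x * (2 * deriv f x * deriv (deriv f) x)) / (deriv f x ^ 2) ^ 2))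
      - (1 - f x * deriv (deriv f) x / deriv f x ^ 2) ^ 2 - 4 * Q x * Ph f x ^ 2 = -1 := by
  have d0 := ha.differentiableAt.hasDerivAt
  have d1 := ha.deriv.differentiableAt.hasDerivAt
  have d2 := ha.deriv.deriv.differentiableAt.hasDerivAt
  refine ⟨?_, ?_, ?_⟩
  · refine (d0.div d1 h0).congr_deriv ?_
    field_simp
  · refine (((d0.mul d2).div (d1.pow 2) (pow_ne_zero 2 h0)).const_sub 1).congr_deriv ?_
    simp
  · have hq : 4 * Q x = (3 * deriv (deriv f) x ^ 2 - 2 * deriv f x * deriv (deriv (deriv f)) x) / deriv f x ^ 2 := by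
      rw [eq_div_iff (pow_ne_zero 2 h0), hid]
    rw [hq, Ph]
    field_simp
    ring
lemma Ph_loc (hfm : ∀ z, MeromorphicAt f z)
    (hG : ∀ z, ∀ᶠ x in 𝓝[≠] z, AnalyticAt ℂ f x ∧ deriv f x ≠ 0)
    (hb : 0 < b) (hid : ∀ x, AnalyticAt ℂ f x → deriv f x ≠ 0 → x ∉ SS b w →
      4 * Q x * deriv f x ^ 2 = 3 * deriv (deriv f) x ^ 2 - 2 * deriv f x * deriv (deriv (deriv f)) x)
    {p e : ℂ} {q : ℂ → ℂ} (hq : AnalyticAt ℂ q 0) (hQq : ∀ᶠ x in 𝓝[≠] (0:ℂ), Q (x + p) = 2 * e / x ^ 2 + q x) :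
    (e = 0 → AE (Ph f) p) ∧ (e = 1 → ∃ a : ℂ, AE (fun x => Ph f x - a / (x - p) ^ 2) p) := by
  have hm : MeromorphicAt (Ph f) p := (hfm p).div (hfm p).deriv
  have hm' : MeromorphicAt (fun x => Ph f (x + p)) 0 := by
    have : MeromorphicAt (Ph f) (0 + p) := by rwa [zero_add]
    exact MeromorphicAt.comp_analyticAt (f := Ph f) (g := fun x => x + p) this (by fun_prop)
  have hev := (hG p).and (SS_ev hb w p)
  have hev2 := ev_shift (z := 0) (t := p) hev (by simp)
  obtain ⟨r1, r2⟩ := poleL (φ := fun x => Ph f (x + p))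
    (φ1 := fun x => 1 - f (x + p) * deriv (deriv f) (x + p) / deriv f (x + p) ^ 2)
    (φ2 := fun x => (-(((deriv f (x + p) * deriv (deriv f) (x + p) + f (x + p) * deriv (deriv (deriv f)) (x + p)) * deriv f (x + p) ^ 2 -
        f (x + p) * deriv (deriv f) (x + p) * (2 * deriv f (x + p) * deriv (deriv f) (x + p))) / (deriv f (x + p) ^ 2) ^ 2)))
    hm' (e := e) (q := q) (by
      filter_upwards [hev2, hQq] with x hx hQx
      obtain ⟨d1, d2, d3⟩ := Ph_ode hx.1.1 hx.1.2 (hid _ hx.1.1 hx.1.2 hx.2)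
      rw [hQx] at d3
      exact ⟨d1.comp_add_const x p, d2.comp_add_const x p, d3⟩) hq
  constructor
  · intro he
    refine ((r1 he).shift (t := -p) (z := p) (by ring)).congr (Eventually.of_forall fun x => ?_)
    simp
  · intro he
    obtain ⟨a, ha⟩ := r2 he
    refine ⟨a, (ha.shift (t := -p) (z := p) (by ring)).congr (Eventually.of_forall fun x => ?_)⟩
    simp [sub_eq_add_neg]
lemma Ph_even (hfm : ∀ z, MeromorphicAt f z)
    (hG : ∀ z, ∀ᶠ x in 𝓝[≠] z, AnalyticAt ℂ f x ∧ deriv f x ≠ 0)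
    (hb : 0 < b) (hw : w ∉ LL b) (h2 : 2 * w ∈ LL b) (hid : ∀ x, AnalyticAt ℂ f x → deriv f x ≠ 0 → x ∉ SS b w →
      4 * Q x * deriv f x ^ 2 = 3 * deriv (deriv f) x ^ 2 - 2 * deriv f x * deriv (deriv (deriv f)) x)
    (hQ : ∀ z ∉ SS b w, Q z = 2 * (Pc b z + Pc b (z - w)) + B)
    (hp1 : ∀ z, Ph f (z + 1) = Ph f z) (hp2 : ∀ z, Ph f (z + I * b) = Ph f z) (z : ℂ) :
    ∀ᶠ x in 𝓝[≠] z, Ph f x = Ph f (-x) := by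
  obtain ⟨k, hk, -, hP⟩ := Zc_zero2 hb
  have hk1 := hk.deriv
  have hwn : -w ∉ LL b := by rwa [LL_negi]
  have A0 : ∃ a : ℂ, AE (fun x => Ph f x - a / (x - 0) ^ 2) 0 := by
    refine (Ph_loc hfm hG hb hid (p := 0) (e := 1)
      (q := fun x => -2 * (k x + x * deriv k x) + 2 * Pc b (x - w) + B) ?_ ?_).2 rfl
    · have : AnalyticAt ℂ (fun x => Pc b (x - w)) 0 :=
        AnalyticAt.comp' (f := fun x => x - w) (g := Pc b) (by simpa using Pc_an hb hwn) (by fun_prop)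
      fun_prop
    · filter_upwards [hP, SS_ev hb w 0] with x h1 h2
      rw [add_zero, hQ x h2, h1]; ring
  have Aw : ∃ a : ℂ, AE (fun x => Ph f x - a / (x - w) ^ 2) w := by
    refine (Ph_loc hfm hG hb hid (p := w) (e := 1)
      (q := fun x => -2 * (k x + x * deriv k x) + 2 * Pc b (x + w) + B) ?_ ?_).2 rfl
    · have : AnalyticAt ℂ (fun x => Pc b (x + w)) 0 :=
        AnalyticAt.comp' (f := fun x => x + w) (g := Pc b) (by simpa using Pc_an hb hw) (by fun_prop)
      fun_prop
    · filter_upwards [hP, ev_shift (z := 0) (t := w) (SS_ev hb w w) (by simp)] with x h1 h2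
      rw [hQ _ h2, add_sub_cancel_right, h1]; ring
  have Az : ∀ z, z ∉ SS b w → AE (Ph f) z := by
    intro z hz
    obtain ⟨z1, z2⟩ := SS_iff.1 hz
    refine (Ph_loc hfm hG hb hid (p := z) (e := 0)
      (q := fun x => 2 * (Pc b (x + z) + Pc b (x + z - w)) + B) ?_ ?_).1 rfl
    · have t1 : AnalyticAt ℂ (fun x => Pc b (x + z)) 0 :=
        AnalyticAt.comp' (f := fun x => x + z) (g := Pc b) (by simpa using Pc_an hb z1) (by fun_prop)
      have t2 : AnalyticAt ℂ (fun x => Pc b (x + z - w)) 0 :=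
        AnalyticAt.comp' (f := fun x => x + z - w) (g := Pc b) (by simpa using Pc_an hb z2) (by fun_prop)
      fun_prop
    · filter_upwards [ev_shift (z := 0) (t := z) (SS_ev hb w z) (by simp)] with x h2
      rw [hQ _ h2]; simp
  have per := fun l (hl : l ∈ LL b) z => per_LL (h := Ph f) hp1 hp2 hl z
  set D : ℂ → ℂ := fun x => Ph f x - Ph f (-x) with hD
  have D0 : AE D 0 := by
    obtain ⟨a, ha⟩ := A0
    refine (ha.sub (ha.refl (c := 0) (z := 0) (by simp))).congr (Eventually.of_forall fun x => ?_)
    simp [hD]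
  have Dw : AE D w := by
    obtain ⟨a, ha⟩ := Aw
    refine (ha.sub (ha.refl (c := 2 * w) (z := w) (by ring))).congr (Eventually.of_forall fun x => ?_)
    simp only [hD]
    rw [show 2 * w - x = -x + 2 * w by ring, per _ h2, show -x + 2 * w - w = -(x - w) by ring, neg_sq]; ring
  obtain ⟨d, hd⟩ := E0 (F := D) hb (cases2 (q := w) D0 Dw fun z h1 h3 => by
      have hz : z ∉ SS b w := SS_iff.2 ⟨h1, h3⟩
      refine ((Az z hz).sub ((Az (-z) (by rwa [SS_neg h2])).refl (c := 0) (z := z) (by ring))).congr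
        (Eventually.of_forall fun x => ?_)
      simp [hD])
    (fun z => Eventually.of_forall fun x => by
      simp only [hD]
      rw [hp1, ← per _ (LL_one b) (-(x + 1))]; ring_nf)
    (fun z => Eventually.of_forall fun x => by
      simp only [hD]
      rw [hp2, ← per _ (LL_ib b) (-(x + I * b))]; ring_nf)
  have hd0 : d = 0 := by
    obtain ⟨x, h1, h3⟩ := ((hd 0).and (ev_neg (z := 0) (hd 0) (by simp))).exists
    simp only [hD, neg_neg] at h1 h3
    linear_combination -(1/2) * h1 - (1/2) * h3
  filter_upwards [hd z] with x hx
  rw [hd0] at hx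
  exact sub_eq_zero.1 hx
end
lemma path_compl {T : Set ℂ} (hT : T.Countable) : IsPathConnected Tᶜ :=
  hT.isPathConnected_compl_of_one_lt_rank (by
    rw [Complex.rank_real_complex]; exact_mod_cast Nat.one_lt_two)
lemma count_of_ev {T : Set ℂ} (h : ∀ z, ∀ᶠ x in 𝓝[≠] z, x ∉ T) : T.Countable := by
  obtain ⟨s, hs, hc⟩ := TopologicalSpace.countable_cover_nhds (f := fun z => {y : ℂ | y ≠ z → y ∉ T})
    (fun z => by have := h z; rw [eventually_nhdsWithin_iff] at this; exact this)
  refine hs.mono fun y hy => ?_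
  have : y ∈ ⋃ x ∈ s, {y : ℂ | y ≠ x → y ∉ T} := by rw [hc]; trivial
  simp only [mem_iUnion, mem_setOf_eq] at this
  obtain ⟨x, hx, hxy⟩ := this
  by_cases e : y = x
  · rw [e]; exact hx
  · exact absurd hy (hxy e)
lemma good_ev {f : ℂ → ℂ} (hfm : ∀ z, MeromorphicAt f z) {z0 : ℂ} (h0 : AnalyticAt ℂ f z0) (h1 : deriv f z0 ≠ 0)
    (z : ℂ) : ∀ᶠ x in 𝓝[≠] z, AnalyticAt ℂ f x ∧ deriv f x ≠ 0 := by
  have hm : MeromorphicOn (deriv f) univ := fun z _ => (hfm z).deriv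
  have t0 : meromorphicOrderAt (deriv f) z0 ≠ ⊤ := by
    rw [meromorphicOrderAt_ne_top_iff_eventually_ne_zero (hfm z0).deriv]
    exact (h0.deriv.continuousAt.eventually_ne h1).filter_mono nhdsWithin_le_nhds
  have t1 := hm.meromorphicOrderAt_ne_top_of_isPreconnected isPreconnected_univ (mem_univ z0) (mem_univ z) t0
  rw [meromorphicOrderAt_ne_top_iff_eventually_ne_zero (hfm z).deriv] at t1
  exact (hfm z).eventually_analyticAt.and t1
def G4 (f : ℂ → ℂ) : Set ℂ := {x | (AnalyticAt ℂ f x ∧ deriv f x ≠ 0) ∧ (AnalyticAt ℂ f (-x) ∧ deriv f (-x) ≠ 0)}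
lemma ff_const {f : ℂ → ℂ} (hG : ∀ z, ∀ᶠ x in 𝓝[≠] z, AnalyticAt ℂ f x ∧ deriv f x ≠ 0)
    (hP : ∀ z, ∀ᶠ x in 𝓝[≠] z, Ph f x = Ph f (-x)) :
    (∀ x ∈ G4 f, Ph f x = Ph f (-x)) ∧ ∃ c : ℂ, c ≠ 0 ∧ ∀ x ∈ G4 f, f x * f (-x) = c := by
  have hop : IsOpen (G4 f) := by
    have o1 : IsOpen {x | AnalyticAt ℂ f x ∧ deriv f x ≠ 0} := by
      rw [isOpen_iff_mem_nhds]
      rintro x ⟨h1, h2⟩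
      exact h1.eventually_analyticAt.and (h1.deriv.continuousAt.eventually_ne h2)
    exact o1.inter (o1.preimage continuous_neg)
  have hev : ∀ z, ∀ᶠ x in 𝓝[≠] z, x ∈ G4 f := fun z => (hG z).and (ev_neg (hG (-z)) rfl)
  have hpc : IsPathConnected (G4 f) := by
    have := path_compl (T := (G4 f)ᶜ) (count_of_ev fun z => by
      filter_upwards [hev z] with x hx; simpa using hx)
    rwa [compl_compl] at this
  have hPh : ∀ x ∈ G4 f, Ph f x = Ph f (-x) := by
    rintro x ⟨⟨a1, a2⟩, ⟨b1, b2⟩⟩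
    refine pe_eq (g := Ph f) (k := fun x => Ph f (-x)) ?_ ?_ (hP x)
    · exact a1.continuousAt.div a1.deriv.continuousAt a2
    · have : ContinuousAt (Ph f) (-x) := b1.continuousAt.div b1.deriv.continuousAt b2
      exact ContinuousAt.comp (f := fun x => -x) this continuous_neg.continuousAt
  refine ⟨hPh, ?_⟩
  obtain ⟨z0, hz0⟩ := hpc.nonempty
  have D : ∀ x ∈ G4 f, HasW (fun x => f x * f (-x)) 0 0 x := by
    intro x hx
    have e := hPh x hx
    obtain ⟨⟨a1, a2⟩, ⟨b1, b2⟩⟩ := hx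
    have d2 : HasDerivAt (fun x => f (-x)) (-deriv f (-x)) x := by
      exact (b1.differentiableAt.hasDerivAt.comp x (hasDerivAt_neg x)).congr_deriv (by ring)
    refine (a1.differentiableAt.hasDerivAt.mul d2).hasW.to ?_ rfl
    rw [Ph, Ph, div_eq_div_iff a2 b2] at e
    linear_combination -e
  refine ⟨f z0 * f (-z0), ?_, fun x hx => HasW.eq_const hop hpc.isConnected.isPreconnected D hx hz0⟩
  intro h0
  have z : ∀ x ∈ G4 f, f x = 0 := by
    intro x hx
    have e := hPh x hx
    have e2 := HasW.eq_const hop hpc.isConnected.isPreconnected D hx hz0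
    rw [h0] at e2
    rcases mul_eq_zero.1 e2 with h | h
    · exact h
    · rw [Ph, Ph, h, zero_div] at e
      exact (div_eq_zero_iff.1 e).resolve_right hx.1.2
  have : f =ᶠ[𝓝 z0] fun _ => 0 := by filter_upwards [hop.mem_nhds hz0] with x hx; exact z x hx
  apply hz0.1.2
  rw [this.deriv_eq]; simp
lemma blo_sum {h : ℂ → ℂ} {p : ℂ} {κ : ℝ} (hκ : 0 < κ) (h1 : Blo h p) (h2 : Blo h (-p)) :
    Blo (fun z => κ * (h z + h (-z))) p := by
  obtain ⟨e1, A1, B1, he1, hA1, k1⟩ := h1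
  obtain ⟨e2, A2, B2, he2, hA2, k2⟩ := h2
  refine ⟨min e1 e2, κ * (A1 + A2), κ * (B1 + B2), lt_min he1 he2, by positivity, fun x hx hxe => ?_⟩
  have a := k1 x hx (hxe.trans_le (min_le_left _ _))
  have c := k2 (-x) (neg_ne_zero.2 hx) (by rw [norm_neg]; exact hxe.trans_le (min_le_right _ _))
  rw [norm_neg, ← neg_add] at c
  simp only [Complex.re_ofReal_mul, Complex.add_re, mul_div_assoc, add_div]
  exact ⟨mul_le_mul_of_nonneg_left (add_le_add a.1 c.1) hκ.le,
    mul_le_mul_of_nonneg_left (add_le_add a.2 c.2) hκ.le⟩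
noncomputable def vs (u : ℂ → ℝ) (κ : ℝ) (z : ℂ) : ℝ :=
  -2 * Real.log (κ * (Real.exp (-(u z) / 2) + Real.exp (-(u (-z)) / 2)))
lemma hu_vs {u : ℂ → ℝ} {κ : ℝ} (hκ : 0 < κ) : hu (vs u κ) = fun z => κ * (hu u z + hu u (-z)) := by
  funext z
  simp only [hu, vs]
  rw [show -(-2 * Real.log (κ * (Real.exp (-(u z) / 2) + Real.exp (-(u (-z)) / 2)))) / 2 =
    Real.log (κ * (Real.exp (-(u z) / 2) + Real.exp (-(u (-z)) / 2))) by ring, Real.exp_log (by positivity)]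
  push_cast; ring
lemma evsol {b : ℝ} (hb : 0 < b) {u : ℂ → ℝ} {w B : ℂ} {Q h1 h12 : ℂ → ℂ} (h2 : 2 * w ∈ LL b)
    (hwk : w = per (I * b) 3 / 2)
    (hs : IsCurvatureSolution (I * b) (starM 3) u)
    (P : Pot (SS b w)ᶜ Q (hu u) h1 h12 (1 / 8)) (hBl : ∀ p ∈ SS b w, Blo (hu u) p)
    (hQ : ∀ z ∉ SS b w, Q z = 2 * (Pc b z + Pc b (z - w)) + B) :
    ∃ κ : ℝ, 0 < κ ∧ IsCurvatureSolution (I * b) (starM 3) (vs u κ) ∧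
      ∃ k1 k12 : ℂ → ℂ, Pot (SS b w)ᶜ Q (hu (vs u κ)) k1 k12 (1 / 8) := by
  have hev : ∀ z ∈ (SS b w)ᶜ, Q z = (-1) ^ 2 * Q (-1 * z + 0) := by
    intro z hz
    have hz' : -z ∉ SS b w := fun h => hz ((SS_neg h2).1 h)
    rw [show (-1 : ℂ) * z + 0 = -z by ring, hQ z hz, hQ (-z) hz', Pc_neg hb,
      show -z - w = -(z - w + 2 * w) by ring, Pc_neg hb, Pc_LL hb h2 (SS_iff.1 hz).2]
    ring
  have P' := (P.aff P.opn (a := -1) (by norm_num) 0 (fun z hz => by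
    rw [show (-1 : ℂ) * z + 0 = -z by ring]
    exact fun h => hz ((SS_neg h2).1 h))).congrQ hev
  have pc := path_compl (SS_countable b w)
  obtain ⟨C, PC⟩ := P.addp P' pc.isConnected.isPreconnected pc.nonempty
  have hC := PC.cpos
  set κ := Real.sqrt (1 / (8 * C)) with hκd
  have hκ : 0 < κ := Real.sqrt_pos.2 (by positivity)
  have hκ2 : κ ^ 2 * C = 1 / 8 := by
    rw [hκd, Real.sq_sqrt (by positivity)]; field_simp
  have PK := PC.smul hκ
  rw [hκ2] at PK
  have e0 : (fun z : ℂ => (κ : ℂ) * (hu u z + hu u (-1 * z + 0))) = hu (vs u κ) := by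
    rw [hu_vs hκ]; funext z; rw [show (-1 : ℂ) * z + 0 = -z by ring]
  rw [e0] at PK
  refine ⟨κ, hκ, ⟨?_, ?_, ?_, ?_⟩, _, _, PK⟩
  · intro z
    have : u (-(z + 1)) = u (-z) := by rw [← hs.1 (-(z + 1))]; congr 1; ring
    simp only [vs, this, hs.1]
  · intro z
    have : u (-(z + I * b)) = u (-z) := by rw [← hs.2.1 (-(z + I * b))]; congr 1; ring
    simp only [vs, this, hs.2.1]
  · rw [sing_eq (Or.inr (Or.inr rfl)), ← hwk]
    intro z hz
    refine ⟨fun n => ?_, PK.lapl (fun x _ => ?_) hz⟩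
    · have a := hs.2.2.1
      rw [sing_eq (Or.inr (Or.inr rfl)), ← hwk] at a
      have c1 := (a z hz).1 n
      have c2 := (a (-z) (fun h => hz ((SS_neg h2).1 h))).1 n
      have c3 : ContDiffAt ℝ n (fun z => u (-z)) z := ContDiffAt.comp z c2 contDiff_neg.contDiffAt
      have c4 : ContDiffAt ℝ n (fun z => κ * (Real.exp (-(u z) / 2) + Real.exp (-(u (-z)) / 2))) z :=
        contDiffAt_const.mul (((c1.neg.div_const 2).exp).add ((c3.neg.div_const 2).exp))
      exact contDiffAt_const.mul (c4.log (by positivity))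
    · simp only [hu, Complex.ofReal_re, Real.log_exp]; ring
  · intro k hk l hl
    have hp : per (I * b) (k : ℕ) / 2 + l ∈ SS b w := by
      rw [hwk, ← sing_eq (Or.inr (Or.inr rfl))]
      exact ⟨k, hk, l, hl, rfl⟩
    have m1 : starM 3 k = 1 := by
      simp only [starM] at hk ⊢
      split_ifs with h
      · rfl
      · rw [if_neg h] at hk; omega
    rw [m1, Nat.cast_one, mul_one]
    refine of_blo ?_
    rw [hu_vs hκ]
    exact blo_sum hκ (hBl _ hp) (hBl _ ((SS_neg h2).2 hp))
lemma dev_iff {u n F : ℝ} (hn : 0 < n) :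
    u = Real.log (8 * n ^ 2 / (1 + F ^ 2) ^ 2) ↔ Real.exp (-u / 2) ^ 2 * n ^ 2 = 1 / 8 * (1 + F ^ 2) ^ 2 := by
  have e : Real.exp (-u / 2) ^ 2 = (Real.exp u)⁻¹ := by
    rw [← Real.exp_nat_mul, ← Real.exp_neg]; congr 1; push_cast; ring
  have hp : 0 < Real.exp u := Real.exp_pos u
  rw [e]
  constructor
  · intro h
    rw [h, Real.exp_log (by positivity)]
    field_simp
  · intro h
    have : Real.exp u = 8 * n ^ 2 / (1 + F ^ 2) ^ 2 := by
      field_simp at h ⊢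
      linarith
    rw [← this, Real.log_exp]
lemma dev_C {r L n F : ℝ} {f f1 : ℂ} (hn : n = ‖f1‖) (hF : F = ‖f‖) :
    (r : ℂ) ^ 2 * (f1 * conj f1) = (L : ℂ) * (1 + f * conj f) ^ 2 ↔ r ^ 2 * n ^ 2 = L * (1 + F ^ 2) ^ 2 := by
  rw [Complex.mul_conj', Complex.mul_conj', ← hn, ← hF]
  exact_mod_cast Iff.rfl
lemma sym_alg {a a' n n' F F' c κ : ℝ} (ha : 0 < a) (ha' : 0 < a') (hn : 0 < n) (hn' : 0 < n') (hF : 0 < F)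
    (hc : 0 < c) (h1 : a ^ 2 * n ^ 2 = 1 / 8 * (1 + F ^ 2) ^ 2) (h2 : a' ^ 2 * n' ^ 2 = 1 / 8 * (1 + F' ^ 2) ^ 2)
    (hf : F * F' = c) (hP : F * n' = F' * n) :
    (κ * (a + a')) ^ 2 * (n ^ 2 / c) = κ ^ 2 * (1 + c) ^ 2 / (8 * c) * (1 + F ^ 2 / c) ^ 2 := by
  have s8 : Real.sqrt 8 ^ 2 = 8 := Real.sq_sqrt (by norm_num)
  have s0 : 0 < Real.sqrt 8 := Real.sqrt_pos.2 (by norm_num)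
  set s := Real.sqrt 8
  have k1 : s * (a * n) = 1 + F ^ 2 := by
    refine (pow_left_inj₀ (by positivity) (by positivity) two_ne_zero).1 ?_
    rw [mul_pow, s8, mul_pow, h1]; ring
  have k2 : s * (a' * n') = 1 + F' ^ 2 := by
    refine (pow_left_inj₀ (by positivity) (by positivity) two_ne_zero).1 ?_
    rw [mul_pow, s8, mul_pow, h2]; ring
  have hF' : F' = c / F := by rw [← hf]; field_simp
  have hn2 : n' = c * n / F ^ 2 := by
    rw [hF'] at hP; field_simp at hP ⊢; linarith
  have k3 : s * (a' * n) * c = F ^ 2 + c ^ 2 := by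
    rw [hn2, hF'] at k2; field_simp at k2; linarith
  have k4 : s * ((a + a') * n) * c = (1 + c) * (c + F ^ 2) := by linear_combination c * k1 + k3
  have k5 : 8 * ((a + a') * n) ^ 2 * c ^ 2 = ((1 + c) * (c + F ^ 2)) ^ 2 := by rw [← k4, ← s8]; ring
  field_simp
  linear_combination κ ^ 2 * k5
lemma no_good_sing {u : ℂ → ℝ} {f : ℂ → ℂ} {z : ℂ} (hd : ∀ z : ℂ, AnalyticAt ℂ f z → deriv f z ≠ 0 →
    Real.exp (-(u z) / 2) ^ 2 * ‖deriv f z‖ ^ 2 = 1 / 8 * (1 + ‖f z‖ ^ 2) ^ 2)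
    (ha : AnalyticAt ℂ f z) (h1 : deriv f z ≠ 0) (hB : Blo (hu u) z) : False := by
  obtain ⟨e, A, A', he, hA, hB⟩ := hB
  have hev : ∀ᶠ x in 𝓝[≠] z, A ^ 2 * ‖deriv f x‖ ^ 2 ≤ ‖x - z‖ ^ 4 * (1 / 8 * (1 + ‖f x‖ ^ 2) ^ 2) := by
    have t1 := (ha.eventually_analyticAt.and (ha.deriv.continuousAt.eventually_ne h1)).filter_mono
      (nhdsWithin_le_nhds (s := {z}ᶜ))
    have t2 : ∀ᶠ x in 𝓝[≠] z, dist x z < e := nhdsWithin_le_nhds (ball_mem_nhds z he)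
    filter_upwards [t1, t2, self_mem_nhdsWithin] with x ⟨x1, x2⟩ x3 x4
    have x5 : x - z ≠ 0 := sub_ne_zero.2 x4
    have a := (hB (x - z) x5 (by rwa [← dist_eq_norm])).1
    rw [sub_add_cancel, hu, Complex.ofReal_re, div_le_iff₀ (by positivity)] at a
    rw [← hd x x1 x2]
    calc A ^ 2 * ‖deriv f x‖ ^ 2 ≤ (Real.exp (-(u x) / 2) * ‖x - z‖ ^ 2) ^ 2 * ‖deriv f x‖ ^ 2 := by
          gcongr
      _ = _ := by ring
  have c1 : Tendsto (fun x => A ^ 2 * ‖deriv f x‖ ^ 2) (𝓝[≠] z) (𝓝 (A ^ 2 * ‖deriv f z‖ ^ 2)) :=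
    (continuousAt_const.mul (ha.deriv.continuousAt.norm.pow 2)).mono_left nhdsWithin_le_nhds
  have c2 : Tendsto (fun x => ‖x - z‖ ^ 4 * (1 / 8 * (1 + ‖f x‖ ^ 2) ^ 2)) (𝓝[≠] z)
      (𝓝 (‖z - z‖ ^ 4 * (1 / 8 * (1 + ‖f z‖ ^ 2) ^ 2))) := by
    refine Tendsto.mono_left (ContinuousAt.tendsto (f := fun x => ‖x - z‖ ^ 4 * (1 / 8 * (1 + ‖f x‖ ^ 2) ^ 2)) ?_) nhdsWithin_le_nhds
    have := ha.continuousAt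
    fun_prop
  have := le_of_tendsto_of_tendsto c1 c2 hev
  rw [sub_self, norm_zero] at this
  have : 0 < A ^ 2 * ‖deriv f z‖ ^ 2 := by positivity
  norm_num at *
  linarith
lemma case3 {b : ℝ} (hb : 0 < b) : ¬ HasNonEvenFamily (I * (b : ℂ)) (starM 3) := by
  rintro ⟨u, f, hs, hd, ht, hne⟩
  apply hne
  obtain ⟨w, hwk⟩ : ∃ w, w = per (I * b) 3 / 2 := ⟨_, rfl⟩
  have hw : w ∉ LL b := by
    have := half_not hb (m := 1) (n := 1) (Or.inl (by decide))
    rw [hwk]; simpa [per] using this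
  have h2 : 2 * w ∈ LL b := by
    rw [hwk, mul_div_cancel₀ _ (two_ne_zero)]
    exact LL_add (LL_one b) (LL_ib b)
  obtain ⟨Q, h1, h12, B, P, q1, q2, hBl, hQ⟩ := sol_main (Or.inr (Or.inr rfl)) hb hw h2 hwk hs
  obtain ⟨κ, hκ, hv, k1, k12, PV⟩ := evsol hb h2 hwk hs P hBl hQ
  have hve : ∀ z, vs u κ (-z) = vs u κ z := fun z => by simp only [vs, neg_neg, add_comm]
  by_cases hex : ∃ z0, AnalyticAt ℂ f z0 ∧ deriv f z0 ≠ 0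
  swap
  · refine ⟨0, vs u κ, hv, ?_, hve⟩
    have : (fun z => ((Real.exp 0 : ℝ) : ℂ) * f z) = f := by funext z; simp
    rw [this]
    exact ⟨hd.1, fun z z1 z2 => absurd ⟨z, z1, z2⟩ hex⟩
  obtain ⟨z0, a0, a1⟩ := hex
  have hG := good_ev hd.1 a0 a1
  have hd2 : ∀ z : ℂ, AnalyticAt ℂ f z → deriv f z ≠ 0 →
      Real.exp (-(u z) / 2) ^ 2 * ‖deriv f z‖ ^ 2 = 1 / 8 * (1 + ‖f z‖ ^ 2) ^ 2 := fun z z1 z2 =>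
    (dev_iff (norm_pos_iff.2 z2)).1 (hd.2 z z1 z2)
  have hid : ∀ x, AnalyticAt ℂ f x → deriv f x ≠ 0 → x ∉ SS b w →
      4 * Q x * deriv f x ^ 2 = 3 * deriv (deriv f) x ^ 2 - 2 * deriv f x * deriv (deriv (deriv f)) x := by
    intro x x1 x2 x3
    refine (devpot (L := ((1 / 8 : ℝ) : ℂ)) P x3 x1 x2 ?_).2
    filter_upwards [x1.eventually_analyticAt, x1.deriv.continuousAt.eventually_ne x2] with y y1 y2
    exact (dev_C rfl rfl).2 (hd2 y y1 y2)
  obtain ⟨t1, t2, ht1, ht2⟩ := ht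
  have hPe := Ph_even hd.1 hG hb hw h2 hid hQ (Ph_per (Complex.exp_ne_zero _) ht1) (Ph_per (Complex.exp_ne_zero _) ht2)
  obtain ⟨hPh, c, hc, hfc⟩ := ff_const hG hPe
  have hcp : 0 < ‖c‖ := norm_pos_iff.2 hc
  set β := -Real.log ‖c‖ / 2 with hβ
  have hE : Real.exp β ^ 2 = 1 / ‖c‖ := by
    rw [← Real.exp_nat_mul, hβ, show ((2 : ℕ) : ℝ) * (-Real.log ‖c‖ / 2) = -Real.log ‖c‖ by push_cast; ring,
      Real.exp_neg, Real.exp_log hcp, one_div]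
  have hE0 := Real.exp_pos β
  have hdg : deriv (fun z => (Real.exp β : ℂ) * f z) = fun z => (Real.exp β : ℂ) * deriv f z := by
    funext z; exact deriv_const_mul_field _
  have ng : ∀ x : ℂ, ‖(Real.exp β : ℂ) * x‖ = Real.exp β * ‖x‖ := fun x => by
    rw [norm_mul, Complex.norm_real, Real.norm_of_nonneg hE0.le]
  obtain ⟨L, hL⟩ : ∃ L : ℝ, L = κ ^ 2 * (1 + ‖c‖) ^ 2 / (8 * ‖c‖) := ⟨_, rfl⟩
  have hR : ∀ x ∈ G4 f, Real.exp (-(vs u κ x) / 2) ^ 2 * (Real.exp β * ‖deriv f x‖) ^ 2 =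
      L * (1 + (Real.exp β * ‖f x‖) ^ 2) ^ 2 := by
    rintro x hx
    have e1 := hPh x hx
    have e2 := hfc x hx
    obtain ⟨⟨x1, x2⟩, x3, x4⟩ := hx
    have x5 : f x ≠ 0 := by rintro h; rw [h, zero_mul] at e2; exact hc e2.symm
    have hvx : Real.exp (-(vs u κ x) / 2) = κ * (Real.exp (-(u x) / 2) + Real.exp (-(u (-x)) / 2)) := by
      have := congrFun (hu_vs (u := u) hκ) x
      simp only [hu] at this
      exact_mod_cast this
    rw [Ph, Ph, div_eq_div_iff x2 x4] at e1
    have := sym_alg (κ := κ) (Real.exp_pos _) (Real.exp_pos _) (norm_pos_iff.2 x2) (norm_pos_iff.2 x4)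
      (norm_pos_iff.2 x5) hcp (hd2 x x1 x2) (hd2 (-x) x3 x4) (by rw [← e2, norm_mul])
      (by rw [← norm_mul, ← norm_mul, e1])
    rw [hvx, mul_pow (Real.exp β), mul_pow (Real.exp β), hE, one_div_mul_eq_div, one_div_mul_eq_div, this, hL]
  have hGev : ∀ z, ∀ᶠ x in 𝓝[≠] z, x ∈ G4 f := fun z => (hG z).and (ev_neg (hG (-z)) rfl)
  have hL8 : L = 1 / 8 := by
    obtain ⟨x, hx, hxS⟩ := ((hGev 0).and (SS_ev hb w 0)).exists
    have hop : ∀ᶠ y in 𝓝 x, y ∈ G4 f := by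
      obtain ⟨⟨x1, x2⟩, x3, x4⟩ := hx
      have o2 := (continuous_neg.tendsto x).eventually
        (x3.eventually_analyticAt.and (x3.deriv.continuousAt.eventually_ne x4))
      exact (x1.eventually_analyticAt.and (x1.deriv.continuousAt.eventually_ne x2)).and o2
    have := (devpot (L := (L : ℂ)) (f := fun z => (Real.exp β : ℂ) * f z) PV hxS (analyticAt_const.mul hx.1.1)
      (by rw [hdg]; exact mul_ne_zero (by exact_mod_cast hE0.ne') hx.1.2) (by
        rw [hdg]
        filter_upwards [hop] with y hy
        exact (dev_C (ng _).symm (ng _).symm).2 (hR y hy))).1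
    exact_mod_cast this.symm
  refine ⟨β, vs u κ, hv, ⟨fun z => (MeromorphicAt.const _ z).mul (hd.1 z), fun z z1 z2 => ?_⟩, hve⟩
  rw [hdg] at z2 ⊢
  have n0 : (Real.exp β : ℂ) ≠ 0 := by exact_mod_cast hE0.ne'
  have z3 : deriv f z ≠ 0 := fun h => z2 (by simp only [h, mul_zero])
  have z4 : AnalyticAt ℂ f z := by
    have := (analyticAt_const (v := (Real.exp β : ℂ)⁻¹)).mul z1
    refine this.congr (Eventually.of_forall fun x => ?_)
    simp only [Pi.mul_apply]
    rw [inv_mul_cancel_left₀ n0]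
  have zS : z ∉ SS b w := fun h => no_good_sing hd2 z4 z3 (hBl z h)
  simp only [ng]
  rw [dev_iff (by have := norm_pos_iff.2 z3; positivity)]
  have cv : ContinuousAt (vs u κ) z := by
    have := hv.2.2.1
    rw [sing_eq (Or.inr (Or.inr rfl)), ← hwk] at this
    exact ((this z zS).1 0).continuousAt
  have cf := z4.continuousAt
  have cf1 := z4.deriv.continuousAt
  have T1 : ContinuousAt (fun x => Real.exp (-(vs u κ x) / 2) ^ 2 * (Real.exp β * ‖deriv f x‖) ^ 2) z := by
    fun_prop
  have T2 : ContinuousAt (fun x => 1 / 8 * (1 + (Real.exp β * ‖f x‖) ^ 2) ^ 2) z := by fun_prop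
  refine tendsto_nhds_unique ((T1.mono_left nhdsWithin_le_nhds).congr' ?_) (T2.mono_left (nhdsWithin_le_nhds (s := {z}ᶜ)))
  filter_upwards [hGev z] with x hx
  rw [hR x hx, hL8]
end

/-- **Theorem (Statement 2).** For a rectangular torus `τ = ib`, `b > 0`: for `k = 1, 2`
equation `(★_k)` has no solutions at all, and for `k = 3` it has no non-even family of
solutions. -/
theorem statement2 (b : ℝ) (hb : 0 < b) :
    (¬ ∃ u : ℂ → ℝ, IsCurvatureSolution (Complex.I * (b : ℂ)) (starM 1) u) ∧
    (¬ ∃ u : ℂ → ℝ, IsCurvatureSolution (Complex.I * (b : ℂ)) (starM 2) u) ∧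
    ¬ HasNonEvenFamily (Complex.I * (b : ℂ)) (starM 3) := by
  exact ⟨case1 hb, case2 hb, case3 hb⟩
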